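/- arXiv:1512.03778 — 2 statements merged into one kernel-verified Lean document; each statement's English description precedes it below -/
import Mathlib

section
/- Suppose n ≥ 3, α ∈ (0,n), (n−α)/(n−2) ≤ λ < n/(n−2), and 0 ≤ σ < (2n−α)/(n−2) − λ. If u is a nonnegative solution of the Choquard–Pekar inequality problem, then u(x) = O(|x|^{2−n}) as x → 0. -/
open MeasureTheory Metric Filter Set Asymptotics Topology

/-- `ℝⁿ` as a Euclidean space. -/
abbrev Euc (n : ℕ) : Type := EuclideanSpace ℝ (Fin n)

/-- The Laplacian `Δu(x) = ∑ i ∂²u/∂xᵢ²(x)`. -/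
noncomputable def lap {n : ℕ} (u : Euc n → ℝ) (x : Euc n) : ℝ :=
  ∑ i : Fin n, iteratedFDeriv ℝ 2 u x ![EuclideanSpace.single i 1, EuclideanSpace.single i 1]

/-- `u` is a nonnegative solution of the Choquard–Pekar inequality problem:
`u ∈ C²(ℝⁿ \ {0}) ∩ L^λ(ℝⁿ)` and
`0 ≤ -Δu(x) ≤ (∫ |x-y|^(-α) u(y)^λ dy) · u(x)^σ` on `B₂(0) \ {0}`. -/
def IsCPSolution (n : ℕ) (α lam sig : ℝ) (u : Euc n → ℝ) : Prop :=
  (∀ x, 0 ≤ u x) ∧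
  ContDiffOn ℝ 2 u {0}ᶜ ∧
  Integrable (fun y => u y ^ lam) ∧
  ∀ x ∈ ball (0 : Euc n) 2 \ {0},
    0 ≤ -lap u x ∧
    -lap u x ≤ (∫ y, ‖x - y‖ ^ (-α) * u y ^ lam) * u x ^ sig

lemma integrable_mul_of_eq_zero_off_compact {n : ℕ} {s K : Set (Euc n)} (hs : IsOpen s)
    (hK : IsCompact K) (hKs : K ⊆ s) {w φ : Euc n → ℝ} (hw : ContinuousOn w s)
    (hφ : Continuous φ) (h0 : ∀ x, x ∉ K → φ x = 0) : Integrable (fun x => w x * φ x) := by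
  have hz : ∀ x, x ∉ K → w x * φ x = 0 := fun x hx => by simp [h0 x hx]
  have hc : Continuous (fun x => w x * φ x) := by
    rw [continuous_iff_continuousAt]
    intro x
    by_cases hx : x ∈ K
    · exact (hw.continuousAt (hs.mem_nhds (hKs hx))).mul hφ.continuousAt
    · have : (fun x => w x * φ x) =ᶠ[𝓝 x] fun _ => 0 := by
        filter_upwards [hK.isClosed.isOpen_compl.mem_nhds hx] with y hy using hz y hy
      exact continuousAt_const.congr this.symm
  exact hc.integrable_of_hasCompactSupport (HasCompactSupport.intro hK hz)

lemma lineDeriv_eq_zero_off_compact {n : ℕ} {K : Set (Euc n)}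
    (hK : IsCompact K) {φ φ' : Euc n → ℝ} {v : Euc n} (hφ : ∀ x, HasLineDerivAt ℝ φ (φ' x) x v)
    (h0 : ∀ x, x ∉ K → φ x = 0) : ∀ x, x ∉ K → φ' x = 0 := by
  intro x hx
  have h : φ =ᶠ[𝓝 x] fun _ => 0 := by
    filter_upwards [hK.isClosed.isOpen_compl.mem_nhds hx] with y hy using h0 y hy
  have h2 : HasLineDerivAt ℝ φ 0 x v :=
    ((hasFDerivAt_const (0 : ℝ) x).congr_of_eventuallyEq h).hasLineDerivAt v
  exact (hφ x).unique h2

lemma green_direction {n : ℕ} {s K : Set (Euc n)} (hs : IsOpen s)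
    (hK : IsCompact K) (hKs : K ⊆ s) {u : Euc n → ℝ} (hu : ContDiffOn ℝ 2 u s) (v : Euc n)
    {φ φ₁ φ₂ : Euc n → ℝ} (h0 : ∀ x, x ∉ K → φ x = 0)
    (h1 : ∀ x, HasLineDerivAt ℝ φ (φ₁ x) x v) (h2 : ∀ x, HasLineDerivAt ℝ φ₁ (φ₂ x) x v)
    (hφ : Continuous φ) (hφ₁ : Continuous φ₁) (hφ₂ : Continuous φ₂) :
    Integrable (fun x => u x * φ₂ x) ∧
    Integrable (fun x => iteratedFDeriv ℝ 2 u x ![v, v] * φ x) ∧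
    ∫ x, u x * φ₂ x = ∫ x, iteratedFDeriv ℝ 2 u x ![v, v] * φ x := by
  have h01 := lineDeriv_eq_zero_off_compact hK h1 h0
  have h02 := lineDeriv_eq_zero_off_compact hK h2 h01
  have sub0 : tsupport φ ⊆ K :=
    closure_minimal (fun x hx => by by_contra h; exact hx (h0 x h)) hK.isClosed
  have sub1 : tsupport φ₁ ⊆ K :=
    closure_minimal (fun x hx => by by_contra h; exact hx (h01 x h)) hK.isClosed
  have hfd : ContDiffOn ℝ 1 (fderiv ℝ u) s := hu.fderiv_of_isOpen hs (by norm_num)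
  have hfd2 : ContinuousOn (fderiv ℝ (fderiv ℝ u)) s := hfd.continuousOn_fderiv_of_isOpen hs le_rfl
  have hu1 : ContinuousOn (fun x => fderiv ℝ u x v) s := hfd.continuousOn.clm_apply continuousOn_const
  have hu2 : ContinuousOn (fun x => iteratedFDeriv ℝ 2 u x ![v, v]) s := by
    simp only [iteratedFDeriv_two_apply]
    exact (hfd2.clm_apply continuousOn_const).clm_apply continuousOn_const
  have d1 : ∀ x ∈ s, HasLineDerivAt ℝ u (fderiv ℝ u x v) x v := fun x hx =>
    (((hu.differentiableOn (by norm_num)) x hx).differentiableAt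
      (hs.mem_nhds hx)).hasFDerivAt.hasLineDerivAt v
  have d2 : ∀ x ∈ s, HasLineDerivAt ℝ (fun x => fderiv ℝ u x v)
      (iteratedFDeriv ℝ 2 u x ![v, v]) x v := fun x hx => by
    have := (((hfd.differentiableOn (by norm_num)) x hx).differentiableAt
      (hs.mem_nhds hx)).hasFDerivAt
    have h := (this.clm_apply (hasFDerivAt_const v x)).hasLineDerivAt v
    simpa [iteratedFDeriv_two_apply] using h
  have i1 := integrable_mul_of_eq_zero_off_compact hs hK hKs hu.continuousOn hφ₂ h02
  have i2 := integrable_mul_of_eq_zero_off_compact hs hK hKs hu2 hφ h0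
  have i3 := integrable_mul_of_eq_zero_off_compact hs hK hKs hu1 hφ₁ h01
  have i4 := integrable_mul_of_eq_zero_off_compact hs hK hKs hu.continuousOn hφ₁ h01
  have i5 := integrable_mul_of_eq_zero_off_compact hs hK hKs hu1 hφ h0
  refine ⟨i1, i2, ?_⟩
  have e1 := integral_bilinear_hasLineDerivAt_right_eq_neg_left_of_integrable (μ := volume)
    (B := ContinuousLinearMap.mul ℝ ℝ) (f := u) (g := φ₁) (f' := fun x => fderiv ℝ u x v) (g' := φ₂)
    (v := v) (by simpa using i3) (by simpa using i1) (by simpa using i4)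
    (fun x hx => d1 x (hKs (sub1 hx))) (fun x _ => h2 x)
  have e2 := integral_bilinear_hasLineDerivAt_right_eq_neg_left_of_integrable (μ := volume)
    (B := ContinuousLinearMap.mul ℝ ℝ) (f := fun x => fderiv ℝ u x v) (g := φ)
    (f' := fun x => iteratedFDeriv ℝ 2 u x ![v, v]) (g' := φ₁)
    (v := v) (by simpa using i2) (by simpa using i3) (by simpa using i5)
    (fun x hx => d2 x (hKs (sub0 hx))) (fun x _ => h1 x)
  simp only [ContinuousLinearMap.mul_apply'] at e1 e2
  rw [e1, e2, neg_neg]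

lemma green_radial {n : ℕ} {s K : Set (Euc n)} (hs : IsOpen s)
    (hK : IsCompact K) (hKs : K ⊆ s) {u : Euc n → ℝ} (hu : ContDiffOn ℝ 2 u s) (a : Euc n)
    {η : ℝ} (hη : 0 < η) {g g₁ g₂ : ℝ → ℝ} (hg : ∀ q, -η < q → HasDerivAt g (g₁ q) q)
    (hg₁ : ∀ q, -η < q → HasDerivAt g₁ (g₂ q) q) (hg₂ : ContinuousOn g₂ (Ioi (-η)))
    (h0 : ∀ x, x ∉ K → g (‖x - a‖ ^ 2) = 0) :
    Integrable (fun x => u x * (4 * ‖x - a‖ ^ 2 * g₂ (‖x - a‖ ^ 2) + 2 * n * g₁ (‖x - a‖ ^ 2))) ∧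
    Integrable (fun x => lap u x * g (‖x - a‖ ^ 2)) ∧
    ∫ x, u x * (4 * ‖x - a‖ ^ 2 * g₂ (‖x - a‖ ^ 2) + 2 * n * g₁ (‖x - a‖ ^ 2)) =
      ∫ x, lap u x * g (‖x - a‖ ^ 2) := by
  have hq : ∀ x : Euc n, -η < ‖x - a‖ ^ 2 := fun x => by nlinarith [sq_nonneg ‖x - a‖]
  have cq : Continuous fun x : Euc n => ‖x - a‖ ^ 2 := by fun_prop
  have cg : Continuous fun x : Euc n => g (‖x - a‖ ^ 2) := continuous_iff_continuousAt.2 fun x =>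
    ContinuousAt.comp (f := fun x : Euc n => ‖x - a‖ ^ 2) (hg _ (hq x)).continuousAt cq.continuousAt
  have cg₁ : Continuous fun x : Euc n => g₁ (‖x - a‖ ^ 2) := continuous_iff_continuousAt.2 fun x =>
    ContinuousAt.comp (f := fun x : Euc n => ‖x - a‖ ^ 2) (hg₁ _ (hq x)).continuousAt cq.continuousAt
  have cg₂ : Continuous fun x : Euc n => g₂ (‖x - a‖ ^ 2) := hg₂.comp_continuous cq hq
  have dq : ∀ (i : Fin n) (x : Euc n), HasLineDerivAt ℝ (fun x : Euc n => ‖x - a‖ ^ 2)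
      (2 * (x i - a i)) x (EuclideanSpace.single i 1) := fun i x => by
    have h := ((hasFDerivAt_id x).sub_const a).norm_sq.hasLineDerivAt (EuclideanSpace.single i 1)
    simpa [EuclideanSpace.inner_single_right] using h
  have dc : ∀ (i : Fin n) (x : Euc n), HasLineDerivAt ℝ (fun x : Euc n => 2 * (x i - a i))
      2 x (EuclideanSpace.single i 1) := fun i x => by
    have h := ((((EuclideanSpace.proj (𝕜 := ℝ) i).hasFDerivAt (x := x)).sub_const (a i)).const_mul
      2).hasLineDerivAt (EuclideanSpace.single i 1)
    simpa using h
  have cx : ∀ i : Fin n, Continuous fun x : Euc n => 2 * (x i - a i) := fun i => by fun_prop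
  have key := fun i : Fin n => green_direction hs hK hKs hu (EuclideanSpace.single i 1)
    (φ := fun x => g (‖x - a‖ ^ 2)) (φ₁ := fun x => g₁ (‖x - a‖ ^ 2) * (2 * (x i - a i)))
    (φ₂ := fun x => g₂ (‖x - a‖ ^ 2) * (2 * (x i - a i)) * (2 * (x i - a i)) + g₁ (‖x - a‖ ^ 2) * 2)
    h0
    (fun x => by
      have h := HasDerivAt.scomp (0 : ℝ) (h := fun t : ℝ => ‖x + t • EuclideanSpace.single i 1 - a‖ ^ 2)
        (g₁ := g) (g₁' := g₁ (‖x - a‖ ^ 2)) (by simpa using hg _ (hq x)) (dq i x)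
      simpa [HasLineDerivAt, mul_comm, Function.comp_def] using h)
    (fun x => by
      have h := HasDerivAt.scomp (0 : ℝ) (h := fun t : ℝ => ‖x + t • EuclideanSpace.single i 1 - a‖ ^ 2)
        (g₁ := g₁) (g₁' := g₂ (‖x - a‖ ^ 2)) (by simpa using hg₁ _ (hq x)) (dq i x)
      refine (HasDerivAt.mul h (dc i x)).congr_deriv ?_
      simp only [smul_eq_mul, zero_smul, add_zero, Function.comp_apply]
      ring)
    cg (cg₁.mul (cx i)) (((cg₂.mul (cx i)).mul (cx i)).add (cg₁.mul continuous_const))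
  have e : ∀ x, u x * (4 * ‖x - a‖ ^ 2 * g₂ (‖x - a‖ ^ 2) + 2 * n * g₁ (‖x - a‖ ^ 2)) =
      ∑ i : Fin n, u x * (g₂ (‖x - a‖ ^ 2) * (2 * (x i - a i)) * (2 * (x i - a i))
        + g₁ (‖x - a‖ ^ 2) * 2) := fun x => by
    have hsum : ‖x - a‖ ^ 2 = ∑ i : Fin n, (x i - a i) ^ 2 := by
      simp [EuclideanSpace.real_norm_sq_eq]
    generalize g₂ (‖x - a‖ ^ 2) = b₂
    generalize g₁ (‖x - a‖ ^ 2) = b₁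
    rw [← Finset.mul_sum, Finset.sum_add_distrib, hsum, Finset.mul_sum, Finset.sum_mul]
    congr 2
    · exact Finset.sum_congr rfl fun i _ => by ring
    · simp; ring
  have e' : ∀ x, lap u x * g (‖x - a‖ ^ 2) = ∑ i : Fin n, iteratedFDeriv ℝ 2 u x
      ![EuclideanSpace.single i 1, EuclideanSpace.single i 1] * g (‖x - a‖ ^ 2) := fun x => by
    rw [lap, Finset.sum_mul]
  simp only [e, e']
  refine ⟨integrable_finsetSum _ fun i _ => (key i).1,
    integrable_finsetSum _ fun i _ => (key i).2.1, ?_⟩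
  rw [integral_finsetSum _ fun i _ => (key i).1, integral_finsetSum _ fun i _ => (key i).2.1]
  exact Finset.sum_congr rfl fun i _ => (key i).2.2

lemma continuousOn_lap {n : ℕ} {s : Set (Euc n)} (hs : IsOpen s) {u : Euc n → ℝ}
    (hu : ContDiffOn ℝ 2 u s) : ContinuousOn (lap u) s := by
  have hfd : ContDiffOn ℝ 1 (fderiv ℝ u) s := hu.fderiv_of_isOpen hs (by norm_num)
  have hfd2 : ContinuousOn (fderiv ℝ (fderiv ℝ u)) s := hfd.continuousOn_fderiv_of_isOpen hs le_rfl
  unfold lap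
  refine continuousOn_finsetSum _ fun i _ => ?_
  simp only [iteratedFDeriv_two_apply]
  exact (hfd2.clm_apply continuousOn_const).clm_apply continuousOn_const

lemma hasDerivAt_max_zero_pow (k : ℕ) (x : ℝ) :
    HasDerivAt (fun x : ℝ => max x 0 ^ (k + 2)) ((k + 2 : ℝ) * max x 0 ^ (k + 1)) x := by
  rcases lt_trichotomy x 0 with hx | rfl | hx
  · have h : (fun x : ℝ => max x 0 ^ (k + 2)) =ᶠ[𝓝 x] fun _ => 0 := by
      filter_upwards [gt_mem_nhds hx] with y hy
      simp [max_eq_right hy.le]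
    refine ((hasDerivAt_const x (0 : ℝ)).congr_of_eventuallyEq h).congr_deriv ?_
    simp [max_eq_right hx.le]
  · rw [hasDerivAt_iff_isLittleO]
    simp only [max_self, ne_eq, Nat.add_eq_zero_iff, one_ne_zero, and_false, not_false_eq_true,
      zero_pow, mul_zero, smul_zero, sub_zero, OfNat.ofNat_ne_zero]
    refine IsBigO.trans_isLittleO (g := fun x : ℝ => x ^ (k + 2)) ?_
      (isLittleO_pow_id (by omega))
    refine IsBigO.of_bound 1 (Eventually.of_forall fun y => ?_)
    rw [norm_pow, norm_pow, one_mul]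
    refine pow_le_pow_left₀ (norm_nonneg _) ?_ _
    rw [Real.norm_eq_abs, Real.norm_eq_abs, abs_of_nonneg (le_max_right y 0)]
    exact max_le (le_abs_self y) (abs_nonneg y)
  · have h : (fun x : ℝ => max x 0 ^ (k + 2)) =ᶠ[𝓝 x] fun x => x ^ (k + 2) := by
      filter_upwards [lt_mem_nhds hx] with y hy
      simp [max_eq_left hy.le]
    refine ((hasDerivAt_pow (k + 2) x).congr_of_eventuallyEq h).congr_deriv ?_
    simp [max_eq_left hx.le]

/-- A `C²` cutoff equal to one on `(-∞, 1]` and to zero on `[2, ∞)`. -/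
lemma exists_cutoff : ∃ (χ χ₁ χ₂ : ℝ → ℝ) (C : ℝ), 0 ≤ C ∧ (∀ t, HasDerivAt χ (χ₁ t) t) ∧
    (∀ t, HasDerivAt χ₁ (χ₂ t) t) ∧ Continuous χ₂ ∧ (∀ t, 0 ≤ χ t ∧ χ t ≤ 1) ∧
    (∀ t, |χ₁ t| ≤ C ∧ |χ₂ t| ≤ C) ∧ (∀ t ≤ 1, χ t = 1 ∧ χ₁ t = 0 ∧ χ₂ t = 0) ∧
    (∀ t ≥ 2, χ t = 0 ∧ χ₁ t = 0 ∧ χ₂ t = 0) := by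
  have hs : ContDiff ℝ 2 (fun t : ℝ => Real.smoothTransition (2 - t)) :=
    Real.smoothTransition.contDiff.comp (contDiff_const.sub contDiff_id)
  set χ : ℝ → ℝ := fun t : ℝ => Real.smoothTransition (2 - t) with hχ
  have hs1 : ContDiff ℝ 1 (deriv χ) := ((contDiff_succ_iff_deriv (n := 1)).1 hs).2.2
  have hs2 : Continuous (deriv (deriv χ)) := hs1.continuous_deriv le_rfl
  have step : ∀ (f : ℝ → ℝ) (c : ℝ) (U : Set ℝ), IsOpen U → (∀ t ∈ U, f t = c) →
      ∀ t ∈ U, deriv f t = 0 := fun f c U hU h t ht => by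
    have : f =ᶠ[𝓝 t] fun _ => c := by filter_upwards [hU.mem_nhds ht] with y hy using h y hy
    rw [this.deriv_eq]; simp
  have cl : ∀ (f : ℝ → ℝ) (U : Set ℝ), Continuous f → (∀ t ∈ U, f t = 0) →
      ∀ t ∈ closure U, f t = 0 := fun f U hf h t ht =>
    closure_minimal (t := {t | f t = 0}) h (isClosed_eq hf continuous_const) ht
  have l0 : ∀ t ≤ 1, χ t = 1 := fun t ht => Real.smoothTransition.one_of_one_le (by linarith)
  have r0 : ∀ t ≥ 2, χ t = 0 := fun t ht => Real.smoothTransition.zero_of_nonpos (by linarith)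
  have l1' := step χ 1 (Iio 1) isOpen_Iio fun t ht => l0 t (le_of_lt ht)
  have r1' := step χ 0 (Ioi 2) isOpen_Ioi fun t ht => r0 t (le_of_lt ht)
  have l2' := step _ 0 (Iio 1) isOpen_Iio l1'
  have r2' := step _ 0 (Ioi 2) isOpen_Ioi r1'
  have l1 := cl _ _ hs1.continuous l1'
  have r1 := cl _ _ hs1.continuous r1'
  have l2 := cl _ _ hs2 l2'
  have r2 := cl _ _ hs2 r2'
  rw [closure_Iio] at l1 l2
  rw [closure_Ioi] at r1 r2
  obtain ⟨C₁, hC₁⟩ := (isCompact_Icc (a := (1 : ℝ)) (b := 2)).exists_bound_of_continuousOn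
    hs1.continuous.continuousOn
  obtain ⟨C₂, hC₂⟩ := (isCompact_Icc (a := (1 : ℝ)) (b := 2)).exists_bound_of_continuousOn
    hs2.continuousOn
  have h0 : 0 ≤ C₁ := (norm_nonneg _).trans (hC₁ 1 (by simp))
  have h0' : 0 ≤ C₂ := (norm_nonneg _).trans (hC₂ 1 (by simp))
  refine ⟨χ, deriv χ, deriv (deriv χ), C₁ + C₂, by positivity,
    fun t => (hs.differentiable (by norm_num) t).hasDerivAt,
    fun t => (hs1.differentiable (by norm_num) t).hasDerivAt, hs2,
    fun t => ⟨Real.smoothTransition.nonneg _, Real.smoothTransition.le_one _⟩, fun t => ?_,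
    fun t ht => ⟨l0 t ht, l1 t ht, l2 t ht⟩, fun t ht => ⟨r0 t ht, r1 t ht, r2 t ht⟩⟩
  rcases le_total t 1 with h | h
  · rw [l1 t h, l2 t h]; simp; positivity
  rcases le_total 2 t with h' | h'
  · rw [r1 t h', r2 t h']; simp; positivity
  · exact ⟨(hC₁ t ⟨h, h'⟩).trans (by linarith), (hC₂ t ⟨h, h'⟩).trans (by linarith)⟩

lemma hasDerivAt_shift_rpow {η q : ℝ} (hq : -η < q) (p : ℝ) :
    HasDerivAt (fun q : ℝ => (q + η) ^ p) (p * (q + η) ^ (p - 1)) q := by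
  have h := ((hasDerivAt_id q).add_const η).rpow_const (p := p) (Or.inl (by simp; linarith))
  simpa using h

lemma hasDerivAt_mul_cutoff {k k₁ χ χ₁ : ℝ → ℝ} {b q : ℝ} (hk : HasDerivAt k (k₁ q) q)
    (hχ : HasDerivAt χ (χ₁ (b * q)) (b * q)) :
    HasDerivAt (fun q => k q * χ (b * q)) (k₁ q * χ (b * q) + b * (k q * χ₁ (b * q))) q := by
  have h := hk.mul (HasDerivAt.comp q (h := fun q => b * q) (h₂ := χ) hχ
    ((hasDerivAt_id q).const_mul b))
  refine h.congr_deriv ?_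
  simp
  ring

/-- The cut off, regularised fundamental solution, as a function of `q = |x|²`. -/
lemma exists_fundamental_test {m : ℝ} (hm : 0 < m) : ∃ C : ℝ, 0 ≤ C ∧ ∀ R η : ℝ, 0 < R → 0 < η →
    ∃ g g₁ g₂ : ℝ → ℝ, (∀ q, -η < q → HasDerivAt g (g₁ q) q) ∧
      (∀ q, -η < q → HasDerivAt g₁ (g₂ q) q) ∧ ContinuousOn g₂ (Ioi (-η)) ∧
      (∀ q ≥ 0, 0 ≤ g q) ∧ (∀ q > 0, g q ≤ q ^ (-m)) ∧ (∀ q ≥ R, g q = 0) ∧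
      (∀ q ≥ R, 4 * q * g₂ q + 2 * (2 * m + 2) * g₁ q = 0) ∧
      (∀ q ≥ 0, 4 * q * g₂ q + 2 * (2 * m + 2) * g₁ q ≤ C * R ^ (-m - 1)) ∧
      (∀ q ≥ 0, q ≤ R / 2 → 4 * q * g₂ q + 2 * (2 * m + 2) * g₁ q =
        -(4 * m * (m + 1) * η * (q + η) ^ (-m - 2))) := by
  obtain ⟨χ, χ₁, χ₂, C, hC, d1, d2, c2, hb, hbd, hl, hr⟩ := exists_cutoff
  refine ⟨(16 * m + 16 + 4 * (2 * m + 2)) * C * (1 / 2) ^ (-m), by positivity,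
    fun R η hR hη => ?_⟩
  set b := 2 / R with hbdef
  have hb0 : 0 < b := by positivity
  set k : ℝ → ℝ := fun q => (q + η) ^ (-m) with hk
  set k₁ : ℝ → ℝ := fun q => -m * (q + η) ^ (-m - 1) with hk₁
  set k₂ : ℝ → ℝ := fun q => m * (m + 1) * (q + η) ^ (-m - 2) with hk₂
  have e1 : ∀ q, -η < q → HasDerivAt k (k₁ q) q := fun q hq => hasDerivAt_shift_rpow hq _
  have e2 : ∀ q, -η < q → HasDerivAt k₁ (k₂ q) q := fun q hq => by
    refine ((hasDerivAt_shift_rpow hq (-m - 1)).const_mul (-m)).congr_deriv ?_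
    simp only [hk₂]
    rw [show -m - 1 - 1 = -m - 2 by ring]; ring
  have ck₂ : ContinuousOn k₂ (Ioi (-η)) := fun q hq => by
    refine ((hasDerivAt_shift_rpow hq (-m - 2)).continuousAt.const_mul (m * (m + 1))).continuousWithinAt
  have ck₁ : ContinuousOn k₁ (Ioi (-η)) := fun q hq => (e2 q hq).continuousAt.continuousWithinAt
  have ck : ContinuousOn k (Ioi (-η)) := fun q hq => (e1 q hq).continuousAt.continuousWithinAt
  have cχ₁ : Continuous χ₁ := continuous_iff_continuousAt.2 fun t => (d2 t).continuousAt
  have cχ : Continuous χ := continuous_iff_continuousAt.2 fun t => (d1 t).continuousAt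
  set g : ℝ → ℝ := fun q => k q * χ (b * q)
  set g₁ : ℝ → ℝ := fun q => k₁ q * χ (b * q) + b * (k q * χ₁ (b * q))
  set g₂ : ℝ → ℝ := fun q => (k₂ q * χ (b * q) + b * (k₁ q * χ₁ (b * q))) +
    b * (k₁ q * χ₁ (b * q) + b * (k q * χ₂ (b * q)))
  have hbq : ∀ q ≥ R, 2 ≤ b * q := fun q hq => by
    rw [hbdef, div_mul_eq_mul_div, le_div_iff₀ hR]; linarith
  have hlow : ∀ q ≥ 0, q ≤ R / 2 → 4 * q * g₂ q + 2 * (2 * m + 2) * g₁ q =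
        -(4 * m * (m + 1) * η * (q + η) ^ (-m - 2)) := fun q hq hqR => by
    have : b * q ≤ 1 := by rw [hbdef, div_mul_eq_mul_div, div_le_iff₀ hR]; linarith
    obtain ⟨h0, h1, h2⟩ := hl _ this
    simp only [g₁, g₂, h0, h1, h2, k₁, k₂]
    have : (q + η) ^ (-m - 1) = (q + η) ^ (-m - 2) * (q + η) := by
      rw [← Real.rpow_add_one (by positivity)]; congr 1; ring
    rw [this]; ring
  refine ⟨g, g₁, g₂, fun q hq => hasDerivAt_mul_cutoff (e1 q hq) (d1 _), fun q hq =>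
    (hasDerivAt_mul_cutoff (e2 q hq) (d1 _)).add
      ((hasDerivAt_mul_cutoff (e1 q hq) (d2 _)).const_mul b), ?_, ?_, ?_, ?_, ?_, ?_, hlow⟩
  · fun_prop
  · intro q hq
    exact mul_nonneg (Real.rpow_nonneg (by linarith) _) (hb _).1
  · intro q hq
    calc g q ≤ k q * 1 := mul_le_mul_of_nonneg_left (hb _).2 (Real.rpow_nonneg (by linarith) _)
      _ ≤ q ^ (-m) := by
        rw [mul_one]
        exact Real.rpow_le_rpow_of_nonpos hq (by linarith) (by linarith)
  · intro q hq
    simp [g, (hr _ (hbq q hq)).1]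
  · intro q hq
    obtain ⟨h0, h1, h2⟩ := hr _ (hbq q hq)
    simp [g₁, g₂, h0, h1, h2]
  · intro q hq
    rcases le_total q (R / 2) with h | h
    · rw [hlow q hq h]
      have : 0 ≤ (q + η) ^ (-m - 2) := Real.rpow_nonneg (by linarith) _
      have h3 : 0 ≤ 4 * m * (m + 1) * η * (q + η) ^ (-m - 2) := by positivity
      have h4 : 0 ≤ (16 * m + 16 + 4 * (2 * m + 2)) * C * (1 / 2) ^ (-m) * R ^ (-m - 1) := by
        positivity
      linarith
    rcases le_total R q with h' | h'
    · obtain ⟨h0, h1, h2⟩ := hr _ (hbq q h')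
      have h4 : 0 ≤ (16 * m + 16 + 4 * (2 * m + 2)) * C * (1 / 2) ^ (-m) * R ^ (-m - 1) := by
        positivity
      simpa [g₁, g₂, h0, h1, h2] using h4
    have hq0 : 0 < q := by linarith
    obtain ⟨b1, b2⟩ := hbd (b * q)
    obtain ⟨b3, b4⟩ := hb (b * q)
    have bq2 : b * q ≤ 2 := by rw [hbdef, div_mul_eq_mul_div, div_le_iff₀ hR]; linarith
    have kq : k q ≤ (1 / 2) ^ (-m) * R ^ (-m) := by
      rw [← Real.mul_rpow (by norm_num) hR.le]
      exact Real.rpow_le_rpow_of_nonpos (by positivity) (by linarith) (by linarith)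
    have k0 : 0 ≤ k q := Real.rpow_nonneg (by linarith) _
    have k1q : q * (-k₁ q) ≤ m * k q := by
      simp only [k₁, k]
      have h5 : (q + η) ^ (-m) = (q + η) ^ (-m - 1) * (q + η) := by
        rw [← Real.rpow_add_one (by positivity)]; congr 1; ring
      have : 0 ≤ (q + η) ^ (-m - 1) := Real.rpow_nonneg (by linarith) _
      rw [h5]
      nlinarith [mul_nonneg (mul_nonneg hm.le this) hη.le]
    have k1n : 0 ≤ -k₁ q := by
      simp only [k₁]
      have : 0 ≤ (q + η) ^ (-m - 1) := Real.rpow_nonneg (by linarith) _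
      nlinarith
    have main : 4 * q * k₂ q + 2 * (2 * m + 2) * k₁ q ≤ 0 := by
      simp only [k₁, k₂]
      have h5 : (q + η) ^ (-m - 1) = (q + η) ^ (-m - 2) * (q + η) := by
        rw [← Real.rpow_add_one (by positivity)]; congr 1; ring
      have : 0 ≤ (q + η) ^ (-m - 2) := Real.rpow_nonneg (by linarith) _
      rw [h5]
      have h3 : 0 ≤ 4 * m * (m + 1) * η * (q + η) ^ (-m - 2) := by positivity
      linarith
    have t1 : 8 * b * (q * (-k₁ q)) * (-χ₁ (b * q)) ≤ 8 * b * (m * k q) * C := by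
      have : -χ₁ (b * q) ≤ C := (neg_le_abs _).trans b1
      calc _ ≤ 8 * b * (q * (-k₁ q)) * C := by gcongr
        _ ≤ _ := by gcongr
    have t2 : 4 * (b * q) * b * k q * χ₂ (b * q) ≤ 4 * 2 * b * k q * C := by
      have : χ₂ (b * q) ≤ C := (le_abs_self _).trans b2
      calc _ ≤ 4 * (b * q) * b * k q * C := by gcongr
        _ ≤ _ := by gcongr
    have t3 : 2 * (2 * m + 2) * b * k q * χ₁ (b * q) ≤ 2 * (2 * m + 2) * b * k q * C := by
      have : χ₁ (b * q) ≤ C := (le_abs_self _).trans b1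
      gcongr
    have t4 := mul_nonneg b3 (neg_nonneg.2 main)
    have hR1 : R ^ (-m) * b = 2 * R ^ (-m - 1) := by
      have : R ^ (-m) = R ^ (-m - 1) * R := by
        rw [← Real.rpow_add_one (by positivity)]; congr 1; ring
      rw [this, hbdef]; field_simp
    have t5 : (8 * m + 8 + 2 * (2 * m + 2)) * C * b * k q ≤
        (8 * m + 8 + 2 * (2 * m + 2)) * C * b * ((1 / 2) ^ (-m) * R ^ (-m)) := by gcongr
    have t6 : (8 * m + 8 + 2 * (2 * m + 2)) * C * b * ((1 / 2) ^ (-m) * R ^ (-m)) =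
        (16 * m + 16 + 4 * (2 * m + 2)) * C * (1 / 2) ^ (-m) * R ^ (-m - 1) := by
      linear_combination (8 * m + 8 + 2 * (2 * m + 2)) * C * ((1 / 2) ^ (-m)) * hR1
    simp only [g₁, g₂]
    linarith

/-- Radial test functions supported in a shell, as functions of `q = |x|²`, subharmonic on the unit
ball. -/
lemma exists_shell_test {m : ℝ} (hm : 0 < m) : ∃ c C : ℝ, 0 < c ∧ 0 ≤ C ∧
    ∀ R : ℝ, 0 < R → R ≤ 1 / 9 → ∃ (η : ℝ) (g g₁ g₂ : ℝ → ℝ), 0 < η ∧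
      (∀ q, -η < q → HasDerivAt g (g₁ q) q) ∧
      (∀ q, -η < q → HasDerivAt g₁ (g₂ q) q) ∧ ContinuousOn g₂ (Ioi (-η)) ∧
      (∀ q ≥ 0, 0 ≤ g q) ∧ (∀ q ≥ R, q ≤ 1 → 1 / 8 ≤ g q) ∧
      (∀ q ≥ 0, q ≤ η → g q = 0) ∧ (∀ q ≥ 2, g q = 0) ∧
      (∀ q ≥ 2, 4 * q * g₂ q + 2 * (2 * m + 2) * g₁ q = 0) ∧
      (∀ q ≥ 0, q ≤ 1 → 0 ≤ 4 * q * g₂ q + 2 * (2 * m + 2) * g₁ q) ∧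
      (∀ q ≥ R, q ≤ 9 * R → c / R ≤ 4 * q * g₂ q + 2 * (2 * m + 2) * g₁ q) ∧
      (∀ q ≥ 1, q ≤ 2 → -C ≤ 4 * q * g₂ q + 2 * (2 * m + 2) * g₁ q) := by
  obtain ⟨χ, χ₁, χ₂, C, hC, d1, d2, c2, hb, hbd, hl, hr⟩ := exists_cutoff
  refine ⟨3 * m ^ 2 * ((10 : ℝ) ^ (-m - 1)) ^ 2, (48 * m + 8 + 2 * (2 * m + 2)) * C, by positivity,
    by positivity, fun R hR hR9 => ?_⟩
  set ε := R ^ m / 2 with hε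
  have hRm : 0 < R ^ m := Real.rpow_pos_of_pos hR m
  have hε0 : 0 < ε := by positivity
  have hRm1 : R ^ m ≤ 1 := Real.rpow_le_one hR.le (by linarith) hm.le
  set η := ε ^ (1 / m) / 2 with hηdef
  have hη : 0 < η := by positivity
  have hηR : η ≤ R := by
    have : ε ^ (1 / m) ≤ (R ^ m) ^ (1 / m) :=
      Real.rpow_le_rpow hε0.le (by linarith) (by positivity)
    rw [← Real.rpow_mul hR.le, mul_one_div_cancel hm.ne', Real.rpow_one] at this
    have h0 : 0 < ε ^ (1 / m) := by positivity
    linarith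
  have hη2 : ε * (2 * η) ^ (-m) = 1 := by
    have : 2 * η = ε ^ (1 / m) := by rw [hηdef]; ring
    rw [this, ← Real.rpow_mul hε0.le, show 1 / m * -m = -1 by field_simp, Real.rpow_neg_one,
      mul_inv_cancel₀ hε0.ne']
  set k : ℝ → ℝ := fun q => (q + η) ^ (-m) with hk
  set k₁ : ℝ → ℝ := fun q => -m * (q + η) ^ (-m - 1) with hk₁
  set k₂ : ℝ → ℝ := fun q => m * (m + 1) * (q + η) ^ (-m - 2) with hk₂
  have e1 : ∀ q, -η < q → HasDerivAt k (k₁ q) q := fun q hq => hasDerivAt_shift_rpow hq _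
  have e2 : ∀ q, -η < q → HasDerivAt k₁ (k₂ q) q := fun q hq => by
    refine ((hasDerivAt_shift_rpow hq (-m - 1)).const_mul (-m)).congr_deriv ?_
    simp only [hk₂]
    rw [show -m - 1 - 1 = -m - 2 by ring]; ring
  have ck₂ : ContinuousOn k₂ (Ioi (-η)) := fun q hq => by
    refine ((hasDerivAt_shift_rpow hq (-m - 2)).continuousAt.const_mul (m * (m + 1))).continuousWithinAt
  have ck₁ : ContinuousOn k₁ (Ioi (-η)) := fun q hq => (e2 q hq).continuousAt.continuousWithinAt
  have ck : ContinuousOn k (Ioi (-η)) := fun q hq => (e1 q hq).continuousAt.continuousWithinAt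
  have cχ₁ : Continuous χ₁ := continuous_iff_continuousAt.2 fun t => (d2 t).continuousAt
  have cχ : Continuous χ := continuous_iff_continuousAt.2 fun t => (d1 t).continuousAt
  set P : ℝ → ℝ := fun q => max (1 - ε * k q) 0 with hP
  have cP : ContinuousOn P (Ioi (-η)) := by simp only [hP]; fun_prop
  have l1 : ∀ q, -η < q → HasDerivAt (fun q => 1 - ε * k q) (-(ε * k₁ q)) q := fun q hq => by
    simpa using ((e1 q hq).const_mul ε).const_sub 1
  set G : ℝ → ℝ := fun q => P q ^ 3
  set G₁ : ℝ → ℝ := fun q => 3 * P q ^ 2 * -(ε * k₁ q)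
  set G₂ : ℝ → ℝ := fun q => 3 * (2 * P q * -(ε * k₁ q)) * -(ε * k₁ q) + 3 * P q ^ 2 * -(ε * k₂ q)
  have f1 : ∀ q, -η < q → HasDerivAt G (G₁ q) q := fun q hq => by
    have h := HasDerivAt.comp q (h := fun q => 1 - ε * k q) (hasDerivAt_max_zero_pow 1 _) (l1 q hq)
    refine h.congr_deriv ?_
    simp only [G₁, P]; norm_num
  have f2 : ∀ q, -η < q → HasDerivAt G₁ (G₂ q) q := fun q hq => by
    have h := HasDerivAt.comp q (h := fun q => 1 - ε * k q) (hasDerivAt_max_zero_pow 0 _) (l1 q hq)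
    have h2 := (h.const_mul 3).mul ((e2 q hq).const_mul ε).neg
    refine h2.congr_deriv ?_
    simp only [G₂, P, Function.comp]; norm_num
  have cG₂ : ContinuousOn G₂ (Ioi (-η)) := by simp only [G₂]; fun_prop
  have cG₁ : ContinuousOn G₁ (Ioi (-η)) := by simp only [G₁]; fun_prop
  have cG : ContinuousOn G (Ioi (-η)) := by simp only [G]; fun_prop
  set g : ℝ → ℝ := fun q => G q * χ (1 * q)
  set g₁ : ℝ → ℝ := fun q => G₁ q * χ (1 * q) + 1 * (G q * χ₁ (1 * q))
  set g₂ : ℝ → ℝ := fun q => (G₂ q * χ (1 * q) + 1 * (G₁ q * χ₁ (1 * q))) +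
    1 * (G₁ q * χ₁ (1 * q) + 1 * (G q * χ₂ (1 * q)))
  have P0 : ∀ q, 0 ≤ P q := fun q => le_max_right _ _
  have P1 : ∀ q ≥ 0, P q ≤ 1 := fun q hq => max_le (by
    have : 0 ≤ k q := Real.rpow_nonneg (by linarith) _
    nlinarith) zero_le_one
  have Phalf : ∀ q ≥ R, 1 / 2 ≤ P q := fun q hq => by
    refine le_max_of_le_left ?_
    have h1 : k q ≤ R ^ (-m) := Real.rpow_le_rpow_of_nonpos hR (by linarith) (by linarith)
    have h2 : ε * R ^ (-m) = 1 / 2 := by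
      rw [hε, Real.rpow_neg hR.le]; field_simp
    nlinarith
  have main : ∀ q ≥ 0, 24 * q * P q * (ε * k₁ q) ^ 2 ≤ 4 * q * G₂ q + 2 * (2 * m + 2) * G₁ q :=
    fun q hq => by
    have h : 4 * q * k₂ q + 2 * (2 * m + 2) * k₁ q ≤ 0 := by
      simp only [k₁, k₂]
      have h5 : (q + η) ^ (-m - 1) = (q + η) ^ (-m - 2) * (q + η) := by
        rw [← Real.rpow_add_one (by positivity)]; congr 1; ring
      have : 0 ≤ (q + η) ^ (-m - 2) := Real.rpow_nonneg (by linarith) _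
      rw [h5]
      have h3 : 0 ≤ 4 * m * (m + 1) * η * (q + η) ^ (-m - 2) := by positivity
      linarith
    have h4 : 0 ≤ 3 * P q ^ 2 * ε * -(4 * q * k₂ q + 2 * (2 * m + 2) * k₁ q) :=
      mul_nonneg (by positivity) (by linarith)
    simp only [G₁, G₂]
    linarith
  have inner : ∀ q ≤ 1, 4 * q * g₂ q + 2 * (2 * m + 2) * g₁ q =
      4 * q * G₂ q + 2 * (2 * m + 2) * G₁ q := fun q hq => by
    obtain ⟨h0, h1, h2⟩ := hl (1 * q) (by linarith)
    simp only [g₁, g₂, h0, h1, h2]; ring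
  refine ⟨η, g, g₁, g₂, hη, fun q hq => hasDerivAt_mul_cutoff (f1 q hq) (d1 _), fun q hq =>
    (hasDerivAt_mul_cutoff (f2 q hq) (d1 _)).add
      ((hasDerivAt_mul_cutoff (f1 q hq) (d2 _)).const_mul 1), ?_, ?_, ?_, ?_, ?_, ?_, ?_, ?_, ?_⟩
  · fun_prop
  · intro q hq
    exact mul_nonneg (pow_nonneg (P0 q) 3) (hb _).1
  · intro q hq hq1
    simp only [g, G, (hl (1 * q) (by linarith)).1, mul_one]
    calc (1 / 8 : ℝ) = (1 / 2) ^ 3 := by norm_num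
      _ ≤ P q ^ 3 := pow_le_pow_left₀ (by norm_num) (Phalf q hq) 3
  · intro q hq hqη
    have : P q = 0 := max_eq_right (by
      have h1 : (2 * η) ^ (-m) ≤ k q :=
        Real.rpow_le_rpow_of_nonpos (by linarith) (by linarith) (by linarith)
      nlinarith)
    simp [g, G, this]
  · intro q hq
    simp only [g, (hr (1 * q) (by linarith)).1, mul_zero]
  · intro q hq
    obtain ⟨h0, h1, h2⟩ := hr (1 * q) (by linarith)
    simp only [g₁, g₂, h0, h1, h2]; ring
  · intro q hq hq1
    rw [inner q hq1]
    refine le_trans ?_ (main q hq)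
    have := P0 q
    positivity
  · intro q hq hq9
    rw [inner q (by linarith)]
    refine le_trans ?_ (main q (by linarith))
    have h1 : (10 * R) ^ (-m - 1) ≤ (q + η) ^ (-m - 1) :=
      Real.rpow_le_rpow_of_nonpos (by linarith) (by linarith) (by linarith)
    rw [Real.mul_rpow (by norm_num) hR.le] at h1
    have h2 : ε * R ^ (-m - 1) = 1 / 2 * R⁻¹ := by
      rw [hε, show -m - 1 = -m + -1 by ring, Real.rpow_add hR, Real.rpow_neg hR.le,
        Real.rpow_neg_one]; field_simp
    have h3 : m * (10 : ℝ) ^ (-m - 1) * (1 / 2 * R⁻¹) ≤ -(ε * k₁ q) := by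
      rw [← h2]
      simp only [k₁]
      calc _ = m * ε * ((10 : ℝ) ^ (-m - 1) * R ^ (-m - 1)) := by ring
        _ ≤ m * ε * (q + η) ^ (-m - 1) := by gcongr
        _ = _ := by ring
    have h4 : (m * (10 : ℝ) ^ (-m - 1) * (1 / 2 * R⁻¹)) ^ 2 ≤ (ε * k₁ q) ^ 2 := by
      rw [← neg_sq (ε * k₁ q)]
      exact pow_le_pow_left₀ (by positivity) h3 2
    calc _ = 24 * R * (1 / 2) * (m * (10 : ℝ) ^ (-m - 1) * (1 / 2 * R⁻¹)) ^ 2 := by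
          field_simp; norm_num
      _ ≤ 24 * q * P q * (ε * k₁ q) ^ 2 := by
          have h5 := Phalf q hq
          have h6 : 0 ≤ q := by linarith
          gcongr
  · intro q hq hq2
    obtain ⟨b1, b2⟩ := hbd (1 * q)
    obtain ⟨b3, b4⟩ := hb (1 * q)
    have q0 : 0 ≤ q := by linarith
    have s0 : 0 ≤ (q + η) ^ (-m - 1) := Real.rpow_nonneg (by linarith) _
    have s1 : (q + η) ^ (-m - 1) ≤ 1 := Real.rpow_le_one_of_one_le_of_nonpos (by linarith) (by linarith)
    have hG0 : 0 ≤ G q := pow_nonneg (P0 q) 3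
    have hG1 : G q ≤ 1 := pow_le_one₀ (P0 q) (P1 q q0)
    have hk0 : 0 ≤ -(ε * k₁ q) := by
      simp only [k₁]
      have : 0 ≤ ε * (m * (q + η) ^ (-m - 1)) := by positivity
      linarith
    have hk1 : -(ε * k₁ q) ≤ m := by
      simp only [k₁]
      have : ε * (m * (q + η) ^ (-m - 1)) ≤ 1 * (m * 1) := by gcongr; linarith
      linarith
    have hG₁0 : 0 ≤ G₁ q := mul_nonneg (by positivity) hk0
    have hG₁1 : G₁ q ≤ 3 * m := by
      have : P q ^ 2 ≤ 1 := pow_le_one₀ (P0 q) (P1 q q0)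
      calc G₁ q ≤ 3 * 1 * m := by simp only [G₁]; gcongr
        _ = _ := by ring
    have t1 : 8 * (q * G₁ q) * -χ₁ (1 * q) ≤ 8 * (2 * (3 * m)) * C := by
      have : -χ₁ (1 * q) ≤ C := (neg_le_abs _).trans b1
      calc _ ≤ 8 * (q * G₁ q) * C := by gcongr
        _ ≤ _ := by gcongr
    have t2 : 4 * (q * G q) * -χ₂ (1 * q) ≤ 4 * (2 * 1) * C := by
      have : -χ₂ (1 * q) ≤ C := (neg_le_abs _).trans b2
      calc _ ≤ 4 * (q * G q) * C := by gcongr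
        _ ≤ _ := by gcongr
    have t3 : 2 * (2 * m + 2) * G q * -χ₁ (1 * q) ≤ 2 * (2 * m + 2) * 1 * C := by
      have : -χ₁ (1 * q) ≤ C := (neg_le_abs _).trans b1
      calc _ ≤ 2 * (2 * m + 2) * G q * C := by gcongr
        _ ≤ _ := by gcongr
    have t4 : 0 ≤ (4 * q * G₂ q + 2 * (2 * m + 2) * G₁ q) * χ (1 * q) := by
      refine mul_nonneg (le_trans ?_ (main q q0)) b3
      have := P0 q
      positivity
    simp only [g₁, g₂]
    linarith

lemma integral_ball_kernel {n : ℕ} (hn : 1 ≤ n) {b : ℝ} (hb : b < n) (x : Euc n) (r : ℝ) :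
    IntegrableOn (fun y : Euc n => ‖x - y‖ ^ (-b)) (ball x r) ∧
    ∫ y in ball x r, ‖x - y‖ ^ (-b) = ∫ y in ball (0 : Euc n) r, ‖y‖ ^ (-b) := by
  have h0 : IntegrableOn (fun y : Euc n => ‖y‖ ^ (-b)) (ball 0 r) := by
    refine integrableOn_ball_of_norm_le_rpow (C := 1) (α := b) (by simpa using hn) (by simpa using hb)
      (ae_of_all _ fun y => ?_) ?_
    · rw [one_mul, Real.norm_of_nonneg (by positivity)]
    · exact (measurable_norm.pow_const _).aestronglyMeasurable
  have e : ∀ y : Euc n, (ball x r).indicator (fun y : Euc n => ‖x - y‖ ^ (-b)) y =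
      (ball (0 : Euc n) r).indicator (fun y : Euc n => ‖y‖ ^ (-b)) (x - y) := fun y => by
    by_cases hy : y ∈ ball x r
    · rw [indicator_of_mem hy, indicator_of_mem]
      rwa [mem_ball_zero_iff, ← dist_eq_norm, dist_comm]
    · rw [indicator_of_notMem hy, indicator_of_notMem]
      rwa [mem_ball_zero_iff, ← dist_eq_norm, dist_comm]
  constructor
  · rw [← integrable_indicator_iff measurableSet_ball] at h0 ⊢
    exact (h0.comp_sub_left x).congr (ae_of_all _ fun y => (e y).symm)
  · rw [← integral_indicator measurableSet_ball, ← integral_indicator measurableSet_ball]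
    simp_rw [e]
    exact integral_sub_left_eq_self (fun y => (ball (0 : Euc n) r).indicator (fun y => ‖y‖ ^ (-b)) y)
      volume x

lemma isCompact_shell (n : ℕ) (r R : ℝ) : IsCompact {x : Euc n | r ≤ ‖x‖ ∧ ‖x‖ ≤ R} := by
  have : {x : Euc n | r ≤ ‖x‖ ∧ ‖x‖ ≤ R} = closedBall 0 R ∩ {x | r ≤ ‖x‖} := by
    ext x; simp [and_comm]
  rw [this]
  exact (isCompact_closedBall _ _).inter_right (isClosed_le continuous_const continuous_norm)

lemma shell_subset {n : ℕ} {r R : ℝ} (hr : 0 < r) : {x : Euc n | r ≤ ‖x‖ ∧ ‖x‖ ≤ R} ⊆ {0}ᶜ := by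
  rintro x ⟨hx, -⟩ rfl
  simp at hx; linarith

lemma annulus_bounds {n : ℕ} (hn : 3 ≤ n) {u : Euc n → ℝ} (h0 : ∀ x, 0 ≤ u x)
    (hu : ContDiffOn ℝ 2 u {0}ᶜ) (hf : ∀ x ∈ ball (0 : Euc n) 2 \ {0}, 0 ≤ -lap u x) :
    ∃ C : ℝ, 0 ≤ C ∧ ∀ r, 0 < r → r ≤ 1 / 3 →
      ∫ x in {x : Euc n | r < ‖x‖ ∧ ‖x‖ < 1}, -lap u x ≤ C ∧
      ∫ x in {x : Euc n | r < ‖x‖ ∧ ‖x‖ < 3 * r}, u x ≤ C * r ^ 2 := by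
  have hn3 : (3 : ℝ) ≤ n := by exact_mod_cast hn
  set m : ℝ := ((n : ℝ) - 2) / 2 with hm
  have hm0 : 0 < m := by rw [hm]; linarith
  have hnm : (n : ℝ) = 2 * m + 2 := by rw [hm]; ring
  obtain ⟨c, C, hc, hC, key⟩ := exists_shell_test hm0
  have hopen : IsOpen ({0}ᶜ : Set (Euc n)) := isOpen_compl_singleton
  have clap := continuousOn_lap hopen hu
  set S := {x : Euc n | 1 ≤ ‖x‖ ∧ ‖x‖ ≤ √2} with hS
  have iS : IntegrableOn u S :=
    (hu.continuousOn.mono (shell_subset one_pos)).integrableOn_compact (isCompact_shell n 1 _)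
  have mS : MeasurableSet S := (isCompact_shell n 1 _).measurableSet
  set I := ∫ x in S, u x with hI
  have hI0 : 0 ≤ I := integral_nonneg fun x => h0 x
  refine ⟨8 * (C * I) + C * I / c, by positivity, fun r hr hr3 => ?_⟩
  obtain ⟨η, g, g₁, g₂, hη, d1, d2, cg₂, gnn, g8, gz, g2, L2, L01, LR, L12⟩ :=
    key (r ^ 2) (by positivity) (by nlinarith)
  have hsq : (√2) ^ 2 = 2 := Real.sq_sqrt (by norm_num)
  have hsη : (√η) ^ 2 = η := Real.sq_sqrt hη.le
  obtain ⟨i1, i2, id⟩ := green_radial hopen (isCompact_shell n (√η) (√2))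
    (shell_subset (Real.sqrt_pos.2 hη)) hu 0 hη d1 d2 cg₂ (fun x hx => by
      rw [sub_zero]
      simp only [mem_ofPred_eq, not_and_or, not_le] at hx
      rcases hx with hx | hx
      · exact gz _ (by positivity) (by
          rw [← hsη]; exact pow_le_pow_left₀ (norm_nonneg _) hx.le 2)
      · refine g2 _ ?_
        rw [ge_iff_le, ← hsq]; exact pow_le_pow_left₀ (Real.sqrt_nonneg _) hx.le 2)
  simp only [sub_zero, hnm] at i1 i2 id
  set A := {x : Euc n | r < ‖x‖ ∧ ‖x‖ < 1} with hA
  set B := {x : Euc n | r < ‖x‖ ∧ ‖x‖ < 3 * r} with hB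
  have mA : MeasurableSet A :=
    ((isOpen_lt continuous_const continuous_norm).inter
      (isOpen_lt continuous_norm continuous_const)).measurableSet
  have mB : MeasurableSet B :=
    ((isOpen_lt continuous_const continuous_norm).inter
      (isOpen_lt continuous_norm continuous_const)).measurableSet
  have iA : IntegrableOn (fun x => -lap u x) A :=
    ((clap.neg.mono (shell_subset hr)).integrableOn_compact (isCompact_shell n r 1)).mono_set
      fun x hx => ⟨hx.1.le, hx.2.le⟩
  have iB : IntegrableOn u B :=
    ((hu.continuousOn.mono (shell_subset hr)).integrableOn_compact
      (isCompact_shell n r (3 * r))).mono_set fun x hx => ⟨hx.1.le, hx.2.le⟩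
  have nA : 0 ≤ ∫ x in A, -lap u x := setIntegral_nonneg mA fun x hx => hf x
    ⟨by simpa using hx.2.trans (by norm_num), by
      rintro rfl; have := hx.1; simp at this; linarith⟩
  have nB : 0 ≤ ∫ x in B, u x := integral_nonneg fun x => h0 x
  have e1 : ∫ x in A, (1 / 8) * -lap u x ≤ ∫ x, -(lap u x * g (‖x‖ ^ 2)) := by
    rw [← integral_indicator mA]
    refine integral_mono ((integrable_indicator_iff mA).2 (iA.const_mul _)) i2.neg fun x => ?_
    by_cases hx : x ∈ A
    · simp only [indicator_of_mem hx]
      have h1 := g8 (‖x‖ ^ 2) (pow_le_pow_left₀ hr.le hx.1.le 2)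
        (pow_le_one₀ (norm_nonneg _) hx.2.le)
      have h2 := hf x ⟨by simpa using hx.2.trans (by norm_num), by
        rintro rfl; have := hx.1; simp at this; linarith⟩
      nlinarith
    · simp only [indicator_of_notMem hx]
      rcases eq_or_ne x 0 with rfl | hx0
      · simp [gz 0 le_rfl hη.le]
      rcases lt_or_ge ‖x‖ 2 with h | h
      · have h2 := hf x ⟨by simpa using h, hx0⟩
        have h1 := gnn (‖x‖ ^ 2) (by positivity)
        nlinarith
      · rw [g2 (‖x‖ ^ 2) (by nlinarith)]; simp
  have e2 : ∫ x in B, (c / r ^ 2) * u x ≤ ∫ x, (u x * (4 * ‖x‖ ^ 2 * g₂ (‖x‖ ^ 2) +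
      2 * (2 * m + 2) * g₁ (‖x‖ ^ 2)) + S.indicator (fun x => C * u x) x) := by
    rw [← integral_indicator mB]
    refine integral_mono ((integrable_indicator_iff mB).2 (iB.const_mul _))
      (i1.add ((integrable_indicator_iff mS).2 (iS.const_mul _))) fun x => ?_
    have hS0 : 0 ≤ S.indicator (fun x => C * u x) x :=
      indicator_nonneg (fun x _ => mul_nonneg hC (h0 x)) x
    have hux := h0 x
    by_cases hx : x ∈ B
    · simp only [indicator_of_mem hx]
      have h1 := LR (‖x‖ ^ 2) (pow_le_pow_left₀ hr.le hx.1.le 2) (by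
        have := pow_le_pow_left₀ (norm_nonneg _) hx.2.le 2
        linarith)
      have := mul_le_mul_of_nonneg_left h1 hux
      linarith
    · simp only [indicator_of_notMem hx]
      rcases le_total (‖x‖ ^ 2) 1 with h | h
      · have := mul_nonneg hux (L01 _ (by positivity) h)
        linarith
      rcases le_total (‖x‖ ^ 2) 2 with h' | h'
      · have hxS : x ∈ S := ⟨by nlinarith [norm_nonneg x], Real.le_sqrt_of_sq_le h'⟩
        rw [indicator_of_mem hxS]
        have := mul_le_mul_of_nonneg_left (L12 _ h h') hux
        linarith
      · rw [L2 _ h', mul_zero, zero_add]; exact hS0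
  rw [integral_add i1 ((integrable_indicator_iff mS).2 (iS.const_mul _)), id,
    integral_indicator mS, integral_const_mul, integral_const_mul, ← hI] at e2
  rw [integral_const_mul] at e1
  have e3 : ∫ x, -(lap u x * g (‖x‖ ^ 2)) = -∫ x, lap u x * g (‖x‖ ^ 2) := integral_neg _
  rw [e3] at e1
  have hB1 : c / r ^ 2 * ∫ x in B, u x ≤ C * I := by linarith
  have hB0 : 0 ≤ c / r ^ 2 * ∫ x in B, u x := by positivity
  have hCI : 0 ≤ C * I := by positivity
  constructor
  · have : 0 ≤ C * I / c := by positivity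
    linarith
  · rw [div_mul_eq_mul_div, div_le_iff₀ (by positivity)] at hB1
    calc ∫ x in B, u x = (c * ∫ x in B, u x) / c := by field_simp
      _ ≤ (C * I * r ^ 2) / c := by gcongr
      _ = C * I / c * r ^ 2 := by ring
      _ ≤ _ := by gcongr; linarith

lemma integrable_neg_lap {n : ℕ} (hn : 3 ≤ n) {u : Euc n → ℝ} (h0 : ∀ x, 0 ≤ u x)
    (hu : ContDiffOn ℝ 2 u {0}ᶜ) (hf : ∀ x ∈ ball (0 : Euc n) 2 \ {0}, 0 ≤ -lap u x) :
    IntegrableOn (fun x => -lap u x) (ball 0 1 \ {0}) := by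
  obtain ⟨C, hC, h⟩ := annulus_bounds hn h0 hu hf
  have : Nonempty (Fin n) := ⟨⟨0, by omega⟩⟩
  have : Nontrivial (Euc n) := inferInstance
  have mB : MeasurableSet (ball (0 : Euc n) 1 \ {0}) := measurableSet_ball.diff (measurableSet_singleton 0)
  set φ : ℕ → Set (Euc n) := fun k => {x | 1 / ((k : ℝ) + 3) < ‖x‖} with hφ
  have mφ : ∀ k, MeasurableSet (φ k) := fun k =>
    (isOpen_lt continuous_const continuous_norm).measurableSet
  have cover : AECover volume atTop φ := by
    refine ⟨?_, mφ⟩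
    have : ∀ᵐ x : Euc n, x ≠ 0 := by simp [ae_iff]
    filter_upwards [this] with x hx
    have ht : Tendsto (fun k : ℕ => 1 / ((k : ℝ) + 3)) atTop (𝓝 0) :=
      tendsto_const_nhds.div_atTop (tendsto_atTop_add_const_right _ _ tendsto_natCast_atTop_atTop)
    exact ht.eventually_lt_const (norm_pos_iff.2 hx)
  have hset : ∀ k : ℕ, φ k ∩ (ball 0 1 \ {0}) =
      {x : Euc n | 1 / ((k : ℝ) + 3) < ‖x‖ ∧ ‖x‖ < 1} := fun k => by
    ext x
    simp only [hφ, mem_inter_iff, mem_ofPred_eq, Set.mem_sdiff, mem_ball_zero_iff, mem_singleton_iff]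
    refine ⟨fun h => ⟨h.1, h.2.1⟩, fun h => ⟨h.1, h.2, ?_⟩⟩
    rintro rfl
    have h1 := h.1
    have : 0 < 1 / ((k : ℝ) + 3) := by positivity
    simp at h1; simp at this; linarith
  rw [← integrable_indicator_iff mB]
  refine cover.integrable_of_integral_bounded_of_nonneg_ae C (fun k => ?_) (ae_of_all _ fun x => ?_)
    (Eventually.of_forall fun k => ?_)
  · rw [integrableOn_indicator_iff mB, inter_comm, hset]
    have hr : 0 < 1 / ((k : ℝ) + 3) := by positivity
    exact ((((continuousOn_lap isOpen_compl_singleton hu).neg).mono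
      (shell_subset hr)).integrableOn_compact (isCompact_shell n _ 1)).mono_set
        fun x hx => ⟨hx.1.le, hx.2.le⟩
  · refine indicator_nonneg (fun x hx => hf x ⟨?_, hx.2⟩) x
    exact ball_subset_ball (by norm_num) hx.1
  · rw [setIntegral_indicator mB, hset]
    refine (h _ (by positivity) ?_).1
    apply one_div_le_one_div_of_le <;> linarith [(Nat.cast_nonneg k : (0 : ℝ) ≤ k)]

/-- Pointwise bound by the mean over a ball plus the Newtonian potential of `-Δu`. -/
lemma local_upper_bound {n : ℕ} (hn : 3 ≤ n) {u : Euc n → ℝ} (h0 : ∀ x, 0 ≤ u x)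
    (hu : ContDiffOn ℝ 2 u {0}ᶜ) (hf : ∀ x ∈ ball (0 : Euc n) 2 \ {0}, 0 ≤ -lap u x) :
    ∃ C : ℝ, 0 ≤ C ∧ ∀ a : Euc n, a ≠ 0 → ‖a‖ ≤ 1 →
      IntegrableOn (fun y => ‖a - y‖ ^ (-((n : ℝ) - 2)) * -lap u y) (ball a (‖a‖ / 2)) ∧
      u a ≤ C * ((‖a‖ / 2) ^ (-(n : ℝ)) * (∫ y in ball a (‖a‖ / 2), u y) +
        ∫ y in ball a (‖a‖ / 2), ‖a - y‖ ^ (-((n : ℝ) - 2)) * -lap u y) := by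
  have hn3 : (3 : ℝ) ≤ n := by exact_mod_cast hn
  set m : ℝ := ((n : ℝ) - 2) / 2 with hm
  have hm0 : 0 < m := by rw [hm]; linarith
  have hnm : (n : ℝ) = 2 * m + 2 := by rw [hm]; ring
  have : Nonempty (Fin n) := ⟨⟨0, by omega⟩⟩
  have : Nontrivial (Euc n) := inferInstance
  obtain ⟨C₀, hC₀, key⟩ := exists_fundamental_test hm0
  set ω := volume.real (ball (0 : Euc n) 1) with hω
  have hω0 : 0 < ω := ENNReal.toReal_pos (measure_ball_pos _ _ one_pos).ne' measure_ball_lt_top.ne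
  set k : ℝ := 1 / 2 * (4 * m * (m + 1) * 2 ^ (-m - 2)) * ω with hk
  have hk0 : 0 < k := by positivity
  refine ⟨(C₀ + 1) / k, by positivity, fun a ha ha1 => ?_⟩
  set ρ := ‖a‖ / 2 with hρ
  have hρ0 : 0 < ρ := by have := norm_pos_iff.2 ha; positivity
  have hopen : IsOpen ({0}ᶜ : Set (Euc n)) := isOpen_compl_singleton
  have clap := (continuousOn_lap hopen hu).neg
  have near : ∀ y ∈ closedBall a ρ, y ≠ 0 ∧ y ∈ ball (0 : Euc n) 2 \ {0} := fun y hy => by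
    rw [mem_closedBall, dist_eq_norm] at hy
    have h1 : ‖a‖ ≤ ‖y - a‖ + ‖y‖ := by
      have := norm_sub_le y (y - a); rw [sub_sub_cancel] at this; linarith
    have h2 : ‖y‖ ≤ ‖y - a‖ + ‖a‖ := by simpa using norm_add_le (y - a) a
    have hy0 : y ≠ 0 := by
      rintro rfl
      rw [norm_zero] at h1; linarith
    exact ⟨hy0, by rw [mem_ball_zero_iff]; linarith, hy0⟩
  have hKs : closedBall a ρ ⊆ ({0}ᶜ : Set (Euc n)) := fun y hy => (near y hy).1
  have hK := isCompact_closedBall a ρ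
  have iu : IntegrableOn u (ball a ρ) :=
    ((hu.continuousOn.mono hKs).integrableOn_compact hK).mono_set ball_subset_closedBall
  have iN : IntegrableOn (fun y => ‖a - y‖ ^ (-((n : ℝ) - 2)) * -lap u y) (ball a ρ) := by
    obtain ⟨M, hM⟩ := hK.exists_bound_of_continuousOn (clap.mono hKs)
    refine (integral_ball_kernel (by omega) (by linarith) a ρ).1.mul_bdd (c := M) ?_ ?_
    · exact ((clap.mono hKs).mono ball_subset_closedBall).aestronglyMeasurable measurableSet_ball
    · exact (ae_restrict_iff' measurableSet_ball).2
        (ae_of_all _ fun y hy => hM y (ball_subset_closedBall hy))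
  refine ⟨iN, ?_⟩
  have nN : 0 ≤ ∫ y in ball a ρ, ‖a - y‖ ^ (-((n : ℝ) - 2)) * -lap u y :=
    setIntegral_nonneg measurableSet_ball fun y hy =>
      mul_nonneg (by positivity) (hf y (near y (ball_subset_closedBall hy)).2)
  have nu : 0 ≤ ∫ y in ball a ρ, u y := integral_nonneg fun y => h0 y
  rcases (h0 a).eq_or_lt with hua | hua
  · rw [← hua]; positivity
  have hcont : ∀ᶠ y in 𝓝 a, u a / 2 < u y :=
    (hu.continuousOn.continuousAt (hopen.mem_nhds ha)).eventually_const_lt (by linarith)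
  obtain ⟨δ', hδ', hδu⟩ := Metric.eventually_nhds_iff_ball.1 hcont
  set δ := min δ' (ρ / 2) with hδ
  have hδ0 : 0 < δ := by positivity
  have hδρ : δ ≤ ρ / 2 := min_le_right _ _
  obtain ⟨g, g₁, g₂, d1, d2, cg₂, gnn, gle, gR, LR, LC, Lδ⟩ :=
    key (ρ ^ 2) (δ ^ 2) (by positivity) (by positivity)
  obtain ⟨i1, i2, id⟩ := green_radial hopen hK hKs hu a (by positivity : 0 < δ ^ 2) d1 d2 cg₂
    (fun x hx => gR _ (by
      rw [mem_closedBall, dist_eq_norm, not_le] at hx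
      exact pow_le_pow_left₀ hρ0.le hx.le 2))
  simp only [hnm] at i1 id
  have e1 : ∫ x, -(lap u x * g (‖x - a‖ ^ 2)) ≤
      ∫ y in ball a ρ, ‖a - y‖ ^ (-((n : ℝ) - 2)) * -lap u y := by
    rw [← integral_indicator measurableSet_ball]
    refine integral_mono_ae i2.neg ((integrable_indicator_iff measurableSet_ball).2 iN) ?_
    have hae : ∀ᵐ x : Euc n, x ≠ a := by simp [ae_iff]
    filter_upwards [hae] with x hx
    by_cases hxB : x ∈ ball a ρ
    · rw [indicator_of_mem hxB]
      have h1 : 0 < ‖x - a‖ := norm_pos_iff.2 (sub_ne_zero.2 hx)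
      have h2 := gle (‖x - a‖ ^ 2) (by positivity)
      rw [← Real.rpow_natCast, ← Real.rpow_mul (norm_nonneg _)] at h2
      have h3 : ((2 : ℕ) : ℝ) * -m = -((n : ℝ) - 2) := by rw [hnm]; push_cast; ring
      rw [h3] at h2
      rw [norm_sub_rev a x]
      have h4 := hf x (near x (ball_subset_closedBall hxB)).2
      have h5 := mul_le_mul_of_nonneg_right h2 h4
      rw [← Real.rpow_natCast]
      linarith
    · rw [indicator_of_notMem hxB]
      rw [mem_ball, dist_eq_norm, not_lt] at hxB
      simp [gR _ (pow_le_pow_left₀ hρ0.le hxB 2)]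
  have e3 : ∫ x, -(lap u x * g (‖x - a‖ ^ 2)) = -∫ x, lap u x * g (‖x - a‖ ^ 2) := integral_neg _
  set A : ℝ := C₀ * (ρ ^ 2) ^ (-m - 1) with hA
  have hA0 : 0 ≤ A := by positivity
  set D : ℝ := 4 * m * (m + 1) * δ ^ 2 * (2 * δ ^ 2) ^ (-m - 2) with hD
  have hD0 : 0 ≤ D := by positivity
  have iD : IntegrableOn (fun _ : Euc n => u a / 2 * D) (ball a δ) :=
    integrableOn_const measure_ball_lt_top.ne
  have e2 : ∫ x, u x * (4 * ‖x - a‖ ^ 2 * g₂ (‖x - a‖ ^ 2) +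
      2 * (2 * m + 2) * g₁ (‖x - a‖ ^ 2)) ≤
      ∫ x, ((ball a ρ).indicator (fun x => A * u x) x -
        (ball a δ).indicator (fun _ => u a / 2 * D) x) := by
    refine integral_mono i1 (((integrable_indicator_iff measurableSet_ball).2 (iu.const_mul A)).sub
      ((integrable_indicator_iff measurableSet_ball).2 iD)) fun x => ?_
    have hq : 0 ≤ ‖x - a‖ ^ 2 := by positivity
    have hux := h0 x
    by_cases hδx : x ∈ ball a δ
    · have hρx : x ∈ ball a ρ := ball_subset_ball (by linarith) hδx
      have hux2 := hδu x (ball_subset_ball (min_le_left _ _) hδx)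
      simp only [indicator_of_mem hδx, indicator_of_mem hρx]
      rw [mem_ball, dist_eq_norm] at hδx
      have h1 : ‖x - a‖ ^ 2 ≤ δ ^ 2 := pow_le_pow_left₀ (norm_nonneg _) hδx.le 2
      rw [Lδ _ hq (by nlinarith)]
      have h2 : D ≤ 4 * m * (m + 1) * δ ^ 2 * (‖x - a‖ ^ 2 + δ ^ 2) ^ (-m - 2) := by
        refine mul_le_mul_of_nonneg_left ?_ (by positivity)
        exact Real.rpow_le_rpow_of_nonpos (by positivity) (by linarith) (by linarith)
      have h3 : u a / 2 * D ≤ u x * (4 * m * (m + 1) * δ ^ 2 * (‖x - a‖ ^ 2 + δ ^ 2) ^ (-m - 2)) :=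
        mul_le_mul hux2.le h2 hD0 hux
      have h4 : 0 ≤ A * u x := by positivity
      linarith
    · simp only [indicator_of_notMem hδx, sub_zero]
      by_cases hρx : x ∈ ball a ρ
      · rw [indicator_of_mem hρx]
        have := mul_le_mul_of_nonneg_left (LC _ hq) hux
        linarith
      · rw [indicator_of_notMem hρx]
        rw [mem_ball, dist_eq_norm, not_lt] at hρx
        rw [LR _ (pow_le_pow_left₀ hρ0.le hρx 2), mul_zero]
  rw [integral_sub ((integrable_indicator_iff measurableSet_ball).2 (iu.const_mul A))
      ((integrable_indicator_iff measurableSet_ball).2 iD), id,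
    integral_indicator measurableSet_ball, integral_indicator measurableSet_ball,
    integral_const_mul, setIntegral_const, smul_eq_mul, Measure.real,
    Measure.addHaar_ball _ _ hδ0.le, ENNReal.toReal_mul,
    ENNReal.toReal_ofReal (by positivity), finrank_euclideanSpace_fin, ← Measure.real, ← hω] at e2
  have e4 : δ ^ n * ω * (u a / 2 * D) = k * u a := by
    have h1 : δ ^ n * (δ ^ 2 * (2 * δ ^ 2) ^ (-m - 2)) = 2 ^ (-m - 2) := by
      rw [Real.mul_rpow (by norm_num) (by positivity), ← Real.rpow_natCast, ← Real.rpow_natCast,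
        ← Real.rpow_mul hδ0.le]
      have h2 : δ ^ (n : ℝ) * δ ^ ((2 : ℕ) : ℝ) * δ ^ (((2 : ℕ) : ℝ) * (-m - 2)) = 1 := by
        rw [← Real.rpow_add hδ0, ← Real.rpow_add hδ0, hnm]
        convert Real.rpow_zero δ using 2
        push_cast; ring
      linear_combination 2 ^ (-m - 2) * h2
    rw [hk, hD]
    linear_combination (ω * (u a / 2) * (4 * m * (m + 1))) * h1
  rw [e4] at e2
  have e5 : A = C₀ * ρ ^ (-(n : ℝ)) := by
    rw [hA, ← Real.rpow_natCast, ← Real.rpow_mul hρ0.le, hnm]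
    congr 2; push_cast; ring
  rw [e5] at e2
  rw [div_mul_eq_mul_div, le_div_iff₀ hk0]
  have hX : 0 ≤ ρ ^ (-(n : ℝ)) * ∫ y in ball a ρ, u y := by positivity
  have hY := mul_nonneg hC₀ nN
  nlinarith

lemma pointwise_bound {n : ℕ} (hn : 3 ≤ n) {u : Euc n → ℝ} (h0 : ∀ x, 0 ≤ u x)
    (hu : ContDiffOn ℝ 2 u {0}ᶜ) (hf : ∀ x ∈ ball (0 : Euc n) 2 \ {0}, 0 ≤ -lap u x) :
    ∃ C : ℝ, 0 ≤ C ∧ ∀ a : Euc n, a ≠ 0 → ‖a‖ ≤ 2 / 3 →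
      IntegrableOn (fun y => ‖a - y‖ ^ (-((n : ℝ) - 2)) * -lap u y) (ball a (‖a‖ / 2)) ∧
      u a ≤ C * (‖a‖ ^ (-((n : ℝ) - 2)) +
        ∫ y in ball a (‖a‖ / 2), ‖a - y‖ ^ (-((n : ℝ) - 2)) * -lap u y) := by
  obtain ⟨C₁, hC₁, hb⟩ := annulus_bounds hn h0 hu hf
  obtain ⟨C₂, hC₂, hl⟩ := local_upper_bound hn h0 hu hf
  refine ⟨C₂ * (C₁ * (1 / 2) ^ (-((n : ℝ) - 2)) + 1), by positivity, fun a ha ha1 => ?_⟩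
  obtain ⟨i, h⟩ := hl a ha (by linarith)
  refine ⟨i, h.trans ?_⟩
  have hna := norm_pos_iff.2 ha
  have near : ∀ y ∈ ball a (‖a‖ / 2), ‖a‖ / 2 < ‖y‖ ∧ ‖y‖ < 3 * (‖a‖ / 2) := fun y hy => by
    rw [mem_ball, dist_eq_norm] at hy
    have h1 : ‖a‖ ≤ ‖y - a‖ + ‖y‖ := by
      have := norm_sub_le y (y - a); rw [sub_sub_cancel] at this; linarith
    have h2 : ‖y‖ ≤ ‖y - a‖ + ‖a‖ := by simpa using norm_add_le (y - a) a
    constructor <;> linarith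
  have hr : 0 < ‖a‖ / 2 := by positivity
  have nN : 0 ≤ ∫ y in ball a (‖a‖ / 2), ‖a - y‖ ^ (-((n : ℝ) - 2)) * -lap u y :=
    setIntegral_nonneg measurableSet_ball fun y hy =>
      mul_nonneg (by positivity) (hf y ⟨by rw [mem_ball_zero_iff]; linarith [(near y hy).2], by
        rintro rfl; have := (near _ hy).1; rw [norm_zero] at this; linarith⟩)
  have h1 : ∫ y in ball a (‖a‖ / 2), u y ≤ C₁ * (‖a‖ / 2) ^ 2 := by
    refine le_trans (setIntegral_mono_set ?_ (ae_of_all _ h0)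
      (LE.le.eventuallyLE near)) (hb _ hr (by linarith)).2
    exact ((hu.continuousOn.mono (shell_subset hr)).integrableOn_compact
      (isCompact_shell n _ _)).mono_set fun x hx => ⟨hx.1.le, hx.2.le⟩
  have h2 : (‖a‖ / 2) ^ (-(n : ℝ)) * (‖a‖ / 2) ^ 2 =
      (1 / 2) ^ (-((n : ℝ) - 2)) * ‖a‖ ^ (-((n : ℝ) - 2)) := by
    rw [← Real.mul_rpow (by norm_num) hna.le, ← Real.rpow_natCast, ← Real.rpow_add hr]
    congr 1
    · ring
    · push_cast; ring
  have h3 := mul_le_mul_of_nonneg_left h1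
    (Real.rpow_nonneg hr.le (-(n : ℝ)))
  rw [mul_left_comm, h2] at h3
  have h4 : 0 ≤ C₁ * (1 / 2) ^ (-((n : ℝ) - 2)) := by positivity
  have h5 := mul_nonneg h4 nN
  have h6 : 0 ≤ ‖a‖ ^ (-((n : ℝ) - 2)) := by positivity
  rw [mul_assoc]
  refine mul_le_mul_of_nonneg_left ?_ hC₂
  nlinarith

/-- The Riesz kernel `|x-y|^(-b)` with extended nonnegative values. -/
noncomputable def riesz {n : ℕ} (b : ℝ) (x y : Euc n) : ENNReal := ENNReal.ofReal (‖x - y‖ ^ (-b))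

lemma riesz_comm {n : ℕ} (b : ℝ) (x y : Euc n) : riesz b x y = riesz b y x := by
  rw [riesz, riesz, norm_sub_rev]

lemma measurable_riesz {n : ℕ} (b : ℝ) : Measurable fun p : Euc n × Euc n => riesz b p.1 p.2 :=
  (((measurable_fst.sub measurable_snd).norm).pow_const _).ennreal_ofReal

lemma measurable_riesz_left {n : ℕ} (b : ℝ) (x : Euc n) : Measurable (riesz b x) :=
  ((measurable_const.sub measurable_id).norm.pow_const _).ennreal_ofReal

lemma riesz_rpow {n : ℕ} {b p : ℝ} (hp : 0 ≤ p) (x y : Euc n) :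
    riesz b x y ^ p = riesz (b * p) x y := by
  rw [riesz, riesz, ENNReal.ofReal_rpow_of_nonneg (by positivity) hp, ← Real.rpow_mul (norm_nonneg _),
    neg_mul]

lemma riesz_mul_le {n : ℕ} {b c : ℝ} (hb : 0 < b) (hc : 0 < c) (x y z : Euc n) :
    riesz b x y * riesz c y z ≤ riesz (b + c) x y + riesz (b + c) z y := by
  rw [riesz_comm (b + c) z y]
  simp only [riesz]
  rw [← ENNReal.ofReal_mul (by positivity), ← ENNReal.ofReal_add (by positivity) (by positivity)]
  refine ENNReal.ofReal_le_ofReal ?_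
  rcases (norm_nonneg (x - y)).eq_or_lt with h | h
  · rw [← h, Real.zero_rpow (by linarith), zero_mul]; positivity
  rcases (norm_nonneg (y - z)).eq_or_lt with h' | h'
  · rw [← h', Real.zero_rpow (by linarith : -c ≠ 0), mul_zero]; positivity
  rcases le_total ‖x - y‖ ‖y - z‖ with h2 | h2
  · have : ‖x - y‖ ^ (-b) * ‖y - z‖ ^ (-c) ≤ ‖x - y‖ ^ (-b) * ‖x - y‖ ^ (-c) :=
      mul_le_mul_of_nonneg_left (Real.rpow_le_rpow_of_nonpos h h2 (by linarith)) (by positivity)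
    rw [← Real.rpow_add h, ← neg_add] at this
    exact this.trans (le_add_of_nonneg_right (by positivity))
  · have : ‖x - y‖ ^ (-b) * ‖y - z‖ ^ (-c) ≤ ‖y - z‖ ^ (-b) * ‖y - z‖ ^ (-c) :=
      mul_le_mul_of_nonneg_right (Real.rpow_le_rpow_of_nonpos h' h2 (by linarith)) (by positivity)
    rw [← Real.rpow_add h', ← neg_add] at this
    exact this.trans (le_add_of_nonneg_left (by positivity))

lemma lintegral_riesz_le {n : ℕ} (hn : 1 ≤ n) {b : ℝ} (hb0 : 0 < b) (hb : b < n) :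
    ∃ C : ENNReal, C ≠ ⊤ ∧ ∀ x : Euc n, ∫⁻ y in ball 0 1, riesz b x y ≤ C := by
  refine ⟨ENNReal.ofReal (∫ y in ball (0 : Euc n) 1, ‖y‖ ^ (-b)) + volume (ball (0 : Euc n) 1),
    ENNReal.add_ne_top.2 ⟨ENNReal.ofReal_ne_top, measure_ball_lt_top.ne⟩, fun x => ?_⟩
  obtain ⟨i, e⟩ := integral_ball_kernel hn hb x 1
  calc ∫⁻ y in ball 0 1, riesz b x y
      ≤ ∫⁻ y in ball x 1 ∪ (ball 0 1 \ ball x 1), riesz b x y :=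
        lintegral_mono_set (by rw [union_sdiff_self]; exact subset_union_right)
    _ ≤ (∫⁻ y in ball x 1, riesz b x y) + ∫⁻ y in ball 0 1 \ ball x 1, riesz b x y :=
        lintegral_union_le _ _ _
    _ ≤ _ := by
        refine add_le_add ?_ ?_
        · rw [← e, ofReal_integral_eq_lintegral_ofReal i (ae_of_all _ fun y => by positivity)]
          rfl
        · calc ∫⁻ y in ball 0 1 \ ball x 1, riesz b x y
              ≤ ∫⁻ y in ball 0 1 \ ball x 1, 1 := by
                refine setLIntegral_mono measurable_const fun y hy => ?_
                have h := hy.2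
                rw [mem_ball, dist_comm, dist_eq_norm, not_lt] at h
                exact ENNReal.ofReal_le_one.2 (Real.rpow_le_one_of_one_le_of_nonpos h (by linarith))
            _ ≤ _ := by
                rw [setLIntegral_one]; exact measure_mono sdiff_subset

lemma lintegral_rpow_le {X : Type*} [MeasurableSpace X] (ν : Measure X) {k : X → ENNReal}
    (hk : Measurable k) {p : ℝ} (hp : 1 ≤ p) :
    (∫⁻ z, k z ∂ν) ^ p ≤ (∫⁻ z, k z ^ p ∂ν) * ν univ ^ (p - 1) := by
  have hp0 : 0 < p := by linarith
  have h := ENNReal.lintegral_mul_norm_pow_le (μ := ν) (f := fun z => k z ^ p) (g := fun _ => 1)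
    (hk.pow_const p).aemeasurable measurable_const.aemeasurable (p := 1 / p) (q := 1 - 1 / p)
    (by positivity) (by rw [sub_nonneg, div_le_one hp0]; exact hp) (by ring)
  have e : ∀ z, (k z ^ p) ^ (1 / p) * (1 : ENNReal) ^ (1 - 1 / p) = k z := fun z => by
    rw [← ENNReal.rpow_mul, mul_one_div_cancel hp0.ne', ENNReal.rpow_one, ENNReal.one_rpow, mul_one]
  simp only [e, lintegral_one] at h
  have h2 := ENNReal.rpow_le_rpow h hp0.le
  rw [ENNReal.mul_rpow_of_nonneg _ _ hp0.le, ← ENNReal.rpow_mul, ← ENNReal.rpow_mul,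
    one_div_mul_cancel hp0.ne', ENNReal.rpow_one, sub_mul, one_div_mul_cancel hp0.ne', one_mul] at h2
  exact h2

lemma lintegral_riesz_potential_of_one_le {n : ℕ} (hn : 1 ≤ n) (ν : Measure (Euc n))
    [IsFiniteMeasure ν] {γ b p : ℝ} (hγ : 0 < γ) (hb : 0 < b) (hp : 1 ≤ p) (h : γ + b * p < n) :
    ∃ C : ENNReal, C ≠ ⊤ ∧ ∀ x : Euc n,
      ∫⁻ y in ball 0 1, riesz γ x y * (∫⁻ z, riesz b y z ∂ν) ^ p ≤ C := by
  have hp0 : 0 < p := by linarith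
  obtain ⟨C, hC, hle⟩ := lintegral_riesz_le hn (b := γ + b * p) (by positivity) h
  refine ⟨(C + C) * ν univ * ν univ ^ (p - 1), by finiteness, fun x => ?_⟩
  have hm : Measurable fun q : Euc n × Euc n => riesz γ x q.1 * riesz (b * p) q.1 q.2 :=
    ((measurable_riesz_left γ x).comp measurable_fst).mul (measurable_riesz _)
  calc ∫⁻ y in ball 0 1, riesz γ x y * (∫⁻ z, riesz b y z ∂ν) ^ p
      ≤ ∫⁻ y in ball 0 1, (∫⁻ z, riesz γ x y * riesz (b * p) y z ∂ν) * ν univ ^ (p - 1) := by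
        refine lintegral_mono fun y => ?_
        rw [lintegral_const_mul _ (measurable_riesz_left _ y), mul_assoc]
        refine mul_le_mul_right ?_ _
        simpa only [riesz_rpow hp0.le] using lintegral_rpow_le ν (measurable_riesz_left b y) hp
    _ = (∫⁻ y in ball 0 1, ∫⁻ z, riesz γ x y * riesz (b * p) y z ∂ν) * ν univ ^ (p - 1) :=
        lintegral_mul_const _ hm.lintegral_prod_right'
    _ = (∫⁻ z, (∫⁻ y in ball 0 1, riesz γ x y * riesz (b * p) y z) ∂ν) * ν univ ^ (p - 1) := by
        rw [lintegral_lintegral_swap hm.aemeasurable]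
    _ ≤ (∫⁻ _, (C + C) ∂ν) * ν univ ^ (p - 1) := by
        refine mul_le_mul_left (lintegral_mono fun z => ?_) _
        refine (lintegral_mono fun y => riesz_mul_le hγ (by positivity) x y z).trans ?_
        rw [lintegral_add_left (measurable_riesz_left _ x)]
        exact add_le_add (hle x) (hle z)
    _ = _ := by rw [lintegral_const]

lemma lintegral_riesz_potential {n : ℕ} (hn : 1 ≤ n) (ν : Measure (Euc n))
    [IsFiniteMeasure ν] {γ b p : ℝ} (hγ : 0 < γ) (hb : 0 < b) (hbn : b < n) (hp : 0 < p)
    (h : γ + b * p < n) :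
    ∃ C : ENNReal, C ≠ ⊤ ∧ ∀ x : Euc n,
      ∫⁻ y in ball 0 1, riesz γ x y * (∫⁻ z, riesz b y z ∂ν) ^ p ≤ C := by
  rcases le_or_gt 1 p with hp1 | hp1
  · exact lintegral_riesz_potential_of_one_le hn ν hγ hb hp1 h
  have hγp : 0 < γ / p := by positivity
  obtain ⟨a, ha1, ha2⟩ : ∃ a, max 0 ((γ - n + n * p) / p) < a ∧ a < min (n - b) (γ / p) := by
    refine exists_between (max_lt (lt_min (by linarith) hγp) (lt_min ?_ ?_))
    · rw [div_lt_iff₀ hp]; linarith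
    · have : (1 : ℝ) ≤ n := by exact_mod_cast hn
      gcongr; nlinarith
  rw [max_lt_iff, div_lt_iff₀ hp] at ha1
  rw [lt_min_iff, lt_div_iff₀ hp] at ha2
  have hq : 0 < 1 - p := by linarith
  set c := (γ - a * p) / (1 - p) with hc
  have hcp : c * (1 - p) = γ - a * p := by rw [hc]; field_simp
  have hc0 : 0 < c := div_pos (by linarith) hq
  have hcn : c < n := by rw [hc, div_lt_iff₀ hq]; linarith
  obtain ⟨C₁, hC₁, h1⟩ := lintegral_riesz_potential_of_one_le hn ν ha1.1 hb le_rfl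
    (by linarith : a + b * 1 < n)
  obtain ⟨C₂, hC₂, h2⟩ := lintegral_riesz_le hn hc0 hcn
  refine ⟨C₁ ^ p * C₂ ^ (1 - p), by finiteness, fun x => ?_⟩
  have hP : Measurable fun y : Euc n => ∫⁻ z, riesz b y z ∂ν :=
    (measurable_riesz b).lintegral_prod_right'
  calc ∫⁻ y in ball 0 1, riesz γ x y * (∫⁻ z, riesz b y z ∂ν) ^ p
      = ∫⁻ y in ball 0 1, (riesz a x y * ∫⁻ z, riesz b y z ∂ν) ^ p * riesz c x y ^ (1 - p) := by
        refine lintegral_congr fun y => ?_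
        have : riesz γ x y = riesz (a * p) x y * riesz (c * (1 - p)) x y := by
          rw [hcp]
          simp only [riesz]
          rw [← ENNReal.ofReal_mul (by positivity)]
          congr 1
          rcases (norm_nonneg (x - y)).eq_or_lt with h | h
          · rw [← h, Real.zero_rpow (by linarith),
              Real.zero_rpow (neg_ne_zero.2 (mul_pos ha1.1 hp).ne'), zero_mul]
          · rw [← Real.rpow_add h]; congr 1; ring
        rw [ENNReal.mul_rpow_of_nonneg _ _ hp.le, riesz_rpow hp.le, riesz_rpow hq.le, this]
        ring
    _ ≤ (∫⁻ y in ball 0 1, riesz a x y * ∫⁻ z, riesz b y z ∂ν) ^ p *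
          (∫⁻ y in ball 0 1, riesz c x y) ^ (1 - p) :=
        ENNReal.lintegral_mul_norm_pow_le ((measurable_riesz_left a x).mul hP).aemeasurable
          (measurable_riesz_left c x).aemeasurable hp.le hq.le (by ring)
    _ ≤ _ := by
        refine mul_le_mul' (ENNReal.rpow_le_rpow ?_ hp.le) (ENNReal.rpow_le_rpow (h2 x) hq.le)
        simpa using h1 x

lemma exists_measure_potential_bound {n : ℕ} (hn : 3 ≤ n) {u : Euc n → ℝ} (h0 : ∀ x, 0 ≤ u x)
    (hu : ContDiffOn ℝ 2 u {0}ᶜ) (hf : ∀ x ∈ ball (0 : Euc n) 2 \ {0}, 0 ≤ -lap u x) :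
    ∃ (ν : Measure (Euc n)) (C : ENNReal), IsFiniteMeasure ν ∧ C ≠ ⊤ ∧
      ∀ a : Euc n, a ≠ 0 → ‖a‖ ≤ 2 / 3 →
        ENNReal.ofReal (u a) ≤ C * ∫⁻ z, riesz ((n : ℝ) - 2) a z ∂ν := by
  obtain ⟨C, hC, h⟩ := pointwise_bound hn h0 hu hf
  have i := integrable_neg_lap hn h0 hu hf
  set ν₁ := (volume.restrict (ball (0 : Euc n) 1 \ {0})).withDensity
    (fun x => ENNReal.ofReal (-lap u x)) with hν₁
  have : IsFiniteMeasure ν₁ := isFiniteMeasure_withDensity_ofReal i.2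
  refine ⟨Measure.dirac 0 + ν₁, ENNReal.ofReal C, inferInstance, ENNReal.ofReal_ne_top,
    fun a ha ha1 => ?_⟩
  obtain ⟨j, hj⟩ := h a ha ha1
  have hna := norm_pos_iff.2 ha
  have sub : ball a (‖a‖ / 2) ⊆ ball (0 : Euc n) 1 \ {0} := fun y hy => by
    rw [mem_ball, dist_eq_norm] at hy
    have h1 : ‖a‖ ≤ ‖y - a‖ + ‖y‖ := by
      have := norm_sub_le y (y - a); rw [sub_sub_cancel] at this; linarith
    have h2 : ‖y‖ ≤ ‖y - a‖ + ‖a‖ := by simpa using norm_add_le (y - a) a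
    refine ⟨by rw [mem_ball_zero_iff]; linarith, ?_⟩
    rintro rfl
    rw [norm_zero] at h1; linarith
  have pos : ∀ y ∈ ball a (‖a‖ / 2), 0 ≤ ‖a - y‖ ^ (-((n : ℝ) - 2)) * -lap u y := fun y hy =>
    mul_nonneg (by positivity)
      (hf y ⟨ball_subset_ball (by norm_num) (sub hy).1, (sub hy).2⟩)
  rw [lintegral_add_measure, lintegral_dirac' _ (measurable_riesz_left _ a), hν₁,
    lintegral_withDensity_eq_lintegral_mul₀ i.1.aemeasurable.ennreal_ofReal
      (measurable_riesz_left _ a).aemeasurable]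
  refine (ENNReal.ofReal_le_ofReal hj).trans ?_
  rw [ENNReal.ofReal_mul hC, ENNReal.ofReal_add (by positivity)
    (setIntegral_nonneg measurableSet_ball pos)]
  gcongr ENNReal.ofReal C * (?_ + ?_)
  · rw [riesz, sub_zero]
  · rw [ofReal_integral_eq_lintegral_ofReal j
      ((ae_restrict_iff' measurableSet_ball).2 (ae_of_all _ pos))]
    refine le_trans (le_of_eq ?_) (lintegral_mono_set sub)
    refine lintegral_congr fun y => ?_
    rw [ENNReal.ofReal_mul (by positivity), mul_comm]
    rfl

/-- The subcritical Choquard potential of `u` is bounded near the origin. -/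
lemma choquard_potential_bound {n : ℕ} (hn : 3 ≤ n) {u : Euc n → ℝ} (h0 : ∀ x, 0 ≤ u x)
    (hu : ContDiffOn ℝ 2 u {0}ᶜ) (hf : ∀ x ∈ ball (0 : Euc n) 2 \ {0}, 0 ≤ -lap u x)
    {lam γ : ℝ} (hlam : 0 < lam) (hi : Integrable fun y => u y ^ lam) (hγ : 0 < γ)
    (h : γ + ((n : ℝ) - 2) * lam < n) :
    ∃ C : ℝ, 0 ≤ C ∧ ∀ x : Euc n, ‖x‖ ≤ 1 / 2 →
      ∫⁻ y, riesz γ x y * ENNReal.ofReal (u y ^ lam) ≤ ENNReal.ofReal C := by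
  have hn3 : (3 : ℝ) ≤ n := by exact_mod_cast hn
  have : Nonempty (Fin n) := ⟨⟨0, by omega⟩⟩
  have : Nontrivial (Euc n) := inferInstance
  obtain ⟨ν, C₁, hν, hC₁, hu1⟩ := exists_measure_potential_bound hn h0 hu hf
  obtain ⟨C₂, hC₂, h2⟩ := lintegral_riesz_potential (by omega) ν hγ
    (by linarith : 0 < (n : ℝ) - 2) (by linarith) hlam h
  set J := ∫⁻ y, ENNReal.ofReal (u y ^ lam) with hJ
  have hJt : J ≠ ⊤ := by
    rw [hJ, ← ofReal_integral_eq_lintegral_ofReal hi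
      (ae_of_all _ fun y => Real.rpow_nonneg (h0 y) _)]
    exact ENNReal.ofReal_ne_top
  set T : ENNReal := C₁ ^ lam * C₂ + ENNReal.ofReal ((1 / 6) ^ (-γ)) * J with hT
  have hTt : T ≠ ⊤ := by rw [hT]; finiteness
  refine ⟨T.toReal, ENNReal.toReal_nonneg, fun x hx => ?_⟩
  rw [ENNReal.ofReal_toReal hTt, ← lintegral_add_compl _ (measurableSet_ball (x := (0 : Euc n))
    (ε := 2 / 3))]
  refine add_le_add ?_ ?_
  · calc ∫⁻ y in ball 0 (2 / 3), riesz γ x y * ENNReal.ofReal (u y ^ lam)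
        ≤ ∫⁻ y in ball 0 (2 / 3),
            C₁ ^ lam * (riesz γ x y * (∫⁻ z, riesz ((n : ℝ) - 2) y z ∂ν) ^ lam) := by
          have hae : ∀ᵐ y : Euc n, y ≠ 0 := by simp [ae_iff]
          refine lintegral_mono_ae ?_
          filter_upwards [ae_restrict_of_ae hae, ae_restrict_mem measurableSet_ball] with y hy hyb
          rw [mem_ball_zero_iff] at hyb
          rw [mul_left_comm, ← ENNReal.mul_rpow_of_nonneg _ _ hlam.le,
            ← ENNReal.ofReal_rpow_of_nonneg (h0 y) hlam.le]
          gcongr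
          exact hu1 y hy hyb.le
      _ = C₁ ^ lam * ∫⁻ y in ball 0 (2 / 3),
            riesz γ x y * (∫⁻ z, riesz ((n : ℝ) - 2) y z ∂ν) ^ lam :=
          lintegral_const_mul _ ((measurable_riesz_left γ x).mul
            ((measurable_riesz _).lintegral_prod_right'.pow_const _))
      _ ≤ C₁ ^ lam * ∫⁻ y in ball 0 1,
            riesz γ x y * (∫⁻ z, riesz ((n : ℝ) - 2) y z ∂ν) ^ lam := by
          gcongr; norm_num
      _ ≤ _ := by gcongr; exact h2 x
  · calc ∫⁻ y in (ball 0 (2 / 3))ᶜ, riesz γ x y * ENNReal.ofReal (u y ^ lam)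
        ≤ ∫⁻ y in (ball 0 (2 / 3))ᶜ,
            ENNReal.ofReal ((1 / 6) ^ (-γ)) * ENNReal.ofReal (u y ^ lam) := by
          refine setLIntegral_mono' measurableSet_ball.compl fun y hy => ?_
          rw [mem_compl_iff, mem_ball_zero_iff, not_lt] at hy
          have h3 : 1 / 6 ≤ ‖x - y‖ := by
            have := norm_sub_norm_le y x
            rw [norm_sub_rev] at this; linarith
          rw [riesz]
          gcongr ENNReal.ofReal ?_ * _
          exact Real.rpow_le_rpow_of_nonpos (by norm_num) h3 (by linarith)
      _ ≤ ∫⁻ y, ENNReal.ofReal ((1 / 6) ^ (-γ)) * ENNReal.ofReal (u y ^ lam) :=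
          setLIntegral_le_lintegral _ _
      _ = _ := lintegral_const_mul' _ _ ENNReal.ofReal_ne_top

lemma integral_choquard_le {n : ℕ} (hn : 1 ≤ n) {u : Euc n → ℝ} (h0 : ∀ x, 0 ≤ u x)
    {lam α β γ C t A : ℝ} (hlam : 0 < lam) (hi : Integrable fun y => u y ^ lam) (hα : 0 < α)
    (hβ : α ≤ β) (hβn : β < n) (hγ : γ ≤ α) (hC : 0 ≤ C) {x : Euc n}
    (hx : ∫⁻ y, riesz γ x y * ENNReal.ofReal (u y ^ lam) ≤ ENNReal.ofReal C)
    (ht : 0 < t) (ht1 : t ≤ 1) (hA : 0 ≤ A) (huA : ∀ y ∈ ball x t, u y ≤ A) :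
    ∫ y, ‖x - y‖ ^ (-α) * u y ^ lam ≤
      A ^ lam * t ^ (β - α) * (∫ y in ball (0 : Euc n) 1, ‖y‖ ^ (-β)) + t ^ (γ - α) * C := by
  obtain ⟨i, e⟩ := integral_ball_kernel hn hβn x t
  have i1 := (integral_ball_kernel hn hβn 0 1).1
  simp only [zero_sub, norm_neg] at i1
  have hI : ∫ y in ball (0 : Euc n) t, ‖y‖ ^ (-β) ≤ ∫ y in ball (0 : Euc n) 1, ‖y‖ ^ (-β) :=
    setIntegral_mono_set i1 (ae_of_all _ fun y => by positivity)
      (LE.le.eventuallyLE (ball_subset_ball ht1))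
  have hI0 : 0 ≤ ∫ y in ball (0 : Euc n) 1, ‖y‖ ^ (-β) := integral_nonneg fun y => by positivity
  have hu0 : ∀ y, 0 ≤ u y ^ lam := fun y => Real.rpow_nonneg (h0 y) _
  have hmk : AEStronglyMeasurable (fun y : Euc n => ‖x - y‖ ^ (-α) * u y ^ lam) volume :=
    ((measurable_const.sub measurable_id).norm.pow_const _).aestronglyMeasurable.mul hi.1
  rw [integral_eq_lintegral_of_nonneg_ae
    (ae_of_all _ fun y => mul_nonneg (by positivity) (hu0 y)) hmk]
  refine ENNReal.toReal_le_of_le_ofReal (by positivity) ?_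
  rw [← lintegral_add_compl _ (measurableSet_ball (x := x) (ε := t)),
    ENNReal.ofReal_add (by positivity) (by positivity)]
  refine add_le_add ?_ ?_
  · calc ∫⁻ y in ball x t, ENNReal.ofReal (‖x - y‖ ^ (-α) * u y ^ lam)
        ≤ ∫⁻ y in ball x t, ENNReal.ofReal (A ^ lam * t ^ (β - α) * ‖x - y‖ ^ (-β)) := by
          refine setLIntegral_mono' measurableSet_ball fun y hy => ENNReal.ofReal_le_ofReal ?_
          have h1 : u y ^ lam ≤ A ^ lam := Real.rpow_le_rpow (h0 y) (huA y hy) hlam.le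
          rw [mem_ball, dist_comm, dist_eq_norm] at hy
          rcases (norm_nonneg (x - y)).eq_or_lt with h | h
          · rw [← h, Real.zero_rpow (by linarith), zero_mul]; positivity
          have h2 : ‖x - y‖ ^ (-α) = ‖x - y‖ ^ (β - α) * ‖x - y‖ ^ (-β) := by
            rw [← Real.rpow_add h]; congr 1; ring
          have h3 : ‖x - y‖ ^ (β - α) ≤ t ^ (β - α) :=
            Real.rpow_le_rpow h.le hy.le (by linarith)
          rw [h2, mul_comm, ← mul_assoc]
          gcongr
      _ = ENNReal.ofReal (A ^ lam * t ^ (β - α) * ∫ y in ball (0 : Euc n) t, ‖y‖ ^ (-β)) := by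
          rw [← e, ← integral_const_mul, ofReal_integral_eq_lintegral_ofReal (i.const_mul _)
            (ae_of_all _ fun y => by positivity)]
      _ ≤ _ := by gcongr
  · calc ∫⁻ y in (ball x t)ᶜ, ENNReal.ofReal (‖x - y‖ ^ (-α) * u y ^ lam)
        ≤ ∫⁻ y in (ball x t)ᶜ,
            ENNReal.ofReal (t ^ (γ - α)) * (riesz γ x y * ENNReal.ofReal (u y ^ lam)) := by
          refine setLIntegral_mono' measurableSet_ball.compl fun y hy => ?_
          rw [mem_compl_iff, mem_ball, dist_comm, dist_eq_norm, not_lt] at hy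
          have h : 0 < ‖x - y‖ := ht.trans_le hy
          have h2 : ‖x - y‖ ^ (-α) = ‖x - y‖ ^ (γ - α) * ‖x - y‖ ^ (-γ) := by
            rw [← Real.rpow_add h]; congr 1; ring
          have h3 : ‖x - y‖ ^ (γ - α) ≤ t ^ (γ - α) :=
            Real.rpow_le_rpow_of_nonpos ht hy (by linarith)
          have h4 := hu0 y
          rw [riesz, ← ENNReal.ofReal_mul (by positivity), ← ENNReal.ofReal_mul (by positivity), h2,
            ← mul_assoc]
          gcongr
      _ ≤ ∫⁻ y, ENNReal.ofReal (t ^ (γ - α)) * (riesz γ x y * ENNReal.ofReal (u y ^ lam)) :=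
          setLIntegral_le_lintegral _ _
      _ = ENNReal.ofReal (t ^ (γ - α)) * ∫⁻ y, riesz γ x y * ENNReal.ofReal (u y ^ lam) :=
          lintegral_const_mul' _ _ ENNReal.ofReal_ne_top
      _ ≤ ENNReal.ofReal (t ^ (γ - α)) * ENNReal.ofReal C := by gcongr
      _ = _ := (ENNReal.ofReal_mul (by positivity)).symm

lemma rescaled_powers {b c s p q r lam sig C D E : ℝ} (hc : 0 < c) (hs : 0 < s)
    (h1 : p + q - b * lam - b * sig + b = E) (h2 : p + r - b * sig + b = E) :
    (c * s) ^ p * ((((2 : ℝ) ^ b * s ^ (-b)) ^ lam * (c * s) ^ q * C + (c * s) ^ r * D) *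
      ((2 : ℝ) ^ b * s ^ (-b)) ^ sig) =
    c ^ p * ((((2 : ℝ) ^ b) ^ lam * c ^ q * C + c ^ r * D) * ((2 : ℝ) ^ b) ^ sig) * s ^ E *
      s ^ (-b) := by
  have e1 : s ^ p * s ^ (-b * lam) * s ^ q * s ^ (-b * sig) = s ^ E * s ^ (-b) := by
    simp only [← Real.rpow_add hs]
    congr 1; linarith
  have e2 : s ^ p * s ^ r * s ^ (-b * sig) = s ^ E * s ^ (-b) := by
    simp only [← Real.rpow_add hs]
    congr 1; linarith
  have h2b : (0 : ℝ) ≤ 2 ^ b := by positivity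
  rw [Real.mul_rpow hc.le hs.le, Real.mul_rpow hc.le hs.le, Real.mul_rpow hc.le hs.le,
    Real.mul_rpow h2b (by positivity), Real.mul_rpow h2b (by positivity), ← Real.rpow_mul hs.le,
    ← Real.rpow_mul hs.le]
  linear_combination c ^ p * (((2 : ℝ) ^ b) ^ lam * c ^ q * C) * ((2 : ℝ) ^ b) ^ sig * e1 +
    c ^ p * (c ^ r * D) * ((2 : ℝ) ^ b) ^ sig * e2

lemma exists_scale {v b E Q : ℝ} (hv : 0 < v) (hb : 0 < b) (hE : 0 < E) (hQ : 0 ≤ Q)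
    (h : (2 * Q) ^ (b / E) < v) : 2 * Q * (v ^ (-(1 / b))) ^ E < 1 ∧ (v ^ (-(1 / b))) ^ (-b) = v := by
  constructor
  · have h1 := Real.rpow_lt_rpow (by positivity) h (by positivity : 0 < E / b)
    have h2 : b / E * (E / b) = 1 := by field_simp
    have h3 : -(1 / b) * E = -(E / b) := by ring
    rw [← Real.rpow_mul (by positivity), h2, Real.rpow_one] at h1
    rw [← Real.rpow_mul hv.le, h3, Real.rpow_neg hv.le, ← div_eq_mul_inv,
      div_lt_one (by positivity)]
    exact h1
  · have h2 : -(1 / b) * -b = 1 := by field_simp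
    rw [← Real.rpow_mul hv.le, h2, Real.rpow_one]

lemma integral_newton_le {n : ℕ} (hn : 1 ≤ n) {f : Euc n → ℝ} {x : Euc n} {R t b β K : ℝ}
    {B : Set (Euc n)} (ht : 0 < t) (ht1 : t ≤ 1) (htR : t ≤ R) (hb : 0 < b) (hbβ : b ≤ β)
    (hβn : β < n) (mB : MeasurableSet B) (hRB : ball x R ⊆ B) (iF : IntegrableOn f B)
    (hf : ∀ y ∈ B, 0 ≤ f y) (iN : IntegrableOn (fun y => ‖x - y‖ ^ (-b) * f y) (ball x R))
    (hK : ∀ y ∈ ball x t, f y ≤ K) (hK0 : 0 ≤ K) :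
    ∫ y in ball x R, ‖x - y‖ ^ (-b) * f y ≤
      K * t ^ (β - b) * (∫ y in ball (0 : Euc n) 1, ‖y‖ ^ (-β)) + t ^ (-b) * ∫ y in B, f y := by
  have sub : ball x t ⊆ ball x R := ball_subset_ball htR
  obtain ⟨ik, ek⟩ := integral_ball_kernel hn hβn x t
  have i1 : IntegrableOn (fun y : Euc n => ‖y‖ ^ (-β)) (ball 0 1) := by
    have := (integral_ball_kernel hn hβn 0 1).1
    simpa only [zero_sub, norm_neg] using this
  have hin : ∫ y in ball x t, ‖x - y‖ ^ (-b) * f y ≤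
      K * t ^ (β - b) * ∫ y in ball (0 : Euc n) 1, ‖y‖ ^ (-β) := by
    calc ∫ y in ball x t, ‖x - y‖ ^ (-b) * f y
        ≤ ∫ y in ball x t, K * t ^ (β - b) * ‖x - y‖ ^ (-β) := by
          refine setIntegral_mono_on (iN.mono_set sub) (ik.const_mul _) measurableSet_ball
            fun y hy => ?_
          have h1 := hK y hy
          have h5 := hf y (hRB (sub hy))
          rw [mem_ball, dist_comm, dist_eq_norm] at hy
          rcases (norm_nonneg (x - y)).eq_or_lt with h | h
          · rw [← h, Real.zero_rpow (by linarith), zero_mul]; positivity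
          have h2 : ‖x - y‖ ^ (-b) = ‖x - y‖ ^ (β - b) * ‖x - y‖ ^ (-β) := by
            rw [← Real.rpow_add h]; congr 1; ring
          have h3 : ‖x - y‖ ^ (β - b) ≤ t ^ (β - b) :=
            Real.rpow_le_rpow h.le hy.le (by linarith)
          rw [h2, mul_comm, ← mul_assoc]
          gcongr
      _ = K * t ^ (β - b) * ∫ y in ball (0 : Euc n) t, ‖y‖ ^ (-β) := by
          rw [integral_const_mul, ek]
      _ ≤ _ := by
          refine mul_le_mul_of_nonneg_left (setIntegral_mono_set i1
            (ae_of_all _ fun y => by positivity) (LE.le.eventuallyLE (ball_subset_ball ht1)))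
            (by positivity)
  have hout : ∫ y in ball x R \ ball x t, ‖x - y‖ ^ (-b) * f y ≤ t ^ (-b) * ∫ y in B, f y := by
    calc ∫ y in ball x R \ ball x t, ‖x - y‖ ^ (-b) * f y
        ≤ ∫ y in ball x R \ ball x t, t ^ (-b) * f y := by
          refine setIntegral_mono_on (iN.mono_set sdiff_subset)
            ((iF.mono_set (sdiff_subset.trans hRB)).const_mul _)
            (measurableSet_ball.diff measurableSet_ball) fun y hy => ?_
          have h5 := hf y (hRB hy.1)
          have hy := hy.2
          rw [mem_ball, dist_comm, dist_eq_norm, not_lt] at hy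
          refine mul_le_mul_of_nonneg_right ?_ h5
          exact Real.rpow_le_rpow_of_nonpos ht hy (by linarith)
      _ = t ^ (-b) * ∫ y in ball x R \ ball x t, f y := integral_const_mul _ _
      _ ≤ _ := by
          refine mul_le_mul_of_nonneg_left (setIntegral_mono_set iF
            ((ae_restrict_iff' mB).2 (ae_of_all _ hf))
            (LE.le.eventuallyLE (sdiff_subset.trans hRB))) (by positivity)
  have hsplit := integral_inter_add_sdiff (measurableSet_ball (x := x) (ε := t)) iN
  rw [inter_eq_self_of_subset_right sub] at hsplit
  rw [← hsplit]
  exact add_le_add hin hout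

/-- Bound for `dⁿ⁻² u(x)` when `u` does not grow by more than a fixed factor on `B(x, d/2)`. -/
lemma doubling_bound {n : ℕ} (hn : 3 ≤ n) {α lam sig : ℝ}
    (hα0 : 0 < α) (hαn : α < n)
    (hlam0 : ((n : ℝ) - α) / ((n : ℝ) - 2) ≤ lam) (hlam1 : lam < (n : ℝ) / ((n : ℝ) - 2))
    (hsig0 : 0 ≤ sig) (hsig1 : sig < (2 * (n : ℝ) - α) / ((n : ℝ) - 2) - lam)
    {u : Euc n → ℝ} (hu : IsCPSolution n α lam sig u) :
    ∃ M : ℝ, ∀ (x : Euc n) (d : ℝ), 0 < d → d ≤ ‖x‖ → ‖x‖ ≤ 1 / 3 →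
      (∀ y ∈ ball x (d / 2), u y ≤ 2 ^ ((n : ℝ) - 2) * u x) → d ^ ((n : ℝ) - 2) * u x ≤ M := by
  obtain ⟨h0, hC2, hi, hlap⟩ := hu
  have hf := fun x hx => (hlap x hx).1
  have hn3 : (3 : ℝ) ≤ n := by exact_mod_cast hn
  set b : ℝ := (n : ℝ) - 2 with hb
  have hb0 : 0 < b := by rw [hb]; linarith
  have hlam : 0 < lam := lt_of_lt_of_le (div_pos (by linarith) hb0) hlam0
  rw [div_le_iff₀ hb0] at hlam0
  rw [lt_div_iff₀ hb0] at hlam1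
  rw [lt_sub_iff_add_lt, lt_div_iff₀ hb0] at hsig1
  obtain ⟨δ, hδ0, hδ⟩ : ∃ δ, 0 < δ ∧ δ < min (min (n - α) (n - lam * b))
      (min 2 ((2 * n - α - (sig + lam) * b) / 2)) := by
    refine exists_between (lt_min (lt_min ?_ ?_) (lt_min ?_ ?_)) <;> linarith
  simp only [lt_min_iff] at hδ
  obtain ⟨⟨hδα, hδl⟩, hδ2, hδE⟩ := hδ
  set E := 2 * n - α - (sig + lam) * b - 2 * δ with hE
  clear_value E
  have hE0 : 0 < E := by rw [hE]; linarith
  set γ := n - lam * b - δ with hγdef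
  clear_value γ
  have hγ : 0 < γ := by rw [hγdef]; linarith
  obtain ⟨D, hD, hpot⟩ := choquard_potential_bound hn h0 hC2 hf hlam hi hγ
    (by rw [← hb, hγdef]; linarith)
  obtain ⟨C, hC, hpw⟩ := pointwise_bound hn h0 hC2 hf
  have iF := integrable_neg_lap hn h0 hC2 hf
  set F := ∫ x in ball (0 : Euc n) 1 \ {0}, -lap u x with hF
  have mB : MeasurableSet (ball (0 : Euc n) 1 \ {0}) :=
    measurableSet_ball.diff (measurableSet_singleton 0)
  have hfB : ∀ x ∈ ball (0 : Euc n) 1 \ {0}, 0 ≤ -lap u x := fun x hx =>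
    hf x ⟨ball_subset_ball (by norm_num) hx.1, hx.2⟩
  have hF0 : 0 ≤ F := setIntegral_nonneg mB hfB
  set β := n - δ with hβ
  set G := ∫ y in ball (0 : Euc n) 1, ‖y‖ ^ (-β) with hG
  have hG0 : 0 ≤ G := integral_nonneg fun y => by positivity
  set c := (2 * (C * (1 + F)) + 1) ^ (1 / b) with hc
  have hc0 : 0 < c := by positivity
  have hcb : c ^ b = 2 * (C * (1 + F)) + 1 := by
    rw [hc, ← Real.rpow_mul (by positivity), one_div_mul_cancel hb0.ne', Real.rpow_one]
  clear_value F G β c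
  have hαβ : α ≤ β := by rw [hβ]; linarith
  have hβn : β < n := by rw [hβ]; linarith
  have hγα : γ ≤ α := by rw [hγdef]; linarith
  set Q := C * G * (c ^ (2 - δ) * ((((2 : ℝ) ^ b) ^ lam * c ^ (β - α) * G + c ^ (γ - α) * D) *
    ((2 : ℝ) ^ b) ^ sig)) with hQ
  have hQ0 : 0 ≤ Q := by positivity
  clear_value Q
  refine ⟨max (max 1 ((2 * Q) ^ (b / E))) ((4 * c) ^ b), fun x d hd hdx hx3 hdb => ?_⟩
  have hux := h0 x
  rcases le_or_gt (u x) (max 1 ((2 * Q) ^ (b / E))) with hU | hU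
  · refine le_trans ?_ (hU.trans (le_max_left _ _))
    exact mul_le_of_le_one_left hux (Real.rpow_le_one hd.le (by linarith) hb0.le)
  rw [max_lt_iff] at hU
  have hu1 := hU.1
  have hupos : 0 < u x := by linarith
  set s := u x ^ (-(1 / b)) with hs
  have hs0 : 0 < s := by positivity
  obtain ⟨hsE, hsb⟩ := exists_scale hupos hb0 hE0 hQ0 hU.2
  rw [← hs] at hsE hsb
  clear_value s
  set t := c * s with ht
  have ht0 : 0 < t := by positivity
  clear_value t
  have hxn : 0 < ‖x‖ := hd.trans_le hdx
  rcases lt_or_ge (d / 4) t with htd | htd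
  · refine le_trans ?_ (le_max_right _ _)
    have h1 : d ^ b ≤ (4 * c * s) ^ b := Real.rpow_le_rpow hd.le (by rw [mul_assoc, ← ht]; linarith) hb0.le
    rw [Real.mul_rpow (by positivity) hs0.le] at h1
    have h2 : s ^ b * u x = 1 := by rw [← hsb, ← Real.rpow_add hs0, add_neg_cancel, Real.rpow_zero]
    calc d ^ b * u x ≤ (4 * c) ^ b * s ^ b * u x := by gcongr
      _ = (4 * c) ^ b := by rw [mul_assoc, h2, mul_one]
  exfalso
  obtain ⟨iN, hN⟩ := hpw x (norm_pos_iff.1 hxn) (by linarith)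
  rw [← hb] at iN hN
  have htb : t ^ (-b) = (c ^ b)⁻¹ * u x := by
    rw [ht, Real.mul_rpow hc0.le hs0.le, hsb, Real.rpow_neg hc0.le]
  have near : ∀ y ∈ ball x (‖x‖ / 2), y ∈ ball (0 : Euc n) 1 \ {0} := fun y hy => by
    rw [mem_ball, dist_eq_norm] at hy
    have h1 : ‖x‖ ≤ ‖y - x‖ + ‖y‖ := by
      have := norm_sub_le y (y - x); rw [sub_sub_cancel] at this; linarith
    have h2 : ‖y‖ ≤ ‖y - x‖ + ‖x‖ := by simpa using norm_add_le (y - x) x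
    refine ⟨by rw [mem_ball_zero_iff]; linarith, ?_⟩
    rintro rfl
    rw [norm_zero] at h1; linarith
  have sub : ball x t ⊆ ball x (‖x‖ / 2) := ball_subset_ball (by linarith)
  set K := (((2 : ℝ) ^ b * s ^ (-b)) ^ lam * t ^ (β - α) * G + t ^ (γ - α) * D) *
      ((2 : ℝ) ^ b * s ^ (-b)) ^ sig with hK
  have hK0 : 0 ≤ K := by positivity
  have hfK : ∀ z ∈ ball x t, -lap u z ≤ K := fun z hz => by
    have hzB := near z (sub hz)
    have hzu : u z ≤ 2 ^ b * s ^ (-b) := by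
      rw [hsb]; exact hdb z (ball_subset_ball (by linarith) hz)
    have hz' : ‖z‖ ≤ 1 / 2 := by
      rw [mem_ball, dist_eq_norm] at hz
      have h2 : ‖z‖ ≤ ‖z - x‖ + ‖x‖ := by simpa using norm_add_le (z - x) x
      linarith
    refine (hlap z ⟨ball_subset_ball (by norm_num) hzB.1, hzB.2⟩).2.trans ?_
    have hnear : ∀ y ∈ ball z t, u y ≤ 2 ^ b * s ^ (-b) := fun y hy => by
      rw [hsb]
      refine hdb y ?_
      rw [mem_ball] at hy hz ⊢
      linarith [dist_triangle y z x]
    have hch := integral_choquard_le (by omega) h0 hlam hi hα0 hαβ hβn hγα hD (hpot z hz') ht0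
      (by linarith) (by positivity : 0 ≤ (2 : ℝ) ^ b * s ^ (-b)) hnear
    rw [← hG] at hch
    rw [hK]
    exact mul_le_mul hch (Real.rpow_le_rpow (h0 z) hzu hsig0) (Real.rpow_nonneg (h0 z) _)
      (by positivity)
  have hsplit := integral_newton_le (by omega) ht0 (by linarith) (by linarith) hb0
    (by rw [hb, hβ]; linarith) hβn mB near iF hfB iN hfK hK0
  rw [show β - b = 2 - δ by rw [hb, hβ]; ring, ← hG, ← hF] at hsplit
  have hxt : ‖x‖ ^ (-b) ≤ t ^ (-b) :=
    Real.rpow_le_rpow_of_nonpos ht0 (by linarith) (by linarith)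
  have hKQ : C * (K * t ^ (2 - δ) * G) = Q * s ^ E * u x := by
    have := rescaled_powers (b := b) (p := 2 - δ) (q := β - α) (r := γ - α) (lam := lam)
      (sig := sig) (C := G) (D := D) (E := E) hc0 hs0 (by rw [hE, hβ, hb]; ring)
      (by rw [hE, hγdef, hb]; ring)
    rw [← ht, ← hK, hsb] at this
    rw [hQ]
    linear_combination C * G * this
  have hfin : u x ≤ C * (1 + F) * t ^ (-b) + Q * s ^ E * u x := by
    calc u x ≤ _ := hN
      _ ≤ C * (t ^ (-b) + (K * t ^ (2 - δ) * G + t ^ (-b) * F)) := by gcongr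
      _ = _ := by rw [← hKQ]; ring
  have hhalf : C * (1 + F) * t ^ (-b) ≤ u x / 2 := by
    rw [htb, hcb, ← mul_assoc, ← div_eq_mul_inv, div_mul_eq_mul_div,
      div_le_iff₀ (by positivity)]
    have : u x / 2 * (2 * (C * (1 + F)) + 1) = C * (1 + F) * u x + u x / 2 := by ring
    linarith
  have := mul_lt_mul_of_pos_right hsE hupos
  linarith

theorem stmt11 (n : ℕ) (hn : 3 ≤ n) (α lam sig : ℝ)
    (hα0 : 0 < α) (hαn : α < n)
    (hlam0 : ((n : ℝ) - α) / ((n : ℝ) - 2) ≤ lam) (hlam1 : lam < (n : ℝ) / ((n : ℝ) - 2))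
    (hsig0 : 0 ≤ sig) (hsig1 : sig < (2 * (n : ℝ) - α) / ((n : ℝ) - 2) - lam)
    (u : Euc n → ℝ) (hu : IsCPSolution n α lam sig u) :
    u =O[𝓝[≠] (0 : Euc n)] fun x => ‖x‖ ^ (2 - (n : ℝ)) := by
  obtain ⟨M, hM⟩ := doubling_bound hn hα0 hαn hlam0 hlam1 hsig0 hsig1 hu
  obtain ⟨h0, hC2, -, -⟩ := hu
  have hn3 : (3 : ℝ) ≤ n := by exact_mod_cast hn
  set b : ℝ := (n : ℝ) - 2 with hb
  have hb0 : 0 < b := by rw [hb]; linarith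
  obtain ⟨L, hL⟩ := (isCompact_shell n (1 / 3) (1 / 2)).exists_bound_of_continuousOn
    (hC2.continuousOn.mono (shell_subset (by norm_num)))
  have main : ∀ x : Euc n, x ≠ 0 → ‖x‖ ≤ 1 / 3 → (‖x‖ / 2) ^ b * u x ≤ max (max M L) 0 := by
    intro a ha ha3
    have hna := norm_pos_iff.2 ha
    set ε := ‖a‖ / 2 with hε
    have hε0 : 0 < ε := by positivity
    have hcont : ContinuousOn (fun x : Euc n => (‖x‖ - ε) ^ b * u x) {x | ε ≤ ‖x‖ ∧ ‖x‖ ≤ 1 / 3} :=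
      ((continuous_norm.sub continuous_const).rpow_const fun _ => Or.inr hb0.le).continuousOn.mul
        (hC2.continuousOn.mono (shell_subset hε0))
    obtain ⟨x, ⟨hx1, hx2⟩, hmax⟩ := (isCompact_shell n ε (1 / 3)).exists_isMaxOn
      ⟨a, by rw [hε]; linarith, ha3⟩ hcont
    have haS : (‖a‖ - ε) ^ b * u a ≤ (‖x‖ - ε) ^ b * u x :=
      hmax (a := a) ⟨by rw [hε]; linarith, ha3⟩
    rw [show ‖a‖ - ε = ε by rw [hε]; ring] at haS
    refine haS.trans ?_
    rcases hx1.eq_or_lt with hd | hd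
    · rw [← hd, sub_self, Real.zero_rpow hb0.ne', zero_mul]
      exact le_max_right _ _
    have hd0 : 0 < ‖x‖ - ε := by linarith
    refine le_trans ?_ (le_max_left _ _)
    rcases le_or_gt (u x) L with hxL | hxL
    · refine le_trans ?_ (hxL.trans (le_max_right _ _))
      exact mul_le_of_le_one_left (h0 x) (Real.rpow_le_one hd0.le (by linarith) hb0.le)
    refine le_trans (hM x _ hd0 (by linarith) hx2 fun y hy => ?_) (le_max_left _ _)
    rw [mem_ball, dist_eq_norm] at hy
    have h1 : ‖x‖ ≤ ‖y - x‖ + ‖y‖ := by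
      have := norm_sub_le y (y - x); rw [sub_sub_cancel] at this; linarith
    have h2 : ‖y‖ ≤ ‖y - x‖ + ‖x‖ := by simpa using norm_add_le (y - x) x
    rcases le_or_gt ‖y‖ (1 / 3) with hy3 | hy3
    · have h3 : (‖y‖ - ε) ^ b * u y ≤ (‖x‖ - ε) ^ b * u x :=
        hmax (a := y) ⟨by linarith, hy3⟩
      have h4 : ((‖x‖ - ε) / 2) ^ b ≤ (‖y‖ - ε) ^ b :=
        Real.rpow_le_rpow (by linarith) (by linarith) hb0.le
      have h5 := (mul_le_mul_of_nonneg_right h4 (h0 y)).trans h3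
      rw [Real.div_rpow hd0.le (by norm_num), div_mul_eq_mul_div, div_le_iff₀ (by positivity),
        mul_assoc] at h5
      rw [mul_comm (2 ^ b)]
      exact le_of_mul_le_mul_left h5 (by positivity)
    · have h3 := (le_abs_self _).trans (hL y ⟨hy3.le, by linarith⟩)
      have h4 : (1 : ℝ) ≤ 2 ^ b := Real.one_le_rpow (by norm_num) hb0.le
      exact (h3.trans hxL.le).trans (le_mul_of_one_le_left (h0 x) h4)
  refine IsBigO.of_bound (max (max M L) 0 * 2 ^ b) ?_
  filter_upwards [self_mem_nhdsWithin,
    nhdsWithin_le_nhds (closedBall_mem_nhds (0 : Euc n) (by norm_num : (0 : ℝ) < 1 / 3))] with x hx hx3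
  have hxn := norm_pos_iff.2 hx
  have h := main x hx (by simpa using hx3)
  rw [Real.norm_of_nonneg (h0 x), Real.norm_of_nonneg (by positivity),
    show 2 - (n : ℝ) = -b by rw [hb]; ring, Real.rpow_neg hxn.le, ← div_eq_mul_inv,
    le_div_iff₀ (by positivity)]
  rw [Real.div_rpow hxn.le (by norm_num), div_mul_eq_mul_div, div_le_iff₀ (by positivity)] at h
  linarith
end

section
/- Suppose n ≥ 3, α ∈ (0,n), and (n−α)/(n−2) ≤ λ ≤ n/(n−2), and σ satisfies: σ ≥ n/(n−2) if λ = (n−α)/(n−2); σ > (2n−α)/(n−2) − λ if (n−α)/(n−2) < λ < n/(n−2); and σ > (n−α)/(n−2) if λ = n/(n−2). Let φ : (0,1) → (0,∞) be a continuous function with φ(t) → ∞ as t → 0⁺. Then there exists a nonnegative solution u of the Choquard–Pekar inequality problem such that u(x) ≠ O(φ(|x|)) as x → 0. -/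
open MeasureTheory Metric Filter Set Asymptotics Topology

/-- `u(x) ≠ O(φ(|x|))` as `x → 0`: there is a sequence `x_j → 0` with
`u(x_j)/φ(|x_j|) → ∞`. -/
def NotBigOAt (n : ℕ) (u : Euc n → ℝ) (φ : ℝ → ℝ) : Prop :=
  ∃ x : ℕ → Euc n, (∀ j, x j ≠ 0) ∧ Tendsto x atTop (𝓝 0) ∧
    Tendsto (fun j => u (x j) / φ ‖x j‖) atTop atTop

lemma lap_eq_laplacian {n : ℕ} (u : Euc n → ℝ) : lap u = Laplacian.laplacian u := by
  rw [InnerProductSpace.laplacian_eq_iteratedFDeriv_orthonormalBasis u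
    (EuclideanSpace.basisFun (Fin n) ℝ)]
  funext x
  simp [lap]

lemma contDiff_two_of_hasDerivAt {H H₁ H₂ : ℝ → ℝ} (h₁ : ∀ s, HasDerivAt H (H₁ s) s)
    (h₂ : ∀ s, HasDerivAt H₁ (H₂ s) s) (hc : Continuous H₂) : ContDiff ℝ 2 H := by
  have e₁ : deriv H = H₁ := funext fun s => (h₁ s).deriv
  have e₂ : deriv H₁ = H₂ := funext fun s => (h₂ s).deriv
  have c₁ : ContDiff ℝ 1 H₁ := contDiff_one_iff_deriv.2
    ⟨fun s => (h₂ s).differentiableAt, by rwa [e₂]⟩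
  rw [show (2 : WithTop ℕ∞) = 1 + 1 by norm_num, contDiff_succ_iff_deriv]
  exact ⟨fun s => (h₁ s).differentiableAt, by simp, by rwa [e₁]⟩

lemma contDiff_radial {n : ℕ} {H : ℝ → ℝ} (hH : ContDiff ℝ 2 H) (c : Euc n) :
    ContDiff ℝ 2 fun x : Euc n => H (‖x - c‖ ^ 2) :=
  hH.comp ((contDiff_id.sub contDiff_const).norm_sq ℝ)

/-- The Laplacian of a radial function, in terms of the squared distance to the centre. -/
lemma lap_radial {n : ℕ} {H H₁ H₂ : ℝ → ℝ} (h₁ : ∀ s, HasDerivAt H (H₁ s) s)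
    (h₂ : ∀ s, HasDerivAt H₁ (H₂ s) s) (c x : Euc n) :
    lap (fun x : Euc n => H (‖x - c‖ ^ 2)) x =
      4 * ‖x - c‖ ^ 2 * H₂ (‖x - c‖ ^ 2) + 2 * n * H₁ (‖x - c‖ ^ 2) := by
  have hsq : ∀ y : Euc n, HasFDerivAt (fun y : Euc n => ‖y - c‖ ^ 2)
      ((2 : ℝ) • innerSL ℝ (y - c)) y := by
    intro y
    exact (((hasFDerivAt_id y).sub_const c).norm_sq).congr_fderiv (by ext z; simp)
  have hf : ∀ y : Euc n, HasFDerivAt (fun y : Euc n => H (‖y - c‖ ^ 2))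
      (H₁ (‖y - c‖ ^ 2) • ((2 : ℝ) • innerSL ℝ (y - c))) y := fun y =>
    (h₁ _).comp_hasFDerivAt y (hsq y)
  have hfd : fderiv ℝ (fun y : Euc n => H (‖y - c‖ ^ 2)) =
      fun y => H₁ (‖y - c‖ ^ 2) • ((2 : ℝ) • innerSL ℝ (y - c)) :=
    funext fun y => (hf y).fderiv
  have hlin : HasFDerivAt (fun y : Euc n => (2 : ℝ) • innerSL ℝ (y - c))
      ((2 : ℝ) • (innerSL ℝ : Euc n →L[ℝ] Euc n →L[ℝ] ℝ)) x :=
    (((innerSL ℝ : Euc n →L[ℝ] Euc n →L[ℝ] ℝ).hasFDerivAt).comp x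
      ((hasFDerivAt_id x).sub_const c)).const_smul (2 : ℝ)
  have hff := ((h₂ _).comp_hasFDerivAt x (hsq x)).smul hlin
  have key : ∀ i : Fin n, iteratedFDeriv ℝ 2 (fun y : Euc n => H (‖y - c‖ ^ 2)) x
      ![EuclideanSpace.single i 1, EuclideanSpace.single i 1] =
      4 * H₂ (‖x - c‖ ^ 2) * ((x - c) i) ^ 2 + 2 * H₁ (‖x - c‖ ^ 2) := by
    intro i
    rw [iteratedFDeriv_two_apply, hfd]
    erw [hff.fderiv]
    have hone : innerSL ℝ (EuclideanSpace.single i (1 : ℝ)) (EuclideanSpace.single i (1 : ℝ)) =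
        (1 : ℝ) := by
      rw [innerSL_apply_apply]; simp
    simp [EuclideanSpace.inner_single_right, hone]
    ring
  simp only [lap, key, Finset.sum_add_distrib, ← Finset.mul_sum]
  rw [EuclideanSpace.real_norm_sq_eq]
  simp
  ring

lemma hasDerivAt_ite_le {f g f' g' : ℝ → ℝ} {q : ℝ} (hf : ∀ s ≤ q, HasDerivAt f (f' s) s)
    (hg : ∀ s, q ≤ s → HasDerivAt g (g' s) s) (h₀ : f q = g q) (h₁ : f' q = g' q) (s : ℝ) :
    HasDerivAt (fun s => if s ≤ q then f s else g s) (if s ≤ q then f' s else g' s) s := by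
  rcases lt_trichotomy s q with h | rfl | h
  · rw [if_pos h.le]
    refine (hf s h.le).congr_of_eventuallyEq ?_
    filter_upwards [Iio_mem_nhds h] with y hy
    exact if_pos (le_of_lt hy)
  · rw [if_pos le_rfl, ← hasDerivWithinAt_univ, ← Iic_union_Ici (a := s)]
    refine HasDerivWithinAt.union ?_ ?_
    · exact (hf s le_rfl).hasDerivWithinAt.congr (fun y hy => if_pos hy) (if_pos le_rfl)
    · rw [h₁]
      refine (hg s le_rfl).hasDerivWithinAt.congr (fun y hy => ?_) (by simp [h₀])
      rcases eq_or_lt_of_le (show s ≤ y from hy) with rfl | hy'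
      · simp [h₀]
      · exact if_neg (not_le.2 hy')
  · rw [if_neg (not_le.2 h)]
    refine (hg s h.le).congr_of_eventuallyEq ?_
    filter_upwards [Ioi_mem_nhds h] with y hy
    exact if_neg (not_le.2 hy)

/-- The function `s ↦ s ^ (-a)` for `s > q`, continued to `s ≤ q` by its second order Taylor
polynomial at `q`. -/
noncomputable def cappedPow (a q s : ℝ) : ℝ :=
  if s ≤ q then q ^ (-a) + -a * q ^ (-a - 1) * (s - q) +
    a * (a + 1) / 2 * q ^ (-a - 2) * (s - q) ^ 2 else s ^ (-a)

/-- The derivative of `cappedPow`. -/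
noncomputable def cappedPowDeriv (a q s : ℝ) : ℝ :=
  if s ≤ q then -a * q ^ (-a - 1) + a * (a + 1) * q ^ (-a - 2) * (s - q)
  else -a * s ^ (-a - 1)

lemma hasDerivAt_cappedPow {a q : ℝ} (hq : 0 < q) (s : ℝ) :
    HasDerivAt (cappedPow a q) (cappedPowDeriv a q s) s := by
  refine hasDerivAt_ite_le (q := q)
    (f := fun s => q ^ (-a) + -a * q ^ (-a - 1) * (s - q) +
      a * (a + 1) / 2 * q ^ (-a - 2) * (s - q) ^ 2)
    (g := fun s => s ^ (-a))
    (f' := fun s => -a * q ^ (-a - 1) + a * (a + 1) * q ^ (-a - 2) * (s - q))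
    (g' := fun s => -a * s ^ (-a - 1)) (fun s _ => ?_) (fun s hs => ?_) (by simp) (by simp) s
  · have h := (hasDerivAt_id s).sub_const q
    refine (((h.const_mul (-a * q ^ (-a - 1))).const_add (q ^ (-a))).add
      ((h.pow 2).const_mul (a * (a + 1) / 2 * q ^ (-a - 2)))).congr_deriv ?_
    simp
    ring
  · exact Real.hasDerivAt_rpow_const (Or.inl (hq.trans_le hs).ne')

lemma hasDerivAt_cappedPowDeriv {a q : ℝ} (hq : 0 < q) (s : ℝ) :
    HasDerivAt (cappedPowDeriv a q) (a * (a + 1) * max s q ^ (-a - 2)) s := by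
  have key := hasDerivAt_ite_le (q := q)
    (f := fun s => -a * q ^ (-a - 1) + a * (a + 1) * q ^ (-a - 2) * (s - q))
    (g := fun s => -a * s ^ (-a - 1)) (f' := fun _ => a * (a + 1) * q ^ (-a - 2))
    (g' := fun s => a * (a + 1) * s ^ (-a - 2)) (fun s _ => ?_) (fun s hs => ?_) (by simp) (by simp) s
  · refine key.congr_deriv ?_
    split_ifs with h
    · rw [max_eq_right h]
    · rw [max_eq_left (le_of_not_ge h)]
  · have h := (hasDerivAt_id s).sub_const q
    refine ((h.const_mul (a * (a + 1) * q ^ (-a - 2))).const_add _).congr_deriv ?_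
    simp
  · refine ((Real.hasDerivAt_rpow_const (p := -a - 1)
      (Or.inl (hq.trans_le hs).ne')).const_mul (-a)).congr_deriv ?_
    rw [show -a - 1 - 1 = -a - 2 by ring]
    ring

lemma contDiff_cappedPow {a q : ℝ} (hq : 0 < q) : ContDiff ℝ 2 (cappedPow a q) := by
  refine contDiff_two_of_hasDerivAt (hasDerivAt_cappedPow hq) (hasDerivAt_cappedPowDeriv hq) ?_
  refine continuous_const.mul ((continuous_id.max continuous_const).rpow_const fun s => ?_)
  exact Or.inl (lt_max_of_lt_right hq).ne'

lemma cappedPow_of_le {a q s : ℝ} (h : q ≤ s) : cappedPow a q s = s ^ (-a) := by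
  rcases eq_or_lt_of_le h with rfl | h
  · simp [cappedPow]
  · exact if_neg (not_le.2 h)

lemma rpow_neg_sub_one_eq {a q : ℝ} (hq : 0 < q) : q ^ (-a - 1) = q * q ^ (-a - 2) := by
  rw [show -a - 1 = 1 + (-a - 2) by ring, Real.rpow_add hq, Real.rpow_one]

lemma rpow_neg_eq {a q : ℝ} (hq : 0 < q) : q ^ (-a) = q ^ 2 * q ^ (-a - 2) := by
  rw [show -a = (2 : ℕ) + (-a - 2) by push_cast; ring, Real.rpow_add hq, Real.rpow_natCast]
  norm_num

lemma cappedPow_bounds {a q s : ℝ} (ha : 0 < a) (hq : 0 < q) (hs : 0 ≤ s) :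
    max s q ^ (-a) ≤ cappedPow a q s ∧
      cappedPow a q s ≤ (1 + a + a * (a + 1) / 2) * max s q ^ (-a) := by
  rcases le_total q s with h | h
  · rw [cappedPow_of_le h, max_eq_left h]
    refine ⟨le_rfl, le_mul_of_one_le_left (by positivity) ?_⟩
    nlinarith [mul_pos ha ha]
  · rw [max_eq_right h, cappedPow, if_pos h, rpow_neg_sub_one_eq hq, rpow_neg_eq hq]
    have hP : 0 < q ^ (-a - 2) := by positivity
    set P := q ^ (-a - 2)
    have h₁ : 0 ≤ a * P * (q * (q - s)) :=
      mul_nonneg (by positivity) (mul_nonneg hq.le (by linarith))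
    have h₂ : 0 ≤ a * (a + 1) / 2 * P * (s - q) ^ 2 := by positivity
    have h₃ : 0 ≤ a * P * (q * s) := by positivity
    have h₄ : 0 ≤ a * (a + 1) / 2 * P * (s * (2 * q - s)) :=
      mul_nonneg (by positivity) (mul_nonneg hs (by linarith))
    constructor <;> nlinarith

/-- A `C²` superharmonic regularisation, at scale `r`, of the fundamental solution
`‖x - c‖ ^ (-(n - 2))` with pole `c`. -/
noncomputable def cappedPole {n : ℕ} (c : Euc n) (r : ℝ) (x : Euc n) : ℝ :=
  cappedPow (((n : ℝ) - 2) / 2) (r ^ 2) (‖x - c‖ ^ 2)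

lemma contDiff_cappedPole {n : ℕ} (c : Euc n) {r : ℝ} (hr : 0 < r) :
    ContDiff ℝ 2 (cappedPole c r) :=
  contDiff_radial (contDiff_cappedPow (by positivity)) c

lemma sq_rpow_neg {D b : ℝ} (hD : 0 ≤ D) : (D ^ 2) ^ (-(b / 2)) = D ^ (-b) := by
  rw [← Real.rpow_natCast, ← Real.rpow_mul hD]
  congr 1
  push_cast
  ring

lemma cappedPole_of_le {n : ℕ} {c x : Euc n} {r : ℝ} (hr : 0 < r) (h : r ≤ ‖x - c‖) :
    cappedPole c r x = ‖x - c‖ ^ (-((n : ℝ) - 2)) := by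
  rw [cappedPole, cappedPow_of_le (by gcongr), sq_rpow_neg (norm_nonneg _)]

lemma max_sq {x y : ℝ} (hx : 0 ≤ x) (hy : 0 ≤ y) : max (x ^ 2) (y ^ 2) = max x y ^ 2 := by
  rcases le_total x y with h | h
  · rw [max_eq_right h, max_eq_right (by gcongr)]
  · rw [max_eq_left h, max_eq_left (by gcongr)]

lemma exists_cappedPole_bounds {n : ℕ} (hn : 3 ≤ n) : ∃ G : ℝ, 1 ≤ G ∧
    ∀ (c : Euc n) (r : ℝ), 0 < r → ∀ x, max ‖x - c‖ r ^ (-((n : ℝ) - 2)) ≤ cappedPole c r x ∧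
      cappedPole c r x ≤ G * max ‖x - c‖ r ^ (-((n : ℝ) - 2)) := by
  have hn' : (3 : ℝ) ≤ n := by exact_mod_cast hn
  have ha : 0 < ((n : ℝ) - 2) / 2 := by linarith
  refine ⟨1 + ((n : ℝ) - 2) / 2 + ((n : ℝ) - 2) / 2 * (((n : ℝ) - 2) / 2 + 1) / 2,
    by nlinarith, fun c r hr x => ?_⟩
  have := cappedPow_bounds ha (q := r ^ 2) (s := ‖x - c‖ ^ 2) (by positivity) (by positivity)
  rwa [max_sq (norm_nonneg _) hr.le, sq_rpow_neg (le_max_of_le_right hr.le)] at this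

lemma lap_cappedPole {n : ℕ} (c x : Euc n) {r : ℝ} (hr : 0 < r) :
    lap (cappedPole c r) x = 4 * ‖x - c‖ ^ 2 *
      (((n : ℝ) - 2) / 2 * (((n : ℝ) - 2) / 2 + 1) *
        max (‖x - c‖ ^ 2) (r ^ 2) ^ (-(((n : ℝ) - 2) / 2) - 2)) +
      2 * n * cappedPowDeriv (((n : ℝ) - 2) / 2) (r ^ 2) (‖x - c‖ ^ 2) :=
  lap_radial (hasDerivAt_cappedPow (by positivity)) (hasDerivAt_cappedPowDeriv (by positivity)) c x

lemma lap_cappedPole_of_le {n : ℕ} {c x : Euc n} {r : ℝ} (hr : 0 < r) (h : r ≤ ‖x - c‖) :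
    lap (cappedPole c r) x = 0 := by
  have h2 : r ^ 2 ≤ ‖x - c‖ ^ 2 := by gcongr
  have hs : 0 < ‖x - c‖ ^ 2 := lt_of_lt_of_le (by positivity) h2
  rw [lap_cappedPole c x hr, max_eq_left h2]
  have hd : cappedPowDeriv (((n : ℝ) - 2) / 2) (r ^ 2) (‖x - c‖ ^ 2) =
      -(((n : ℝ) - 2) / 2) * (‖x - c‖ ^ 2) ^ (-(((n : ℝ) - 2) / 2) - 1) := by
    rcases eq_or_lt_of_le h2 with h2 | h2
    · simp [cappedPowDeriv, h2]
    · exact if_neg (not_le.2 h2)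
  rw [hd, rpow_neg_sub_one_eq hs]
  ring

lemma exists_lap_cappedPole_bounds {n : ℕ} (hn : 3 ≤ n) : ∃ C : ℝ, 0 < C ∧
    ∀ (c : Euc n) (r : ℝ), 0 < r → ∀ x, 0 ≤ -lap (cappedPole c r) x ∧
      -lap (cappedPole c r) x ≤ C * r ^ (-(n : ℝ)) := by
  have hn' : (3 : ℝ) ≤ n := by exact_mod_cast hn
  set a : ℝ := ((n : ℝ) - 2) / 2 with ha_def
  have ha : 0 < a := by rw [ha_def]; linarith
  have hna : (n : ℝ) = 2 * a + 2 := by rw [ha_def]; ring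
  refine ⟨2 * a * n * (a + 2), by positivity, fun c r hr x => ?_⟩
  rcases le_total r ‖x - c‖ with h | h
  · rw [lap_cappedPole_of_le hr h]
    exact ⟨by simp, by simp; positivity⟩
  · have h2 : ‖x - c‖ ^ 2 ≤ r ^ 2 := by gcongr
    have hq : 0 < r ^ 2 := by positivity
    have hr2 : r ^ (-(n : ℝ)) = r ^ 2 * (r ^ 2) ^ (-a - 2) := by
      rw [← rpow_neg_sub_one_eq hq, ← sq_rpow_neg hr.le]
      congr 1
      rw [ha_def]; ring
    have hP : 0 < (r ^ 2) ^ (-a - 2) := by positivity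
    have e : -lap (cappedPole c r) x =
        2 * a * n * (a + 2) * ((r ^ 2) ^ (-a - 2) * (r ^ 2 - ‖x - c‖ ^ 2)) := by
      rw [lap_cappedPole c x hr, max_eq_right h2, cappedPowDeriv, if_pos h2,
        rpow_neg_sub_one_eq hq, ← ha_def, hna]
      ring
    rw [e, hr2]
    have := sq_nonneg ‖x - c‖
    constructor
    · exact mul_nonneg (by positivity) (mul_nonneg hP.le (by linarith))
    · refine mul_le_mul_of_nonneg_left ?_ (by positivity)
      nlinarith

lemma continuous_max_norm_rpow {n : ℕ} (c : Euc n) {r : ℝ} (hr : 0 < r) (b : ℝ) :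
    Continuous fun y : Euc n => max ‖y - c‖ r ^ (-b) :=
  (((continuous_id.sub continuous_const).norm).max continuous_const).rpow_const fun _ =>
    Or.inl (lt_max_of_lt_right hr).ne'

lemma integrableOn_ball_of_continuous {n : ℕ} {f : Euc n → ℝ} (hf : Continuous f) (c : Euc n)
    (ρ : ℝ) : IntegrableOn f (ball c ρ) :=
  (hf.continuousOn.integrableOn_compact (isCompact_closedBall c ρ)).mono_set
    ball_subset_closedBall

lemma setIntegral_ball_sub {n : ℕ} (F : ℝ → ℝ) (c : Euc n) (ρ : ℝ) :
    ∫ y in ball c ρ, F ‖y - c‖ = ∫ y in ball (0 : Euc n) ρ, F ‖y‖ := by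
  rw [← integral_indicator measurableSet_ball, ← integral_indicator measurableSet_ball,
    ← integral_sub_right_eq_self ((ball (0 : Euc n) ρ).indicator fun y => F ‖y‖) c]
  congr 1
  funext y
  simp [indicator, dist_eq_norm]

lemma integrableOn_ball_norm_rpow {n : ℕ} (hn : 1 ≤ n) {b : ℝ} (hb : b < n) (ρ : ℝ) :
    IntegrableOn (fun y : Euc n => ‖y‖ ^ (-b)) (ball 0 ρ) := by
  refine integrableOn_ball_of_norm_le_rpow (C := 1) (α := b) (by simpa using hn) (by simpa using hb)
    (Eventually.of_forall fun x => ?_) (Measurable.aestronglyMeasurable (by fun_prop))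
  rw [one_mul, Real.norm_of_nonneg (by positivity)]

lemma exists_integral_max_le {n : ℕ} (hn : 1 ≤ n) {b δ : ℝ} (hδ : 0 ≤ δ) (hδb : δ ≤ b)
    (hb : b - δ < n) : ∃ J : ℝ, 0 < J ∧ ∀ (c : Euc n) (r ρ : ℝ), 0 < r → ρ ≤ 1 →
      ∫ y in ball c ρ, max ‖y - c‖ r ^ (-b) ≤ J * r ^ (-δ) := by
  have : Nontrivial (Euc n) := by
    have : Nonempty (Fin n) := ⟨⟨0, hn⟩⟩
    infer_instance
  have hi := integrableOn_ball_norm_rpow hn hb 1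
  have h0 : 0 ≤ ∫ y in ball (0 : Euc n) 1, ‖y‖ ^ (-(b - δ)) :=
    integral_nonneg fun y => by positivity
  refine ⟨(∫ y in ball (0 : Euc n) 1, ‖y‖ ^ (-(b - δ))) + 1, by linarith, fun c r ρ hr hρ => ?_⟩
  rw [setIntegral_ball_sub (fun d => max d r ^ (-b))]
  have hcont : Continuous fun y : Euc n => max ‖y‖ r ^ (-b) := by
    simpa using continuous_max_norm_rpow (0 : Euc n) hr b
  calc ∫ y in ball (0 : Euc n) ρ, max ‖y‖ r ^ (-b)
      ≤ ∫ y in ball (0 : Euc n) 1, max ‖y‖ r ^ (-b) := by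
        refine setIntegral_mono_set (integrableOn_ball_of_continuous hcont 0 1)
          (Eventually.of_forall fun y => ?_) (ball_subset_ball hρ).eventuallyLE
        exact Real.rpow_nonneg (le_max_of_le_right hr.le) _
    _ ≤ ∫ y in ball (0 : Euc n) 1, ‖y‖ ^ (-(b - δ)) * r ^ (-δ) := by
        refine integral_mono_ae (integrableOn_ball_of_continuous hcont 0 1) (hi.mul_const _) ?_
        refine ae_restrict_of_ae ?_
        have : ∀ᵐ y : Euc n, y ≠ 0 := by simp [ae_iff]
        filter_upwards [this] with y hy
        have hy : 0 < ‖y‖ := norm_pos_iff.2 hy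
        have hm : 0 < max ‖y‖ r := lt_max_of_lt_right hr
        rw [show -b = -(b - δ) + -δ by ring, Real.rpow_add hm]
        exact mul_le_mul
          (Real.rpow_le_rpow_of_nonpos hy (le_max_left _ _) (by linarith))
          (Real.rpow_le_rpow_of_nonpos hr (le_max_right _ _) (by linarith))
          (by positivity) (by positivity)
    _ = (∫ y in ball (0 : Euc n) 1, ‖y‖ ^ (-(b - δ))) * r ^ (-δ) := integral_mul_const _ _
    _ ≤ _ := by
        have : 0 < r ^ (-δ) := by positivity
        nlinarith

lemma volume_real_unit_ball_pos (n : ℕ) : 0 < volume.real (ball (0 : Euc n) 1) :=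
  ENNReal.toReal_pos (measure_ball_pos _ _ one_pos).ne' measure_ball_lt_top.ne

lemma le_integral_max {n : ℕ} (c : Euc n) {b r ρ : ℝ} (hr : 0 < r) (hρ : r ≤ ρ) :
    volume.real (ball (0 : Euc n) 1) * r ^ ((n : ℝ) - b) ≤
      ∫ y in ball c ρ, max ‖y - c‖ r ^ (-b) := by
  have hcont := continuous_max_norm_rpow c hr b
  calc volume.real (ball (0 : Euc n) 1) * r ^ ((n : ℝ) - b)
      = ∫ y in ball c r, r ^ (-b) := by
        rw [setIntegral_const, measureReal_def, measureReal_def,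
          Measure.addHaar_ball_of_pos _ _ hr, ENNReal.toReal_mul, ENNReal.toReal_ofReal (by positivity),
          smul_eq_mul,
          sub_eq_add_neg, Real.rpow_add hr, Real.rpow_natCast]
        simp
        ring
    _ = ∫ y in ball c r, max ‖y - c‖ r ^ (-b) := by
        refine setIntegral_congr_fun measurableSet_ball fun y hy => ?_
        rw [mem_ball, dist_eq_norm] at hy
        rw [max_eq_right hy.le]
    _ ≤ _ := by
        refine setIntegral_mono_set (integrableOn_ball_of_continuous hcont c ρ)
          (Eventually.of_forall fun y => ?_) (ball_subset_ball hρ).eventuallyLE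
        exact Real.rpow_nonneg (le_max_of_le_right hr.le) _

lemma log_le_integral_max {n : ℕ} (hn : 1 ≤ n) (c : Euc n) {r ρ : ℝ} (hr : 0 < r) (hρ : r ≤ ρ) :
    n * volume.real (ball (0 : Euc n) 1) * Real.log (ρ / r) ≤
      ∫ y in ball c ρ, max ‖y - c‖ r ^ (-(n : ℝ)) := by
  have : Nontrivial (Euc n) := by
    have : Nonempty (Fin n) := ⟨⟨0, hn⟩⟩
    infer_instance
  have hρ0 : 0 < ρ := hr.trans_le hρ
  rw [setIntegral_ball_sub (fun d => max d r ^ (-(n : ℝ)))]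
  have hcont : Continuous fun y : Euc n => max ‖y‖ r ^ (-(n : ℝ)) := by
    simpa using continuous_max_norm_rpow (0 : Euc n) hr n
  have hint := integrableOn_ball_of_continuous hcont 0 ρ
  have hone := (integrableOn_fun_norm_addHaar (E := Euc n) volume (r := ρ)
    (f := fun d => max d r ^ (-(n : ℝ)))).1 hint
  rw [← integral_indicator measurableSet_ball]
  have e : (ball (0 : Euc n) ρ).indicator (fun y => max ‖y‖ r ^ (-(n : ℝ))) =
      fun y => (Iio ρ).indicator (fun d => max d r ^ (-(n : ℝ))) ‖y‖ := by
    funext y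
    simp [indicator]
  rw [e, integral_fun_norm_addHaar, finrank_euclideanSpace_fin, nsmul_eq_mul, smul_eq_mul]
  rw [finrank_euclideanSpace_fin] at hone
  rw [mul_assoc]
  refine mul_le_mul_of_nonneg_left ?_ (by positivity)
  refine mul_le_mul_of_nonneg_left ?_ (by positivity)
  have e2 : ∫ y in Ioi (0 : ℝ), y ^ (n - 1) • (Iio ρ).indicator (fun d => max d r ^ (-(n : ℝ))) y
      = ∫ y in Ioo 0 ρ, y ^ (n - 1) • max y r ^ (-(n : ℝ)) := by
    rw [← Ioi_inter_Iio, ← setIntegral_indicator measurableSet_Iio]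
    congr 1
    funext y
    by_cases h : y < ρ <;> simp [indicator, h]
  rw [e2, ← integral_inv_of_pos hr hρ0, intervalIntegral.integral_of_le hρ,
    integral_Ioc_eq_integral_Ioo]
  calc ∫ x in Ioo r ρ, x⁻¹ = ∫ x in Ioo r ρ, x ^ (n - 1) • max x r ^ (-(n : ℝ)) := by
        refine setIntegral_congr_fun measurableSet_Ioo fun x hx => ?_
        have hx0 : 0 < x := hr.trans hx.1
        rw [max_eq_left hx.1.le, smul_eq_mul, Real.rpow_neg hx0.le, Real.rpow_natCast]
        obtain ⟨m, rfl⟩ := Nat.exists_eq_add_of_le hn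
        rw [Nat.add_sub_cancel_left, pow_add]
        field_simp
    _ ≤ _ := by
        refine setIntegral_mono_set hone ?_ (Ioo_subset_Ioo_left hr.le).eventuallyLE
        refine (ae_restrict_iff' measurableSet_Ioo).2 (Eventually.of_forall fun x hx => ?_)
        exact mul_nonneg (pow_nonneg hx.1.le _) (Real.rpow_nonneg (le_max_of_le_right hr.le) _)

lemma tendsto_rpow_nhdsGT_zero_of_pos {p : ℝ} (hp : 0 < p) :
    Tendsto (fun x : ℝ => x ^ p) (𝓝[>] 0) (𝓝 0) := by
  have h := (Real.continuousAt_rpow_const 0 p (Or.inr hp.le)).tendsto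
  rw [Real.zero_rpow hp.ne'] at h
  exact h.mono_left nhdsWithin_le_nhds

/-- The requirements on the mass `ε` and the width `r` of a peak at `c`: it has height at least `Q`,
the lower bound for the Choquard term dominates the Laplacian of the peak, and the `L^lam` norm of
the peak over `ball c ρ` is small. -/
def PeakCondition {n : ℕ} (α lam sig C E ρ Q η : ℝ) (c : Euc n) (ε r : ℝ) : Prop :=
  0 < ε ∧ ε ≤ E ∧ 0 < r ∧ r ≤ ρ ∧ Q ≤ ε * r ^ (-((n : ℝ) - 2)) ∧
  C * ε * r ^ (-(n : ℝ)) ≤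
    ε ^ lam * (∫ y in ball c ρ, max ‖y - c‖ r ^ (-(α + ((n : ℝ) - 2) * lam))) *
      (ε * r ^ (-((n : ℝ) - 2))) ^ sig ∧
  ε ^ lam * ∫ y in ball c ρ, max ‖y - c‖ r ^ (-(((n : ℝ) - 2) * lam)) ≤ η

lemma exists_peakCondition_of_lt {n : ℕ} (hn : 3 ≤ n) {α lam sig : ℝ} (hlam : 0 < lam)
    (hsig : 0 < sig) (hb : ((n : ℝ) - 2) * lam ≤ n)
    (hκ : 2 * (n : ℝ) - α < ((n : ℝ) - 2) * (lam + sig))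
    {C E ρ Q η : ℝ} (hE : 0 < E) (hρ : 0 < ρ) (hρ1 : ρ ≤ 1) (hη : 0 < η) (c : Euc n) :
    ∃ ε r, PeakCondition α lam sig C E ρ Q η c ε r := by
  have hn' : (3 : ℝ) ≤ n := by exact_mod_cast hn
  set m : ℝ := (n : ℝ) - 2 with hm
  have hm1 : 1 ≤ m := by linarith
  set κ : ℝ := m * (lam + sig) - (2 * n - α) with hκd
  have hκ0 : 0 < κ := by linarith
  set K : ℝ := 2 + (lam + sig) / κ with hK
  have hK2 : 2 ≤ K := by rw [hK]; linarith [show 0 < (lam + sig) / κ by positivity]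
  have hKκ : lam + sig ≤ K * κ := by
    rw [hK, add_mul, div_mul_cancel₀ _ hκ0.ne']; linarith
  set δ : ℝ := lam / (2 * K) with hδd
  have hδ0 : 0 < δ := by positivity
  have hKδ : K * δ = lam / 2 := by rw [hδd]; field_simp
  have hδb : δ ≤ m * lam := by nlinarith
  obtain ⟨J, hJ, hJint⟩ := exists_integral_max_le (n := n) (by omega) hδ0.le hδb (by linarith)
  set ω := volume.real (ball (0 : Euc n) 1)
  have hω : 0 < ω := volume_real_unit_ball_pos n
  have t₁ : Tendsto (fun ε : ℝ => ε) (𝓝[>] 0) (𝓝 0) := nhdsWithin_le_nhds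
  have t₂ : Tendsto (fun ε : ℝ => ε ^ K) (𝓝[>] 0) (𝓝 0) :=
    tendsto_rpow_nhdsGT_zero_of_pos (by linarith)
  have t₃ : Tendsto (fun ε : ℝ => ε ^ (1 - K * m)) (𝓝[>] 0) atTop :=
    tendsto_rpow_neg_nhdsGT_zero (by nlinarith)
  have t₄ : Tendsto (fun ε : ℝ => ω * ε ^ (lam + sig - 1 - K * κ)) (𝓝[>] 0) atTop :=
    (tendsto_rpow_neg_nhdsGT_zero (by linarith)).const_mul_atTop hω
  have t₅ : Tendsto (fun ε : ℝ => J * ε ^ (lam / 2)) (𝓝[>] 0) (𝓝 0) := by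
    simpa using (tendsto_rpow_nhdsGT_zero_of_pos (p := lam / 2) (by linarith)).const_mul J
  obtain ⟨ε, h₁, h₂, h₃, h₄, h₅, hε⟩ := ((t₁.eventually_le_const hE).and
    ((t₂.eventually_le_const hρ).and ((t₃.eventually_ge_atTop Q).and
    ((t₄.eventually_ge_atTop C).and ((t₅.eventually_le_const hη).and
    self_mem_nhdsWithin))))).exists
  have hε : 0 < ε := hε
  have hr : 0 < ε ^ K := by positivity
  refine ⟨ε, ε ^ K, hε, h₁, hr, h₂, ?_, ?_, ?_⟩
  · refine h₃.trans_eq ?_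
    rw [← Real.rpow_mul hε.le, sub_eq_add_neg, Real.rpow_add hε, Real.rpow_one]
    congr 2; ring
  · have hlow := le_integral_max c (b := α + m * lam) hr h₂
    calc C * ε * (ε ^ K) ^ (-(n : ℝ))
        ≤ ω * ε ^ (lam + sig - 1 - K * κ) * ε * (ε ^ K) ^ (-(n : ℝ)) := by gcongr
      _ = ε ^ lam * (ω * (ε ^ K) ^ ((n : ℝ) - (α + m * lam))) * (ε * (ε ^ K) ^ (-m)) ^ sig := by
        rw [Real.mul_rpow hε.le (by positivity)]
        simp only [← Real.rpow_mul hε.le]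
        rw [show ∀ a b c d : ℝ, a * (ω * b) * (c * d) = ω * (a * b * c * d) by intros; ring,
          show ∀ a b : ℝ, ω * a * ε * b = ω * (a * ε * b) by intros; ring]
        nth_rewrite 2 [← Real.rpow_one ε]
        simp only [← Real.rpow_add hε]
        congr 2
        rw [hκd]; ring
      _ ≤ _ := by gcongr
  · refine le_trans ?_ h₅
    calc _ ≤ ε ^ lam * (J * (ε ^ K) ^ (-δ)) := by
          gcongr
          exact hJint c _ _ hr hρ1
      _ = J * ε ^ (lam / 2) := by
        rw [← Real.rpow_mul hε.le, mul_left_comm, ← Real.rpow_add hε]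
        congr 2
        linarith

lemma exists_peakCondition_of_eq {n : ℕ} (hn : 3 ≤ n) {α lam sig : ℝ} (hα : 0 < α)
    (hlam : 0 < lam) (hb : α + ((n : ℝ) - 2) * lam = n)
    (hsig : (n : ℝ) ≤ ((n : ℝ) - 2) * sig)
    {C E ρ Q η : ℝ} (hE : 0 < E) (hρ : 0 < ρ) (hρ1 : ρ ≤ 1) (hη : 0 < η) (c : Euc n) :
    ∃ ε r, PeakCondition α lam sig C E ρ Q η c ε r := by
  have hn' : (3 : ℝ) ≤ n := by exact_mod_cast hn
  set m : ℝ := (n : ℝ) - 2 with hm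
  have hm1 : 1 ≤ m := by linarith
  have hmlam : 0 ≤ m * lam := by positivity
  obtain ⟨J, hJ, hJint⟩ := exists_integral_max_le (n := n) (by omega) le_rfl hmlam (by linarith)
  set ω := volume.real (ball (0 : Euc n) 1)
  have hω : 0 < ω := volume_real_unit_ball_pos n
  have t₁ : Tendsto (fun ε : ℝ => ε) (𝓝[>] 0) (𝓝 0) := nhdsWithin_le_nhds
  have t₂ : Tendsto (fun ε : ℝ => J * ε ^ lam) (𝓝[>] 0) (𝓝 0) := by
    simpa using (tendsto_rpow_nhdsGT_zero_of_pos hlam).const_mul J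
  obtain ⟨ε, h₁, h₂, hε⟩ := ((t₁.eventually_le_const hE).and
    ((t₂.eventually_le_const hη).and self_mem_nhdsWithin)).exists
  have hε : 0 < ε := hε
  have t₃ : Tendsto (fun r : ℝ => ε * r ^ (-m)) (𝓝[>] 0) atTop :=
    (tendsto_rpow_neg_nhdsGT_zero (by linarith)).const_mul_atTop hε
  have t₄ : Tendsto (fun r : ℝ => ε ^ lam * (n * ω * Real.log (ρ / r)) * ε ^ sig)
      (𝓝[>] 0) atTop := by
    refine Tendsto.atTop_mul_const (by positivity) (Tendsto.const_mul_atTop (by positivity)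
      (Tendsto.const_mul_atTop (by positivity) (Real.tendsto_log_atTop.comp ?_)))
    exact ((tendsto_inv_nhdsGT_zero (𝕜 := ℝ)).const_mul_atTop hρ).congr fun r =>
      (div_eq_mul_inv ρ r).symm
  obtain ⟨r, h₃, h₄, h₅, hr⟩ := ((t₃.eventually_ge_atTop Q).and
    ((t₄.eventually_ge_atTop (|C| * ε)).and
    ((t₁.eventually_le_const hρ).and self_mem_nhdsWithin))).exists
  have hr : 0 < r := hr
  refine ⟨ε, r, hε, h₁, hr, h₅, h₃, ?_, ?_⟩
  · rw [hb]
    have hlow := log_le_integral_max (n := n) (by omega) c hr h₅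
    calc C * ε * r ^ (-(n : ℝ))
        ≤ |C| * ε * r ^ (-(n : ℝ)) := by gcongr; exact le_abs_self C
      _ ≤ |C| * ε * r ^ (-m * sig) := by
        refine mul_le_mul_of_nonneg_left ?_ (by positivity)
        exact Real.rpow_le_rpow_of_exponent_ge hr (h₅.trans hρ1) (by linarith)
      _ ≤ ε ^ lam * (n * ω * Real.log (ρ / r)) * ε ^ sig * r ^ (-m * sig) := by gcongr
      _ ≤ ε ^ lam * (∫ y in ball c ρ, max ‖y - c‖ r ^ (-(n : ℝ))) * ε ^ sig * r ^ (-m * sig) := by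
        gcongr
      _ = _ := by
        rw [Real.mul_rpow hε.le (by positivity), ← Real.rpow_mul hr.le]
        ring
  · refine le_trans ?_ h₂
    rw [mul_comm J]
    gcongr
    simpa using hJint c r ρ hr hρ1

lemma ContDiffAt.lap_add {n : ℕ} {f g : Euc n → ℝ} {x : Euc n} (hf : ContDiffAt ℝ 2 f x)
    (hg : ContDiffAt ℝ 2 g x) : lap (fun y => f y + g y) x = lap f x + lap g x := by
  simp only [lap_eq_laplacian]
  exact hf.laplacian_add hg

lemma lap_congr {n : ℕ} {f g : Euc n → ℝ} {x : Euc n} (h : f =ᶠ[𝓝 x] g) : lap f x = lap g x := by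
  simp only [lap_eq_laplacian]
  exact (InnerProductSpace.laplacian_congr_nhds h).eq_of_nhds

/-- A peak of mass `ε` and width `r`, supported in the ball of radius `ρ` around `c`. -/
noncomputable def peak {n : ℕ} (c : Euc n) (ε r ρ : ℝ) (x : Euc n) : ℝ :=
  ε * (cappedPole c r x - cappedPole c ρ x)

lemma contDiff_peak {n : ℕ} (c : Euc n) (ε : ℝ) {r ρ : ℝ} (hr : 0 < r) (hρ : 0 < ρ) :
    ContDiff ℝ 2 (peak c ε r ρ) :=
  contDiff_const.mul ((contDiff_cappedPole c hr).sub (contDiff_cappedPole c hρ))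

lemma peak_of_le {n : ℕ} {c x : Euc n} {ε r ρ : ℝ} (hr : 0 < r) (hρ : r ≤ ρ) (h : ρ ≤ ‖x - c‖) :
    peak c ε r ρ x = 0 := by
  rw [peak, cappedPole_of_le hr (hρ.trans h), cappedPole_of_le (hr.trans_le hρ) h, sub_self,
    mul_zero]

lemma lap_peak {n : ℕ} (c x : Euc n) (ε : ℝ) {r ρ : ℝ} (hr : 0 < r) (hρ : 0 < ρ) :
    lap (peak c ε r ρ) x = ε * (lap (cappedPole c r) x - lap (cappedPole c ρ) x) := by
  have h₁ := (contDiff_cappedPole c hr).contDiffAt (x := x)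
  have h₂ := (contDiff_cappedPole c hρ).contDiffAt (x := x)
  simp only [lap_eq_laplacian]
  rw [← h₁.laplacian_sub h₂]
  exact InnerProductSpace.laplacian_smul ε (h₁.sub h₂)

lemma exists_peak_bounds {n : ℕ} (hn : 3 ≤ n) : ∃ C G : ℝ, 0 < C ∧ 1 ≤ G ∧
    ∀ ρ : ℝ, 0 < ρ → ∃ E : ℝ, 0 < E ∧ ∀ (c : Euc n) (ε r : ℝ), 0 < ε → ε ≤ E → 0 < r → r ≤ ρ →
      ∀ x, (ε * max ‖x - c‖ r ^ (-((n : ℝ) - 2)) - 1 ≤ peak c ε r ρ x ∧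
        peak c ε r ρ x ≤ G * (ε * max ‖x - c‖ r ^ (-((n : ℝ) - 2)))) ∧
        -1 ≤ -lap (peak c ε r ρ) x ∧ -lap (peak c ε r ρ) x ≤ C * ε * r ^ (-(n : ℝ)) ∧
        (r ≤ ‖x - c‖ → -lap (peak c ε r ρ) x ≤ 0) := by
  obtain ⟨C, hC, hlap⟩ := exists_lap_cappedPole_bounds hn
  obtain ⟨G, hG, hval⟩ := exists_cappedPole_bounds hn
  have hn' : (3 : ℝ) ≤ n := by exact_mod_cast hn
  refine ⟨C, G, hC, hG, fun ρ hρ => ?_⟩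
  have h₁ : 0 < C * ρ ^ (-(n : ℝ)) := by positivity
  have h₂ : 0 < G * ρ ^ (-((n : ℝ) - 2)) := by positivity
  refine ⟨min (C * ρ ^ (-(n : ℝ)))⁻¹ (G * ρ ^ (-((n : ℝ) - 2)))⁻¹, by positivity,
    fun c ε r hε hεE hr hrρ x => ?_⟩
  have e₁ : ε * (C * ρ ^ (-(n : ℝ))) ≤ 1 :=
    (le_inv_mul_iff₀' h₁).1 (by simpa using hεE.trans (min_le_left _ _))
  have e₂ : ε * (G * ρ ^ (-((n : ℝ) - 2))) ≤ 1 :=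
    (le_inv_mul_iff₀' h₂).1 (by simpa using hεE.trans (min_le_right _ _))
  have v₁ := hval c r hr x
  have v₂ := hval c ρ hρ x
  have l₁ := hlap c r hr x
  have l₂ := hlap c ρ hρ x
  have hmax : max ‖x - c‖ ρ ^ (-((n : ℝ) - 2)) ≤ ρ ^ (-((n : ℝ) - 2)) :=
    Real.rpow_le_rpow_of_nonpos hρ (le_max_right _ _) (by linarith)
  have hpos : 0 ≤ max ‖x - c‖ ρ ^ (-((n : ℝ) - 2)) := Real.rpow_nonneg (le_max_of_le_right hρ.le) _
  rw [lap_peak c x ε hr hρ, peak]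
  refine ⟨⟨?_, ?_⟩, ?_, ?_, fun h => ?_⟩
  · have a₁ := mul_le_mul_of_nonneg_left v₁.1 hε.le
    have a₂ := mul_le_mul_of_nonneg_left
      (v₂.2.trans (mul_le_mul_of_nonneg_left hmax (by linarith))) hε.le
    linarith
  · have a₁ := mul_le_mul_of_nonneg_left v₁.2 hε.le
    have a₂ := mul_nonneg hε.le (hpos.trans v₂.1)
    linarith
  · have a₁ := mul_nonneg hε.le l₁.1
    have a₂ := mul_le_mul_of_nonneg_left l₂.2 hε.le
    linarith
  · have a₁ := mul_le_mul_of_nonneg_left l₁.2 hε.le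
    have a₂ := mul_nonneg hε.le l₂.1
    linarith
  · rw [lap_cappedPole_of_le hr h]
    have a₂ := mul_nonneg hε.le l₂.1
    linarith

lemma exists_base {n : ℕ} {M : ℝ} (hM : 9 ≤ M) : ∃ V : Euc n → ℝ, ContDiff ℝ 2 V ∧
    HasCompactSupport V ∧ (∀ x, 0 ≤ V x ∧ V x ≤ M) ∧
    ∀ x ∈ ball (0 : Euc n) 2, M - 4 ≤ V x ∧ lap V x = -(2 * n) := by
  let f : ContDiffBump (0 : Euc n) := ⟨2, 3, by norm_num, by norm_num⟩
  have hsmooth : ContDiff ℝ 2 fun x : Euc n => M - ‖x‖ ^ 2 :=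
    contDiff_const.sub (contDiff_id.norm_sq ℝ)
  refine ⟨fun x => f x * (M - ‖x‖ ^ 2), f.contDiff.mul hsmooth, f.hasCompactSupport.mul_right,
    fun x => ?_, fun x hx => ?_⟩
  · have h0 := f.nonneg' x
    have h1 := f.le_one (x := x)
    have hsq := sq_nonneg ‖x‖
    rcases le_or_gt 3 ‖x‖ with h | h
    · have : f x = 0 := f.zero_of_le_dist (by simpa using h)
      simp only [this, zero_mul]
      exact ⟨le_rfl, by linarith⟩
    · have hnn := norm_nonneg x
      have h2 : 0 ≤ M - ‖x‖ ^ 2 := by nlinarith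
      exact ⟨mul_nonneg h0 h2, by nlinarith⟩
  · have hev : (fun x => f x * (M - ‖x‖ ^ 2)) =ᶠ[𝓝 x] fun x => M - ‖x - 0‖ ^ 2 := by
      filter_upwards [isOpen_ball.mem_nhds hx] with y hy
      rw [f.one_of_mem_closedBall (ball_subset_closedBall hy), one_mul, sub_zero]
    refine ⟨?_, ?_⟩
    · refine le_of_le_of_eq ?_ hev.eq_of_nhds.symm
      rw [sub_zero]
      have hx' : ‖x‖ < 2 := by simpa using hx
      nlinarith [norm_nonneg x]
    · rw [lap_congr hev, lap_radial (H := fun s => M - s) (H₁ := fun _ => -1) (H₂ := fun _ => 0)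
        (fun s => by simpa using (hasDerivAt_id s).const_sub M) (fun s => hasDerivAt_const s _)]
      ring

lemma integrable_norm_rpow_mul {n : ℕ} (hn : 1 ≤ n) {α δ B : ℝ} {g : Euc n → ℝ} {x : Euc n}
    (hα : 0 ≤ α) (hαn : α < n) (hδ : 0 < δ) (hg : Integrable g)
    (hB : ∀ y ∈ ball x δ, ‖g y‖ ≤ B) : Integrable fun y => ‖x - y‖ ^ (-α) * g y := by
  have hmeas : AEStronglyMeasurable (fun y : Euc n => ‖x - y‖ ^ (-α)) volume :=
    Measurable.aestronglyMeasurable (by fun_prop)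
  have hker : IntegrableOn (fun y : Euc n => ‖x - y‖ ^ (-α)) (ball x δ) := by
    have h := (integrable_indicator_iff measurableSet_ball).2 (integrableOn_ball_norm_rpow hn hαn δ)
    rw [← integrable_indicator_iff measurableSet_ball]
    refine (h.comp_sub_right x).congr (Eventually.of_forall fun y => ?_)
    simp [indicator, dist_eq_norm, norm_sub_rev y x]
  rw [← integrableOn_univ, ← union_compl_self (ball x δ)]
  refine IntegrableOn.union ?_ ?_
  · refine Integrable.mono' (hker.mul_const B) (hmeas.mul hg.1).restrict ?_
    refine (ae_restrict_iff' measurableSet_ball).2 (Eventually.of_forall fun y hy => ?_)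
    rw [norm_mul, Real.norm_of_nonneg (by positivity)]
    exact mul_le_mul_of_nonneg_left (hB y hy) (by positivity)
  · refine Integrable.mono' (hg.norm.const_mul (δ ^ (-α))).integrableOn
      (hmeas.mul hg.1).restrict ?_
    refine (ae_restrict_iff' measurableSet_ball.compl).2 (Eventually.of_forall fun y hy => ?_)
    rw [norm_mul, Real.norm_of_nonneg (by positivity)]
    refine mul_le_mul_of_nonneg_right ?_ (norm_nonneg _)
    have hy : δ ≤ ‖x - y‖ := by simpa [dist_eq_norm, norm_sub_rev y x] using hy
    exact Real.rpow_le_rpow_of_nonpos hδ hy (by linarith)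

lemma add_rpow_le_two_rpow_mul {a b p : ℝ} (ha : 0 ≤ a) (hb : 0 ≤ b) (hp : 0 ≤ p) :
    (a + b) ^ p ≤ 2 ^ p * (a ^ p + b ^ p) := by
  have hmax : (max a b) ^ p ≤ a ^ p + b ^ p := by
    have := Real.rpow_nonneg ha p
    have := Real.rpow_nonneg hb p
    rcases max_choice a b with h | h <;> rw [h] <;> linarith
  calc (a + b) ^ p ≤ (2 * max a b) ^ p := by
        refine Real.rpow_le_rpow (by positivity) ?_ hp
        linarith [le_max_left a b, le_max_right a b]
    _ = 2 ^ p * (max a b) ^ p := Real.mul_rpow (by norm_num) (le_max_of_le_left ha)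
    _ ≤ _ := by gcongr

lemma half_le_abs_sub_of_ne {s : ℝ} {j : ℕ} (h₁ : 3 / 8 * (1 / 4 : ℝ) ^ (j + 1) < s)
    (h₂ : j = 0 ∨ s ≤ 2 * (1 / 4 : ℝ) ^ (j + 1)) {k : ℕ} (hk : k ≠ j) :
    (1 / 4 : ℝ) ^ (k + 1) / 2 ≤ |s - (1 / 4 : ℝ) ^ (k + 1)| := by
  rcases lt_or_gt_of_ne hk with h | h
  · have hle : (1 / 4 : ℝ) ^ (j + 1) ≤ (1 / 4) ^ (k + 1 + 1) :=
      pow_le_pow_of_le_one (by norm_num) (by norm_num) (by omega)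
    rw [pow_succ _ (k + 1)] at hle
    have h₂ := h₂.resolve_left (by omega)
    rw [abs_sub_comm]
    exact le_trans (by linarith) (le_abs_self _)
  · have hle : (1 / 4 : ℝ) ^ (k + 1) ≤ (1 / 4) ^ (j + 1 + 1) :=
      pow_le_pow_of_le_one (by norm_num) (by norm_num) (by omega)
    rw [pow_succ _ (j + 1)] at hle
    exact le_trans (by linarith) (le_abs_self _)

lemma exists_eventually_half_le_abs_sub {n : ℕ} {x : Euc n} (hx : x ≠ 0) :
    ∃ j, ∀ᶠ y in 𝓝 x, ∀ k ≠ j, (1 / 4 : ℝ) ^ (k + 1) / 2 ≤ |‖y‖ - (1 / 4 : ℝ) ^ (k + 1)| := by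
  have hx0 : 0 < ‖x‖ := norm_pos_iff.2 hx
  have hex : ∃ j : ℕ, 3 / 8 * (1 / 4 : ℝ) ^ (j + 1) < ‖x‖ := by
    obtain ⟨j, hj⟩ := exists_pow_lt_of_lt_one hx0 (show (1 / 4 : ℝ) < 1 by norm_num)
    refine ⟨j, ?_⟩
    have : (0 : ℝ) < (1 / 4) ^ j := by positivity
    rw [pow_succ]
    linarith
  classical
  refine ⟨Nat.find hex, ?_⟩
  have h₂ : Nat.find hex = 0 ∨ ‖x‖ < 2 * (1 / 4 : ℝ) ^ (Nat.find hex + 1) := by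
    refine or_iff_not_imp_left.2 fun h0 => ?_
    have := Nat.find_min hex (m := Nat.find hex - 1) (by omega)
    rw [Nat.sub_add_cancel (by omega)] at this
    rw [pow_succ]
    have : (0 : ℝ) < (1 / 4) ^ Nat.find hex := by positivity
    linarith
  have e₁ : ∀ᶠ y : Euc n in 𝓝 x, 3 / 8 * (1 / 4 : ℝ) ^ (Nat.find hex + 1) < ‖y‖ :=
    continuous_norm.continuousAt.eventually (lt_mem_nhds (Nat.find_spec hex))
  have e₂ : ∀ᶠ y : Euc n in 𝓝 x,
      Nat.find hex = 0 ∨ ‖y‖ ≤ 2 * (1 / 4 : ℝ) ^ (Nat.find hex + 1) := by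
    rcases h₂ with h | h
    · exact Eventually.of_forall fun _ => Or.inl h
    · filter_upwards [continuous_norm.continuousAt.eventually (gt_mem_nhds h)] with y hy
      exact Or.inr (le_of_lt hy)
  filter_upwards [e₁, e₂] with y h₁ h₂ k hk
  exact half_le_abs_sub_of_ne h₁ h₂ hk

lemma integrable_rpow_of_peaks {n : ℕ} (hn : 3 ≤ n) {lam M G : ℝ} (hlam : 0 < lam) (hG : 0 ≤ G)
    {u V : Euc n → ℝ} {D : ℕ → Euc n → ℝ} {c : ℕ → Euc n} {ε r ρ : ℕ → ℝ}
    (hu : ∀ x, 0 ≤ u x) (hVc : Continuous V) (hVs : HasCompactSupport V) (hVM : ∀ x, V x ≤ M)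
    (hV0 : ∀ x, 0 ≤ V x) (hD : ∀ j, Continuous (D j))
    (hin : ∀ j, ∀ y ∈ ball (c j) (ρ j), u y = V y + D j y)
    (hout : ∀ y ∉ ⋃ j, ball (c j) (ρ j), u y = V y)
    (hDG : ∀ j y, D j y ≤ G * (ε j * max ‖y - c j‖ (r j) ^ (-((n : ℝ) - 2))))
    (hρ0 : ∀ j, 0 < ρ j) (hρ : ∀ j, ρ j ≤ (1 / 4) ^ j) (hr : ∀ j, 0 < r j) (hε : ∀ j, 0 < ε j)
    (hsmall : ∀ j, ε j ^ lam * ∫ y in ball (c j) (ρ j),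
      max ‖y - c j‖ (r j) ^ (-(((n : ℝ) - 2) * lam)) ≤ (1 / 2) ^ j) :
    Integrable fun y => u y ^ lam := by
  have hM0 : 0 ≤ M := (hV0 0).trans (hVM 0)
  rw [← integrableOn_univ, ← union_compl_self (⋃ j, ball (c j) (ρ j))]
  refine IntegrableOn.union ?_ ?_
  · have hi : ∀ j, IntegrableOn (fun y => u y ^ lam) (ball (c j) (ρ j)) := fun j =>
      (integrableOn_ball_of_continuous ((hVc.add (hD j)).rpow_const fun _ => Or.inr hlam.le)
        (c j) (ρ j)).congr_fun (fun y hy => by simp only [hin j y hy, Pi.add_apply])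
        measurableSet_ball
    refine integrableOn_iUnion_of_summable_integral_norm hi ?_
    set ω := volume.real (ball (0 : Euc n) 1)
    have hsum : Summable fun j : ℕ =>
        2 ^ lam * (M ^ lam * (ω * (1 / 4 : ℝ) ^ j) + G ^ lam * (1 / 2) ^ j) :=
      ((((summable_geometric_of_lt_one (by norm_num) (by norm_num)).mul_left ω).mul_left _).add
        ((summable_geometric_of_lt_one (by norm_num) (by norm_num)).mul_left _)).mul_left _
    refine Summable.of_nonneg_of_le (fun j => integral_nonneg fun y => norm_nonneg _)
      (fun j => ?_) hsum
    have hci := integrableOn_ball_of_continuous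
      (continuous_max_norm_rpow (c j) (hr j) (((n : ℝ) - 2) * lam)) (c j) (ρ j)
    have hvol : volume.real (ball (c j) (ρ j)) ≤ ω * (1 / 4) ^ j := by
      rw [measureReal_def, Measure.addHaar_ball_of_pos _ _ (hρ0 j), ENNReal.toReal_mul,
        ENNReal.toReal_ofReal (pow_nonneg (hρ0 j).le _), mul_comm, finrank_euclideanSpace_fin]
      refine mul_le_mul_of_nonneg_left ?_ measureReal_nonneg
      refine (pow_le_of_le_one (hρ0 j).le ?_ (by omega)).trans (hρ j)
      exact (hρ j).trans (pow_le_one₀ (by norm_num) (by norm_num))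
    have : IsFiniteMeasure (volume.restrict (ball (c j) (ρ j))) :=
      ⟨by simpa using measure_ball_lt_top⟩
    calc ∫ y in ball (c j) (ρ j), ‖u y ^ lam‖
        ≤ ∫ y in ball (c j) (ρ j), 2 ^ lam * (M ^ lam + G ^ lam * (ε j ^ lam *
            max ‖y - c j‖ (r j) ^ (-(((n : ℝ) - 2) * lam)))) := by
          refine setIntegral_mono_on (hi j).norm (((integrable_const _).add
            ((hci.const_mul _).const_mul _)).const_mul _) measurableSet_ball fun y hy => ?_
          have hm : 0 ≤ max ‖y - c j‖ (r j) := le_max_of_le_right (hr j).le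
          have hP : 0 ≤ max ‖y - c j‖ (r j) ^ (-((n : ℝ) - 2)) := Real.rpow_nonneg hm _
          rw [Real.norm_of_nonneg (Real.rpow_nonneg (hu y) _)]
          have hle : u y ≤ M + G * (ε j * max ‖y - c j‖ (r j) ^ (-((n : ℝ) - 2))) := by
            rw [hin j y hy]; exact add_le_add (hVM y) (hDG j y)
          have hεP := mul_nonneg (hε j).le hP
          refine (Real.rpow_le_rpow (hu y) hle hlam.le).trans
            ((add_rpow_le_two_rpow_mul hM0 (mul_nonneg hG hεP) hlam.le).trans_eq ?_)
          rw [Real.mul_rpow hG hεP, Real.mul_rpow (hε j).le hP, ← Real.rpow_mul hm, neg_mul]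
      _ = 2 ^ lam * (M ^ lam * volume.real (ball (c j) (ρ j)) + G ^ lam * (ε j ^ lam *
            ∫ y in ball (c j) (ρ j), max ‖y - c j‖ (r j) ^ (-(((n : ℝ) - 2) * lam)))) := by
          rw [integral_const_mul, integral_add (integrable_const _)
            ((hci.const_mul _).const_mul _), integral_const_mul, integral_const_mul,
            setIntegral_const, smul_eq_mul, mul_comm (volume.real _)]
      _ ≤ _ := by
          gcongr
          exact hsmall j
  · have hVi : Integrable fun y => V y ^ lam := by
      refine (hVc.rpow_const fun _ => Or.inr hlam.le).integrable_of_hasCompactSupport ?_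
      exact hVs.comp_left (g := fun s : ℝ => s ^ lam) (Real.zero_rpow hlam.ne')
    refine hVi.integrableOn.congr_fun (fun y hy => by simp only [hout y hy]) ?_
    exact (MeasurableSet.iUnion fun j => measurableSet_ball).compl

lemma setIntegral_le_integral_norm_rpow_mul {n : ℕ} (hn : 3 ≤ n) {α : ℝ} {f g : Euc n → ℝ}
    {s : Set (Euc n)} {x : Euc n} (hs : MeasurableSet s) (hf : IntegrableOn f s)
    (hint : Integrable fun y => ‖x - y‖ ^ (-α) * g y) (hg : ∀ y, 0 ≤ g y)
    (h : ∀ y ∈ s, y ≠ x → f y ≤ ‖x - y‖ ^ (-α) * g y) :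
    ∫ y in s, f y ≤ ∫ y, ‖x - y‖ ^ (-α) * g y := by
  have : Nonempty (Fin n) := ⟨⟨0, by omega⟩⟩
  have hx : ∀ᵐ y : Euc n, y ≠ x := by
    simp [ae_iff]
  calc ∫ y in s, f y ≤ ∫ y in s, ‖x - y‖ ^ (-α) * g y := by
        refine setIntegral_mono_on_ae hf hint.integrableOn hs ?_
        filter_upwards [hx] with y hy hys using h y hys hy
    _ ≤ _ := setIntegral_le_integral hint
        (Eventually.of_forall fun y => mul_nonneg (by positivity) (hg y))

lemma le_integral_of_le_on_unit_ball {n : ℕ} (hn : 3 ≤ n) {α lam L : ℝ} {u : Euc n → ℝ}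
    {x : Euc n} (hα : 0 ≤ α) (hlam : 0 ≤ lam) (hL : 0 ≤ L) (hu : ∀ y, 0 ≤ u y)
    (hint : Integrable fun y => ‖x - y‖ ^ (-α) * u y ^ lam) (hx : x ∈ ball (0 : Euc n) 2)
    (huL : ∀ y ∈ ball (0 : Euc n) 2, L ≤ u y) :
    volume.real (ball (0 : Euc n) 1) * (4 ^ (-α) * L ^ lam) ≤
      ∫ y, ‖x - y‖ ^ (-α) * u y ^ lam := by
  have h := setIntegral_le_integral_norm_rpow_mul hn (s := ball (0 : Euc n) 1) (x := x) (α := α)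
    (f := fun _ => 4 ^ (-α) * L ^ lam) measurableSet_ball
    (integrableOn_ball_of_continuous continuous_const _ _) hint
    (fun y => Real.rpow_nonneg (hu y) _) fun y hy hyx => ?_
  · simpa [setIntegral_const] using h
  · rw [mem_ball_zero_iff] at hx hy
    have h0 : 0 < ‖x - y‖ := norm_pos_iff.2 (sub_ne_zero.2 hyx.symm)
    refine mul_le_mul ?_ (Real.rpow_le_rpow hL (huL y (by rw [mem_ball_zero_iff]; linarith)) hlam)
      (by positivity) (by positivity)
    refine Real.rpow_le_rpow_of_nonpos h0 ?_ (by linarith)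
    linarith [norm_sub_le x y]

lemma le_integral_of_peak_le {n : ℕ} (hn : 3 ≤ n) {α lam ε r ρ : ℝ} {u : Euc n → ℝ}
    {c x : Euc n} (hα : 0 ≤ α) (hlam : 0 ≤ lam) (hε : 0 ≤ ε) (hr : 0 < r) (hu : ∀ y, 0 ≤ u y)
    (hint : Integrable fun y => ‖x - y‖ ^ (-α) * u y ^ lam) (hx : ‖x - c‖ < r)
    (huP : ∀ y ∈ ball c ρ, ε * max ‖y - c‖ r ^ (-((n : ℝ) - 2)) ≤ u y) :
    2 ^ (-α) * (ε ^ lam * ∫ y in ball c ρ, max ‖y - c‖ r ^ (-(α + ((n : ℝ) - 2) * lam))) ≤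
      ∫ y, ‖x - y‖ ^ (-α) * u y ^ lam := by
  rw [← integral_const_mul, ← integral_const_mul]
  refine setIntegral_le_integral_norm_rpow_mul hn measurableSet_ball
    (integrableOn_ball_of_continuous (continuous_const.mul (continuous_const.mul
      (continuous_max_norm_rpow c hr _))) _ _) hint
    (fun y => Real.rpow_nonneg (hu y) _) fun y hy hyx => ?_
  have h0 : 0 < ‖x - y‖ := norm_pos_iff.2 (sub_ne_zero.2 hyx.symm)
  have hm : 0 < max ‖y - c‖ r := lt_max_of_lt_right hr
  have hker : (2 * max ‖y - c‖ r) ^ (-α) ≤ ‖x - y‖ ^ (-α) := by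
    refine Real.rpow_le_rpow_of_nonpos h0 ?_ (by linarith)
    have := norm_sub_le (x - c) (y - c)
    rw [sub_sub_sub_cancel_right] at this
    linarith [le_max_left ‖y - c‖ r, le_max_right ‖y - c‖ r]
  have hpow := Real.rpow_le_rpow (by positivity) (huP y hy) hlam
  refine le_trans (le_of_eq ?_) (mul_le_mul hker hpow (by positivity) (by positivity))
  rw [Real.mul_rpow (by norm_num) hm.le, Real.mul_rpow hε (by positivity), ← Real.rpow_mul hm.le,
    neg_add, Real.rpow_add hm, neg_mul]
  ring

lemma neg_lap_le_of_peak {n : ℕ} {α sig C ε r I J : ℝ} {u V D : Euc n → ℝ} {c x : Euc n}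
    (hsig : 0 ≤ sig) (hε : 0 < ε) (hr : 0 < r) (hux : u =ᶠ[𝓝 x] fun y => V y + D y)
    (hV : ContDiffAt ℝ 2 V x) (hD : ContDiffAt ℝ 2 D x) (hVx : lap V x = -(2 * n))
    (hDx : -lap D x ≤ C * ε * r ^ (-(n : ℝ))) (hDx' : r ≤ ‖x - c‖ → -lap D x ≤ 0)
    (hI : 4 * n ≤ I) (hu1 : 1 ≤ u x) (huP : ε * max ‖x - c‖ r ^ (-((n : ℝ) - 2)) ≤ u x)
    (hJI : ‖x - c‖ < r → 2 ^ (-α) * J ≤ I)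
    (hJ : 2 ^ (α + 1) * C * ε * r ^ (-(n : ℝ)) ≤ J * (ε * r ^ (-((n : ℝ) - 2))) ^ sig) :
    -lap u x ≤ I * u x ^ sig := by
  have hn0 : (0 : ℝ) ≤ n := n.cast_nonneg
  have h1 : 1 ≤ u x ^ sig := Real.one_le_rpow hu1 hsig
  have hI1 : 4 * n ≤ I * u x ^ sig := hI.trans (le_mul_of_one_le_right (by linarith) h1)
  rw [lap_congr hux, hV.lap_add hD, hVx]
  rcases le_or_gt r ‖x - c‖ with h | h
  · linarith [hDx' h]
  · rw [max_eq_right h.le] at huP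
    have hsigle := Real.rpow_le_rpow (by positivity) huP hsig
    have h2 : 2 * (C * ε * r ^ (-(n : ℝ))) ≤ I * u x ^ sig :=
      calc 2 * (C * ε * r ^ (-(n : ℝ)))
          = 2 ^ (-α) * (2 ^ (α + 1) * C * ε * r ^ (-(n : ℝ))) := by
            have : (2 : ℝ) ^ (-α) * 2 ^ (α + 1) = 2 := by
              rw [← Real.rpow_add (by norm_num)]; simp
            linear_combination (-(C * ε * r ^ (-(n : ℝ)))) * this
        _ ≤ 2 ^ (-α) * (J * (ε * r ^ (-((n : ℝ) - 2))) ^ sig) := by gcongr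
        _ = 2 ^ (-α) * J * (ε * r ^ (-((n : ℝ) - 2))) ^ sig := by ring
        _ ≤ I * (ε * r ^ (-((n : ℝ) - 2))) ^ sig :=
            mul_le_mul_of_nonneg_right (hJI h) (by positivity)
        _ ≤ _ := mul_le_mul_of_nonneg_left hsigle (by linarith)
    linarith

lemma integrable_norm_rpow_mul_rpow {n : ℕ} (hn : 3 ≤ n) {α lam : ℝ} {u : Euc n → ℝ} {x : Euc n}
    (hα : 0 ≤ α) (hαn : α < n) (hlam : 0 ≤ lam) (hc : ContinuousOn u {0}ᶜ) (hx : x ≠ 0)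
    (hint : Integrable fun y => u y ^ lam) :
    Integrable fun y => ‖x - y‖ ^ (-α) * u y ^ lam := by
  have hx0 : 0 < ‖x‖ := norm_pos_iff.2 hx
  have hsub : closedBall x (‖x‖ / 2) ⊆ {0}ᶜ := by
    rintro y hy rfl
    simp only [mem_closedBall, dist_zero_left] at hy
    linarith
  obtain ⟨B, hB⟩ := (isCompact_closedBall x (‖x‖ / 2)).exists_bound_of_continuousOn
    ((hc.mono hsub).rpow_const fun _ _ => Or.inr hlam)
  exact integrable_norm_rpow_mul (by omega) hα hαn (half_pos hx0) hint
    fun y hy => hB y (ball_subset_closedBall hy)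

lemma exists_isCPSolution_with_peaks {n : ℕ} (hn : 3 ≤ n) {α lam sig : ℝ} (hα : 0 ≤ α)
    (hαn : α < n) (hlam : 0 < lam) (hsig : 0 ≤ sig)
    (hpeak : ∀ C E ρ Q η : ℝ, ∀ c : Euc n, 0 < E → 0 < ρ → ρ ≤ 1 → 0 < η →
      ∃ ε r, PeakCondition α lam sig C E ρ Q η c ε r) (Q : ℕ → ℝ) :
    ∃ u : Euc n → ℝ, IsCPSolution n α lam sig u ∧
      ∃ c : ℕ → Euc n, ∀ j, ‖c j‖ = (1 / 4) ^ (j + 1) ∧ Q j ≤ u (c j) := by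
  have hn' : (3 : ℝ) ≤ n := by exact_mod_cast hn
  obtain ⟨C, G, -, hG, hbounds⟩ := exists_peak_bounds hn
  have ht0 (j : ℕ) : (0 : ℝ) < (1 / 4) ^ (j + 1) := by positivity
  have ht1 (j : ℕ) : (1 / 4 : ℝ) ^ (j + 1) ≤ 1 / 4 :=
    (pow_le_pow_of_le_one (by norm_num) (by norm_num) (Nat.le_add_left 1 j)).trans_eq (pow_one _)
  have hρ0 (j : ℕ) : (0 : ℝ) < (1 / 4) ^ (j + 1) / 2 := half_pos (ht0 j)
  choose E hE hE' using fun j : ℕ => hbounds ((1 / 4) ^ (j + 1) / 2) (hρ0 j)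
  obtain ⟨c, hc⟩ : ∃ c : ℕ → Euc n, ∀ j, ‖c j‖ = (1 / 4) ^ (j + 1) :=
    ⟨fun j => EuclideanSpace.single ⟨0, by omega⟩ ((1 / 4) ^ (j + 1)), fun j => by simp⟩
  choose ε r hε hεE hr hrρ hQ hJ hη using fun j : ℕ =>
    hpeak (2 ^ (α + 1) * C) (E j) ((1 / 4) ^ (j + 1) / 2) (Q j) ((1 / 2) ^ j) (c j) (hE j) (hρ0 j)
      (by linarith [ht1 j]) (by positivity)
  obtain ⟨L, hL4, hLω⟩ : ∃ L : ℝ, 4 ≤ L ∧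
      4 * n ≤ volume.real (ball (0 : Euc n) 1) * (4 ^ (-α) * L ^ lam) :=
    ((eventually_ge_atTop 4).and ((((tendsto_rpow_atTop hlam).const_mul_atTop
      (show (0 : ℝ) < 4 ^ (-α) by positivity)).const_mul_atTop
      (volume_real_unit_ball_pos n)).eventually_ge_atTop _)).exists
  obtain ⟨V, hV, hVs, hVM, hVb⟩ := exists_base (n := n) (M := L + 5) (by linarith)
  set D : ℕ → Euc n → ℝ := fun j => peak (c j) (ε j) (r j) ((1 / 4) ^ (j + 1) / 2) with hDdef
  have hD (j : ℕ) : ContDiff ℝ 2 (D j) := contDiff_peak _ _ (hr j) (hρ0 j)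
  have hDb (j : ℕ) := hE' j (c j) (ε j) (r j) (hε j) (hεE j) (hr j) (hrρ j)
  have hP (j : ℕ) (y : Euc n) : 0 ≤ ε j * max ‖y - c j‖ (r j) ^ (-((n : ℝ) - 2)) :=
    mul_nonneg (hε j).le (Real.rpow_nonneg (le_max_of_le_right (hr j).le) _)
  have hDzero (k : ℕ) (y : Euc n) (h : (1 / 4 : ℝ) ^ (k + 1) / 2 ≤ |‖y‖ - (1 / 4 : ℝ) ^ (k + 1)|) :
      D k y = 0 := by
    refine peak_of_le (hr k) (hrρ k) (h.trans ?_)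
    rw [← hc k]
    exact abs_norm_sub_norm_le y (c k)
  set u : Euc n → ℝ := fun y => V y + ∑' k, D k y with hudef
  have hueq (j : ℕ) (y : Euc n)
      (h : ∀ k ≠ j, (1 / 4 : ℝ) ^ (k + 1) / 2 ≤ |‖y‖ - (1 / 4 : ℝ) ^ (k + 1)|) :
      u y = V y + D j y := by
    simp only [hudef]
    rw [tsum_eq_single j fun k hk => hDzero k y (h k hk)]
  have hloc (x : Euc n) (hx : x ≠ 0) : ∃ j, u =ᶠ[𝓝 x] fun y => V y + D j y := by
    obtain ⟨j, hj⟩ := exists_eventually_half_le_abs_sub hx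
    exact ⟨j, hj.mono fun y hy => hueq j y hy⟩
  have hnorm (j : ℕ) (y : Euc n) (hy : y ∈ ball (c j) ((1 / 4) ^ (j + 1) / 2)) :
      |‖y‖ - (1 / 4 : ℝ) ^ (j + 1)| < (1 / 4 : ℝ) ^ (j + 1) / 2 := by
    rw [← hc j] at hy ⊢
    rw [mem_ball, dist_eq_norm] at hy
    exact (abs_norm_sub_norm_le y (c j)).trans_lt hy
  have hball (j : ℕ) (y : Euc n) (hy : y ∈ ball (c j) ((1 / 4) ^ (j + 1) / 2)) :
      y ∈ ball (0 : Euc n) 2 := by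
    rw [mem_ball_zero_iff]
    linarith [(abs_lt.1 (hnorm j y hy)).2, ht1 j]
  have hin (j : ℕ) (y : Euc n) (hy : y ∈ ball (c j) ((1 / 4) ^ (j + 1) / 2)) :
      u y = V y + D j y := by
    have h := abs_lt.1 (hnorm j y hy)
    refine hueq j y fun k hk => half_le_abs_sub_of_ne ?_ (Or.inr ?_) hk <;> linarith [ht0 j]
  have hout (y : Euc n) (hy : y ∉ ⋃ j, ball (c j) ((1 / 4) ^ (j + 1) / 2)) : u y = V y := by
    simp only [mem_iUnion, not_exists, mem_ball, not_lt, dist_eq_norm] at hy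
    have : ∀ k, D k y = 0 := fun k => peak_of_le (hr k) (hrρ k) (hy k)
    simp [hudef, this]
  have hlow (j : ℕ) (y : Euc n) (hy : y ∈ ball (0 : Euc n) 2) (huy : u y = V y + D j y) :
      L + ε j * max ‖y - c j‖ (r j) ^ (-((n : ℝ) - 2)) ≤ u y := by
    have := (hDb j y).1.1
    rw [huy]
    linarith [(hVb y hy).1]
  have huL (y : Euc n) (hy : y ∈ ball (0 : Euc n) 2) : L ≤ u y := by
    by_cases h : y ∈ ⋃ j, ball (c j) ((1 / 4) ^ (j + 1) / 2)
    · obtain ⟨j, hj⟩ := mem_iUnion.1 h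
      linarith [hlow j y hy (hin j y hj), hP j y]
    · rw [hout y h]
      linarith [(hVb y hy).1]
  have hu0 (y : Euc n) : 0 ≤ u y := by
    by_cases h : y ∈ ⋃ j, ball (c j) ((1 / 4) ^ (j + 1) / 2)
    · obtain ⟨j, hj⟩ := mem_iUnion.1 h
      linarith [huL y (hball j y hj)]
    · rw [hout y h]
      exact (hVM y).1
  have hsmooth : ContDiffOn ℝ 2 u {0}ᶜ := fun x hx => by
    obtain ⟨j, hj⟩ := hloc x hx
    exact ((hV.add (hD j)).contDiffAt.congr_of_eventuallyEq hj).contDiffWithinAt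
  have hint : Integrable fun y => u y ^ lam :=
    integrable_rpow_of_peaks hn hlam (by linarith) hu0 hV.continuous hVs (fun x => (hVM x).2)
      (fun x => (hVM x).1) (fun j => (hD j).continuous) hin hout (fun j y => (hDb j y).1.2) hρ0
      (fun j => by rw [pow_succ]; linarith [show (0 : ℝ) < (1 / 4) ^ j by positivity]) hr hε hη
  refine ⟨u, ⟨hu0, hsmooth, hint, fun x hx => ?_⟩, c, fun j => ⟨hc j, ?_⟩⟩
  · obtain ⟨hx2, hx0⟩ := hx
    obtain ⟨j, hj⟩ := hloc x hx0
    have hkint := integrable_norm_rpow_mul_rpow hn hα hαn hlam.le hsmooth.continuousOn hx0 hint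
    have hux := hlow j x hx2 hj.eq_of_nhds
    constructor
    · rw [lap_congr hj, hV.contDiffAt.lap_add (hD j).contDiffAt, (hVb x hx2).2]
      linarith [(hDb j x).2.1]
    · exact neg_lap_le_of_peak (J := ε j ^ lam * ∫ y in ball (c j) ((1 / 4) ^ (j + 1) / 2),
          max ‖y - c j‖ (r j) ^ (-(α + ((n : ℝ) - 2) * lam))) hsig (hε j) (hr j) hj hV.contDiffAt
        (hD j).contDiffAt (hVb x hx2).2 (hDb j x).2.2.1 (hDb j x).2.2.2
        (hLω.trans (le_integral_of_le_on_unit_ball hn hα hlam.le (by linarith) hu0 hkint hx2 huL))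
        (by linarith [huL x hx2]) (by linarith)
        (fun hxc => le_integral_of_peak_le hn hα hlam.le (hε j).le (hr j) hu0 hkint hxc
          fun y hy => by linarith [hlow j y (hball j y hy) (hin j y hy)]) (hJ j)
  · have hcj := mem_ball_self (x := c j) (hρ0 j)
    have := hlow j (c j) (hball j _ hcj) (hin j _ hcj)
    rw [sub_self, norm_zero, max_eq_right (hr j).le] at this
    linarith [hQ j]

theorem stmt13 (n : ℕ) (hn : 3 ≤ n) (α lam sig : ℝ)
    (hα0 : 0 < α) (hαn : α < n)
    (hlam0 : ((n : ℝ) - α) / ((n : ℝ) - 2) ≤ lam) (hlam1 : lam ≤ (n : ℝ) / ((n : ℝ) - 2))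
    (hsig1 : lam = ((n : ℝ) - α) / ((n : ℝ) - 2) → (n : ℝ) / ((n : ℝ) - 2) ≤ sig)
    (hsig2 : ((n : ℝ) - α) / ((n : ℝ) - 2) < lam → lam < (n : ℝ) / ((n : ℝ) - 2) →
      (2 * (n : ℝ) - α) / ((n : ℝ) - 2) - lam < sig)
    (hsig3 : lam = (n : ℝ) / ((n : ℝ) - 2) → ((n : ℝ) - α) / ((n : ℝ) - 2) < sig)
    (φ : ℝ → ℝ) (hφc : ContinuousOn φ (Ioo 0 1))
    (hφp : ∀ t ∈ Ioo (0:ℝ) 1, 0 < φ t)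
    (hφl : Tendsto φ (𝓝[>] (0:ℝ)) atTop) :
    ∃ u : Euc n → ℝ, IsCPSolution n α lam sig u ∧ NotBigOAt n u φ := by
  have hn' : (3 : ℝ) ≤ n := by exact_mod_cast hn
  have hm : (0 : ℝ) < (n : ℝ) - 2 := by linarith
  have hlam : 0 < lam := (div_pos (by linarith) hm).trans_le hlam0
  have hpeak : 0 ≤ sig ∧ ∀ C E ρ Q η : ℝ, ∀ c : Euc n, 0 < E → 0 < ρ → ρ ≤ 1 → 0 < η →
      ∃ ε r, PeakCondition α lam sig C E ρ Q η c ε r := by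
    rcases hlam0.eq_or_lt with h | h
    · have hs := hsig1 h.symm
      refine ⟨(div_pos (by linarith) hm).le.trans hs, fun C E ρ Q η c hE hρ hρ1 hη => ?_⟩
      rw [div_le_iff₀' hm] at hs
      rw [div_eq_iff hm.ne'] at h
      exact exists_peakCondition_of_eq hn hα0 hlam (by linarith) hs hE hρ hρ1 hη c
    · have hs : (2 * (n : ℝ) - α) / ((n : ℝ) - 2) - lam < sig := by
        rcases hlam1.eq_or_lt with h' | h'
        · refine lt_of_eq_of_lt ?_ (hsig3 h')
          rw [h', ← sub_div]
          ring
        · exact hsig2 h h'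
      have hs0 : 0 < sig := by
        refine lt_of_le_of_lt ?_ hs
        have := div_pos (show 0 < (n : ℝ) - α by linarith) hm
        have h2 : (2 * (n : ℝ) - α) / ((n : ℝ) - 2) =
          (n : ℝ) / ((n : ℝ) - 2) + ((n : ℝ) - α) / ((n : ℝ) - 2) := by ring
        linarith
      rw [sub_lt_iff_lt_add', div_lt_iff₀' hm] at hs
      rw [le_div_iff₀' hm] at hlam1
      exact ⟨hs0.le, fun C E ρ Q η c hE hρ hρ1 hη =>
        exists_peakCondition_of_lt hn hlam hs0 hlam1 hs hE hρ hρ1 hη c⟩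
  obtain ⟨u, hu, c, hc⟩ := exists_isCPSolution_with_peaks hn hα0.le hαn hlam hpeak.1 hpeak.2
    fun j => j * φ ((1 / 4) ^ (j + 1))
  refine ⟨u, hu, c, fun j => norm_pos_iff.1 ?_, ?_, ?_⟩
  · rw [(hc j).1]
    positivity
  · refine tendsto_zero_iff_norm_tendsto_zero.2 ?_
    simp only [(hc _).1]
    exact (tendsto_pow_atTop_nhds_zero_of_lt_one (by norm_num) (by norm_num)).comp
      (tendsto_add_atTop_nat 1)
  · refine tendsto_atTop_mono (fun j => ?_) tendsto_natCast_atTop_atTop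
    rw [(hc j).1, le_div_iff₀ (hφp _ ⟨by positivity, pow_lt_one₀ (by norm_num) (by norm_num)
      (by omega)⟩)]
    exact (hc j).2
end
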